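/- Under the standing hypotheses on H, the following properties are equivalent for a continuous function u : [t₀,t₁] × 𝕋 → ℝ and c ∈ ℝ: (i) u is a viscosity solution of ∂_t u + H(t,x,c+∂_x u) = 0 in the classical Crandall–Lions sense; (ii) u is locally Lipschitz on (t₀,t₁] × 𝕋, satisfies ∂_t u + H(t,x,c+∂_x u) = 0 almost everywhere, and there exists a nonincreasing function K : (t₀,t₁] → (0,∞) such that u_t is K(t)-semi-concave for every t ∈ (t₀,t₁]; (iii) for all t, t' with t₀ ≤ t ≤ t' ≤ t₁ one has u_{t'} = V^c_{t,t'}(u_t). -/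

import Mathlib

open MeasureTheory Filter Set Topology

noncomputable section

/-- The Hamiltonian vector field `X(t,x,p) = (∂_p H, -∂_x H)` on `𝕋 × ℝ` (lifted to `ℝ × ℝ`). -/
def HamVF (H : ℝ → ℝ → ℝ → ℝ) (t : ℝ) (z : ℝ × ℝ) : ℝ × ℝ :=
  (deriv (fun p => H t z.1 p) z.2, - deriv (fun x => H t x z.2) z.1)

/-- The standing hypotheses on the Hamiltonian `H`, with the circle `𝕋 = ℝ/ℤ` modelled by
`1`-periodicity in the space variable `x`. -/
structure BurgersHyp (H : ℝ → ℝ → ℝ → ℝ) : Prop where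
  smooth : ContDiff ℝ 2 (fun q : ℝ × ℝ × ℝ => H q.1 q.2.1 q.2.2)
  per_t : ∀ t x p, H (t + 1) x p = H t x p
  per_x : ∀ t x p, H t (x + 1) p = H t x p
  convexp : ∀ t x p, 0 < iteratedDeriv 2 (fun q => H t x q) p
  superlinear : ∀ t x, Tendsto (fun p => H t x p / |p|) (Bornology.cobounded ℝ) atTop
  complete : ∀ t₀ : ℝ, ∀ z₀ : ℝ × ℝ,
    ∃ γ : ℝ → ℝ × ℝ, γ t₀ = z₀ ∧ ∀ t, HasDerivAt γ (HamVF H t (γ t)) t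

/-- The Lagrangian associated to `H` by Legendre duality. -/
def Lag (H : ℝ → ℝ → ℝ → ℝ) (t x v : ℝ) : ℝ := sSup (range fun p => p * v - H t x p)

/-- `ξ` is absolutely continuous on `[a,b]` with (a.e.) derivative `g`. -/
def IsAC (ξ g : ℝ → ℝ) (a b : ℝ) : Prop :=
  IntervalIntegrable g volume a b ∧ ∀ t ∈ Icc a b, ξ t = ξ a + ∫ s in a..t, g s

/-- The set of values over which the Hopf–Lax–Oleinik infimum is taken. -/
def hloSet (H : ℝ → ℝ → ℝ → ℝ) (c a b : ℝ) (u : ℝ → ℝ) (x : ℝ) : Set ℝ :=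
  {v | ∃ ξ g : ℝ → ℝ, IsAC ξ g a b ∧ ξ b = x ∧
    IntervalIntegrable (fun s => Lag H s (ξ s) (g s) - c * g s) volume a b ∧
    v = u (ξ a) + ∫ s in a..b, (Lag H s (ξ s) (g s) - c * g s)}

/-- The Hopf–Lax–Oleinik operator `V^c_{a,b}`. -/
def hlo (H : ℝ → ℝ → ℝ → ℝ) (c a b : ℝ) (u : ℝ → ℝ) (x : ℝ) : ℝ := sInf (hloSet H c a b u x)

/-- Viscosity subsolution of `∂_t u + H(t,x,c+∂_x u) = a` on `D`. -/
def ViscSubSol (H : ℝ → ℝ → ℝ → ℝ) (c a : ℝ) (D : Set (ℝ × ℝ)) (u : ℝ → ℝ → ℝ) : Prop :=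
  ∀ φ : ℝ × ℝ → ℝ, ContDiff ℝ 1 φ → ∀ z ∈ D,
    IsLocalMax (fun w : ℝ × ℝ => u w.1 w.2 - φ w) z →
    fderiv ℝ φ z (1, 0) + H z.1 z.2 (c + fderiv ℝ φ z (0, 1)) ≤ a

/-- Viscosity supersolution of `∂_t u + H(t,x,c+∂_x u) = a` on `D`. -/
def ViscSuperSol (H : ℝ → ℝ → ℝ → ℝ) (c a : ℝ) (D : Set (ℝ × ℝ)) (u : ℝ → ℝ → ℝ) : Prop :=
  ∀ φ : ℝ × ℝ → ℝ, ContDiff ℝ 1 φ → ∀ z ∈ D,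
    IsLocalMin (fun w : ℝ × ℝ => u w.1 w.2 - φ w) z →
    a ≤ fderiv ℝ φ z (1, 0) + H z.1 z.2 (c + fderiv ℝ φ z (0, 1))

/-- Viscosity solution (Crandall–Lions) of `∂_t u + H(t,x,c+∂_x u) = a` on `D`. -/
def ViscSol (H : ℝ → ℝ → ℝ → ℝ) (c a : ℝ) (D : Set (ℝ × ℝ)) (u : ℝ → ℝ → ℝ) : Prop :=
  ViscSubSol H c a D u ∧ ViscSuperSol H c a D u

/-- Viscosity solution of `(HJc)` on `[t₀,∞) × 𝕋`: continuous up to `t₀`, `1`-periodic in `x`,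
and a viscosity solution for `t > t₀`. -/
def IsViscSolOn (H : ℝ → ℝ → ℝ → ℝ) (c t₀ : ℝ) (u : ℝ → ℝ → ℝ) : Prop :=
  ContinuousOn (fun z : ℝ × ℝ => u z.1 z.2) (Ici t₀ ×ˢ univ) ∧
  (∀ t x, u t (x + 1) = u t x) ∧
  ViscSol H c 0 (Ioi t₀ ×ˢ univ) u

/-- `w` is `K`-semi-concave: `∂_xx w ≤ K` in the sense of distributions. -/
def SemiConcaveK (w : ℝ → ℝ) (K : ℝ) : Prop :=
  ConcaveOn ℝ univ (fun x => w x - K * x ^ 2 / 2)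

/-- The class `ℰ`: functions that are (locally) the sum of a continuous and a
nonincreasing function. -/
def EClass (f : ℝ → ℝ) : Prop :=
  ∃ g h : ℝ → ℝ, Continuous g ∧ Antitone h ∧ ∀ x, f x = g x + h x

/-- Right limit `f⁻(x)`. -/
def rlim (f : ℝ → ℝ) (q : ℝ) : ℝ := limUnder (nhdsWithin q (Ioi q)) f

/-- Left limit `f⁺(x)`. -/
def llim (f : ℝ → ℝ) (q : ℝ) : ℝ := limUnder (nhdsWithin q (Iio q)) f

def Gminus (f : ℝ → ℝ) : Set (ℝ × ℝ) := {z | z.2 = rlim f z.1}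
def Gplus (f : ℝ → ℝ) : Set (ℝ × ℝ) := {z | z.2 = llim f z.1}

/-- The graph `G(f) = G⁻(f) ∩ G⁺(f)`. -/
def Ggraph (f : ℝ → ℝ) : Set (ℝ × ℝ) := Gminus f ∩ Gplus f

/-- The closure of the graph, `G⁻(f) ∪ G⁺(f)`. -/
def Gbar (f : ℝ → ℝ) : Set (ℝ × ℝ) := Gminus f ∪ Gplus f

/-- The Jordan curve `H(f) = ⋃_x {x} × [f⁻(x), f⁺(x)]` (one period). -/
def Hset (f : ℝ → ℝ) : Set (ℝ × ℝ) :=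
  {z | z.1 ∈ Icc (0:ℝ) 1 ∧ z.2 ∈ Icc (rlim f z.1) (llim f z.1)}

/-- Entropy solution of `∂_t y + ∂_x (H(t,x,y)) = 0` on `[t₀,∞) × 𝕋` (with its own
initial trace at `t₀`): distributional solution satisfying the Oleinik inequalities. -/
def IsEntropySolOn (H : ℝ → ℝ → ℝ → ℝ) (t₀ : ℝ) (y : ℝ → ℝ → ℝ) : Prop :=
  (∀ t x, t₀ ≤ t → y t (x + 1) = y t x) ∧
  (∀ T, t₀ < T →
    IntegrableOn (fun z : ℝ × ℝ => y z.1 z.2) (Icc t₀ T ×ˢ Icc (0:ℝ) 1) volume ∧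
    IntegrableOn (fun z : ℝ × ℝ => H z.1 z.2 (y z.1 z.2)) (Icc t₀ T ×ˢ Icc (0:ℝ) 1) volume) ∧
  (∀ φ : ℝ × ℝ → ℝ, ContDiff ℝ 2 φ → (∀ t x, φ (t, x + 1) = φ (t, x)) →
    (∃ T, ∀ t x, T ≤ t → φ (t, x) = 0) →
    (∫ z in Ioi t₀ ×ˢ Ioc (0:ℝ) 1,
      (y z.1 z.2 * fderiv ℝ φ z (1, 0) + H z.1 z.2 (y z.1 z.2) * fderiv ℝ φ z (0, 1)))
      + ∫ x in (0:ℝ)..1, y t₀ x * φ (t₀, x) = 0) ∧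
  (∃ K : ℝ → ℝ, (∀ t, t₀ < t → 0 < K t) ∧ AntitoneOn K (Ioi t₀) ∧
    ∀ t, t₀ < t → ∀ x δ, 0 < δ → y t (x + δ) - y t x ≤ K t * δ)

/-- `ξ` (with a.e. derivative `g`) is calibrated by `u` on `[a,b]`. -/
def CalibratedCurve (H : ℝ → ℝ → ℝ → ℝ) (c : ℝ) (u : ℝ → ℝ → ℝ)
    (ξ g : ℝ → ℝ) (a b : ℝ) : Prop :=
  IsAC ξ g a b ∧
  IntervalIntegrable (fun s => Lag H s (ξ s) (g s) - c * g s) volume a b ∧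
  u b (ξ b) = u a (ξ a) + ∫ s in a..b, (Lag H s (ξ s) (g s) - c * g s)

/-- `φ t₀ t` is the (lifted) flow of the Hamiltonian vector field of `H` between times
`t₀` and `t`. -/
def IsHamFlow (H : ℝ → ℝ → ℝ → ℝ) (φ : ℝ → ℝ → ℝ × ℝ → ℝ × ℝ) : Prop :=
  (∀ t₀ z, φ t₀ t₀ z = z) ∧
  (∀ t₀ z t, HasDerivAt (fun s => φ t₀ s z) (HamVF H t (φ t₀ t z)) t) ∧
  (∀ t₀ t, Function.Bijective (φ t₀ t)) ∧
  (∀ t₀ t z, φ t₀ t (z + ((1:ℝ), (0:ℝ))) = φ t₀ t z + ((1:ℝ), (0:ℝ)))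

/-- Periodic, measurable, integrable over a period: a representative of an element of
`L¹(𝕋)`. -/
def PerInt (y : ℝ → ℝ) : Prop :=
  (∀ x, y (x + 1) = y x) ∧ Measurable y ∧ IntervalIntegrable y volume 0 1

/-- `E` is the time-one entropy evolution operator of `H` (extended to `L¹(𝕋)` by
`L¹`-continuity; it is considered up to a.e. equality, and satisfies the Oleinik bound). -/
structure IsEntropyOp (H : ℝ → ℝ → ℝ → ℝ) (E : (ℝ → ℝ) → (ℝ → ℝ)) : Prop where
  sol : ∀ y₀ : ℝ → ℝ, PerInt y₀ → (∃ M, ∀ x, |y₀ x| ≤ M) →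
    ∃ y : ℝ → ℝ → ℝ, IsEntropySolOn H 0 y ∧ (∀ x, y 0 x = y₀ x) ∧ (∀ x, E y₀ x = y 1 x)
  maps : ∀ y, PerInt y → PerInt (E y)
  oleinik : ∀ y, PerInt y → ∃ K, 0 < K ∧ ∀ x δ, 0 < δ → E y (x + δ) - E y x ≤ K * δ
  cont : ∀ y : ℝ → ℝ, PerInt y → ∀ z : ℕ → ℝ → ℝ, (∀ n, PerInt (z n)) →
    Tendsto (fun n => ∫ x in (0:ℝ)..1, |z n x - y x|) atTop (𝓝 0) →
    Tendsto (fun n => ∫ x in (0:ℝ)..1, |E (z n) x - E y x|) atTop (𝓝 0)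

/-- Mather's alpha function: `C¹`, convex, superlinear, and every viscosity solution `u`
of `(HJc)` has `u + tα(c)` bounded. -/
def MatherAlpha (H : ℝ → ℝ → ℝ → ℝ) (α : ℝ → ℝ) : Prop :=
  ContDiff ℝ 1 α ∧ ConvexOn ℝ univ α ∧
  Tendsto (fun c => α c / |c|) (Bornology.cobounded ℝ) atTop ∧
  ∀ c t₀ : ℝ, ∀ u : ℝ → ℝ → ℝ, IsViscSolOn H c t₀ u →
    ∃ M, ∀ t ∈ Ici t₀, ∀ x, |u t x + t * α c| ≤ M

end

/-- The partial derivative `∂_p H`. -/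
noncomputable def Hp (H : ℝ → ℝ → ℝ → ℝ) (t x p : ℝ) : ℝ := deriv (fun q => H t x q) p

/-- The partial derivative `∂_x H`. -/
noncomputable def Hx (H : ℝ → ℝ → ℝ → ℝ) (t x p : ℝ) : ℝ := deriv (fun y => H t y p) x

/-- The inverse Legendre transform: the momentum `p` with `∂_p H (t, x, p) = v`. -/
noncomputable def momentum (H : ℝ → ℝ → ℝ → ℝ) (t x v : ℝ) : ℝ :=
  Classical.epsilon fun p => Hp H t x p = v

/-- A function of `(t, x, p)` which is continuous and `1`-periodic in `x` is bounded on
`[a, b] × ℝ × [-R, R]`. -/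
theorem exists_bound_of_periodic {E : Type*} [NormedAddCommGroup E] {F : ℝ → ℝ → ℝ → E}
    (hF : Continuous fun q : ℝ × ℝ × ℝ => F q.1 q.2.1 q.2.2)
    (hper : ∀ t x p, F t (x + 1) p = F t x p) (a b R : ℝ) :
    ∃ C, 0 < C ∧ ∀ t ∈ Icc a b, ∀ x p, |p| ≤ R → ‖F t x p‖ ≤ C := by
  have hK : IsCompact (Icc a b ×ˢ (Icc (0:ℝ) 1 ×ˢ Icc (-R) R)) :=
    isCompact_Icc.prod (isCompact_Icc.prod isCompact_Icc)
  obtain ⟨C, hC⟩ := hK.exists_bound_of_continuousOn hF.continuousOn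
  refine ⟨max C 1, by positivity, fun t ht x p hp => ?_⟩
  have h1 : F t x p = F t (Int.fract x) p := by
    have : Function.Periodic (fun x => F t x p) 1 := fun x => hper t x p
    have h2 := this.sub_int_mul_eq (x := x) ⌊x⌋
    simp only [mul_one] at h2
    rw [Int.fract]; exact h2.symm
  rw [h1]
  exact (hC (t, Int.fract x, p) ⟨ht, ⟨Int.fract_nonneg x, (Int.fract_lt_one x).le⟩,
    abs_le.1 hp⟩).trans (le_max_left _ _)

/-- A `C¹` function of `(t, x, p)` which is `1`-periodic in `x` is Lipschitz on
`[a, b] × ℝ × [-R, R]`. -/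
theorem exists_lipschitz_of_periodic {F : ℝ → ℝ → ℝ → ℝ}
    (hF : ContDiff ℝ 1 fun q : ℝ × ℝ × ℝ => F q.1 q.2.1 q.2.2)
    (hper : ∀ t x p, F t (x + 1) p = F t x p) (a b R : ℝ) :
    ∃ C, 0 < C ∧ ∀ t ∈ Icc a b, ∀ t' ∈ Icc a b, ∀ x x' p p', |p| ≤ R → |p'| ≤ R →
      |F t x p - F t' x' p'| ≤ C * (|t - t'| + |x - x'| + |p - p'|) := by
  set G : ℝ × ℝ × ℝ → ℝ := fun q => F q.1 q.2.1 q.2.2 with hG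
  have hc : Continuous (fderiv ℝ G) := hF.continuous_fderiv (by norm_num)
  have hp' : ∀ q : ℝ × ℝ × ℝ, fderiv ℝ G (q + (0, 1, 0)) = fderiv ℝ G q := by
    intro q
    rw [← fderiv_comp_add_right]
    congr 1
    ext ⟨t, x, p⟩
    simp [hG, hper]
  obtain ⟨C, hC0, hC⟩ := exists_bound_of_periodic (F := fun t x p => fderiv ℝ G (t, x, p)) hc
    (fun t x p => by simpa using hp' (t, x, p)) a b R
  refine ⟨C, hC0, fun t ht t' ht' x x' p p' hp hp' => ?_⟩
  have hconv : Convex ℝ (Icc a b ×ˢ ((univ : Set ℝ) ×ˢ Icc (-R) R)) :=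
    (convex_Icc a b).prod (convex_univ.prod (convex_Icc _ _))
  have := hconv.norm_image_sub_le_of_norm_fderiv_le (𝕜 := ℝ) (f := G) (C := C)
    (x := (t', x', p')) (y := (t, x, p))
    (fun q _ => (hF.differentiable (by norm_num)) q)
    (fun q hq => hC q.1 hq.1 q.2.1 q.2.2 (abs_le.2 hq.2.2))
    ⟨ht', trivial, abs_le.1 hp'⟩ ⟨ht, trivial, abs_le.1 hp⟩
  refine this.trans (mul_le_mul_of_nonneg_left ?_ hC0.le)
  simp only [Prod.mk_sub_mk, Prod.norm_mk, Real.norm_eq_abs]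
  have h1 := abs_nonneg (t - t')
  have h2 := abs_nonneg (x - x')
  have h3 := abs_nonneg (p - p')
  refine max_le (by linarith) (max_le (by linarith) (by linarith))

namespace BurgersHyp

variable {H : ℝ → ℝ → ℝ → ℝ}

theorem continuous_H (hH : BurgersHyp H) :
    Continuous fun q : ℝ × ℝ × ℝ => H q.1 q.2.1 q.2.2 := hH.smooth.continuous

theorem hasDerivAt_p (hH : BurgersHyp H) (t x p : ℝ) :
    HasDerivAt (fun q => H t x q) (Hp H t x p) p := by
  have h : DifferentiableAt ℝ (fun q => H t x q) p :=
    ((hH.smooth.differentiable (by norm_num)).comp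
      (g := fun q : ℝ × ℝ × ℝ => H q.1 q.2.1 q.2.2) (f := fun q => (t, x, q)) (by fun_prop)) p
  exact h.hasDerivAt

theorem hasDerivAt_x (hH : BurgersHyp H) (t x p : ℝ) :
    HasDerivAt (fun y => H t y p) (Hx H t x p) x := by
  have h : DifferentiableAt ℝ (fun y => H t y p) x :=
    ((hH.smooth.differentiable (by norm_num)).comp
      (g := fun q : ℝ × ℝ × ℝ => H q.1 q.2.1 q.2.2) (f := fun y => (t, y, p)) (by fun_prop)) x
  exact h.hasDerivAt

theorem Hp_eq_fderiv (hH : BurgersHyp H) (t x p : ℝ) :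
    Hp H t x p = fderiv ℝ (fun q : ℝ × ℝ × ℝ => H q.1 q.2.1 q.2.2) (t, x, p) (0, 0, 1) := by
  have h := ((hH.smooth.differentiable (by norm_num)) (t, x, p)).hasFDerivAt
  have h2 : HasDerivAt (fun q : ℝ => (t, x, q)) ((0:ℝ), (0:ℝ), (1:ℝ)) p :=
    (hasDerivAt_const p t).prodMk ((hasDerivAt_const p x).prodMk (hasDerivAt_id p))
  have h3 : HasDerivAt (fun q => H t x q) _ p :=
    HasFDerivAt.comp_hasDerivAt (f := fun q : ℝ => (t, x, q)) p h h2
  exact (hH.hasDerivAt_p t x p).unique h3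

theorem Hx_eq_fderiv (hH : BurgersHyp H) (t x p : ℝ) :
    Hx H t x p = fderiv ℝ (fun q : ℝ × ℝ × ℝ => H q.1 q.2.1 q.2.2) (t, x, p) (0, 1, 0) := by
  have h := ((hH.smooth.differentiable (by norm_num)) (t, x, p)).hasFDerivAt
  have h2 : HasDerivAt (fun y : ℝ => (t, y, p)) ((0:ℝ), (1:ℝ), (0:ℝ)) x :=
    (hasDerivAt_const x t).prodMk ((hasDerivAt_id x).prodMk (hasDerivAt_const x p))
  have h3 : HasDerivAt (fun y => H t y p) _ x :=
    HasFDerivAt.comp_hasDerivAt (f := fun y : ℝ => (t, y, p)) x h h2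
  exact (hH.hasDerivAt_x t x p).unique h3

theorem contDiff_Hp (hH : BurgersHyp H) :
    ContDiff ℝ 1 fun q : ℝ × ℝ × ℝ => Hp H q.1 q.2.1 q.2.2 := by
  have : (fun q : ℝ × ℝ × ℝ => Hp H q.1 q.2.1 q.2.2) = fun q =>
      fderiv ℝ (fun q : ℝ × ℝ × ℝ => H q.1 q.2.1 q.2.2) q (0, 0, 1) := by
    ext q; exact hH.Hp_eq_fderiv _ _ _
  rw [this]
  exact (hH.smooth.fderiv_right (m := 1) (by norm_num)).clm_apply contDiff_const

theorem contDiff_Hx (hH : BurgersHyp H) :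
    ContDiff ℝ 1 fun q : ℝ × ℝ × ℝ => Hx H q.1 q.2.1 q.2.2 := by
  have : (fun q : ℝ × ℝ × ℝ => Hx H q.1 q.2.1 q.2.2) = fun q =>
      fderiv ℝ (fun q : ℝ × ℝ × ℝ => H q.1 q.2.1 q.2.2) q (0, 1, 0) := by
    ext q; exact hH.Hx_eq_fderiv _ _ _
  rw [this]
  exact (hH.smooth.fderiv_right (m := 1) (by norm_num)).clm_apply contDiff_const

theorem Hp_periodic (hH : BurgersHyp H) (t x p : ℝ) : Hp H t (x + 1) p = Hp H t x p := by
  simp only [Hp, hH.per_x]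

theorem Hx_periodic (hH : BurgersHyp H) (t x p : ℝ) : Hx H t (x + 1) p = Hx H t x p := by
  simp only [Hx]
  rw [← deriv_comp_add_const]
  simp only [hH.per_x]

theorem differentiable_Hp (hH : BurgersHyp H) (t x : ℝ) : Differentiable ℝ (Hp H t x) := by
  have := (hH.contDiff_Hp.differentiable (by norm_num)).comp
      (g := fun q : ℝ × ℝ × ℝ => Hp H q.1 q.2.1 q.2.2) (f := fun q => (t, x, q)) (by fun_prop)
  exact this

theorem deriv_Hp_pos (hH : BurgersHyp H) (t x p : ℝ) : 0 < deriv (Hp H t x) p := by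
  have := hH.convexp t x p
  rw [iteratedDeriv_succ, iteratedDeriv_one] at this
  exact this

theorem strictMono_Hp (hH : BurgersHyp H) (t x : ℝ) : StrictMono (Hp H t x) :=
  strictMono_of_deriv_pos fun p => hH.deriv_Hp_pos t x p

/-- `∂_p H` is uniformly strongly monotone in `p` on `[a, b] × ℝ × [-R, R]`. -/
theorem exists_Hp_strong_mono (hH : BurgersHyp H) (a b R : ℝ) :
    ∃ δ, 0 < δ ∧ ∀ t ∈ Icc a b, ∀ x p p', |p| ≤ R → |p'| ≤ R →
      δ * |p - p'| ≤ |Hp H t x p - Hp H t x p'| := by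
  set G : ℝ × ℝ × ℝ → ℝ := fun q => Hp H q.1 q.2.1 q.2.2 with hG
  have hder : ∀ t x p, deriv (Hp H t x) p = fderiv ℝ G (t, x, p) (0, 0, 1) := by
    intro t x p
    have h := ((hH.contDiff_Hp.differentiable (by norm_num)) (t, x, p)).hasFDerivAt
    have h2 : HasDerivAt (fun q : ℝ => (t, x, q)) ((0:ℝ), (0:ℝ), (1:ℝ)) p :=
      (hasDerivAt_const p t).prodMk ((hasDerivAt_const p x).prodMk (hasDerivAt_id p))
    exact (h.comp_hasDerivAt p h2).deriv
  have hc : Continuous fun q : ℝ × ℝ × ℝ => (deriv (Hp H q.1 q.2.1) q.2.2)⁻¹ := by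
    refine Continuous.inv₀ ?_ fun q => (hH.deriv_Hp_pos _ _ _).ne'
    simp only [hder]
    exact (hH.contDiff_Hp.continuous_fderiv (by norm_num)).clm_apply continuous_const
  obtain ⟨C, hC0, hC⟩ := exists_bound_of_periodic (F := fun t x p => (deriv (Hp H t x) p)⁻¹) hc
    (fun t x p => by
      have : Hp H t (x + 1) = Hp H t x := funext fun p => hH.Hp_periodic t x p
      simp [this]) a b R
  refine ⟨C⁻¹, by positivity, fun t ht x => ?_⟩
  have key : ∀ p p', p' ≤ p → |p| ≤ R → |p'| ≤ R →
      C⁻¹ * (p - p') ≤ Hp H t x p - Hp H t x p' := by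
    intro p p' hpp hp hp'
    refine (convex_Icc (-R) R).mul_sub_le_image_sub_of_le_deriv
      (hH.differentiable_Hp t x).continuous.continuousOn
      (hH.differentiable_Hp t x).differentiableOn ?_ p' (abs_le.1 hp') p (abs_le.1 hp) hpp
    intro q hq
    have hqR : q ∈ Icc (-R) R := interior_subset hq
    have hq' := hC t ht x q (abs_le.2 ⟨hqR.1, hqR.2⟩)
    have hpos := hH.deriv_Hp_pos t x q
    rw [Real.norm_eq_abs, abs_of_pos (inv_pos.2 hpos)] at hq'
    exact inv_le_of_inv_le₀ hpos hq'
  intro p p' hp hp'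
  rcases le_total p' p with h | h
  · rw [abs_of_nonneg (sub_nonneg.2 h)]
    exact (key p p' h hp hp').trans (le_abs_self _)
  · rw [abs_sub_comm p, abs_sub_comm (Hp H t x p), abs_of_nonneg (sub_nonneg.2 h)]
    exact (key p' p h hp' hp).trans (le_abs_self _)

theorem exists_maximizer (hH : BurgersHyp H) (t x v : ℝ) :
    ∃ p, ∀ q, q * v - H t x q ≤ p * v - H t x p := by
  have hcont : Continuous fun p => p * v - H t x p := by
    have := hH.continuous_H.comp (f := fun p : ℝ => (t, x, p)) (by fun_prop)
    exact (continuous_id.mul continuous_const).sub this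
  refine hcont.exists_forall_ge ?_
  have h1 := (hH.superlinear t x).eventually_ge_atTop (|v| + 1)
  have h2 : ∀ᶠ p : ℝ in Bornology.cobounded ℝ, p * v - H t x p ≤ -|p| := by
    have h3 : ∀ᶠ p : ℝ in Bornology.cobounded ℝ, 1 ≤ ‖p‖ :=
      (tendsto_norm_cobounded_atTop (E := ℝ)).eventually_ge_atTop 1
    filter_upwards [h1, h3] with p hp hp1
    rw [Real.norm_eq_abs] at hp1
    rw [le_div_iff₀ (by linarith)] at hp
    have : p * v ≤ |p| * |v| := by rw [← abs_mul]; exact le_abs_self _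
    nlinarith
  rw [← Metric.cobounded_eq_cocompact]
  refine tendsto_atBot_mono' _ h2 ?_
  exact tendsto_neg_atTop_atBot.comp (tendsto_norm_cobounded_atTop (E := ℝ))

theorem Hp_surjective (hH : BurgersHyp H) (t x : ℝ) : Function.Surjective (Hp H t x) := by
  intro v
  obtain ⟨p, hp⟩ := hH.exists_maximizer t x v
  refine ⟨p, ?_⟩
  have hd : HasDerivAt (fun q => q * v - H t x q) (1 * v - Hp H t x p) p :=
    ((hasDerivAt_id p).mul_const v).sub (hH.hasDerivAt_p t x p)
  have := IsLocalMax.hasDerivAt_eq_zero (f := fun q => q * v - H t x q)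
    (Filter.Eventually.of_forall hp) hd
  linarith

theorem Hp_momentum (hH : BurgersHyp H) (t x v : ℝ) : Hp H t x (momentum H t x v) = v :=
  Classical.epsilon_spec (hH.Hp_surjective t x v)

theorem momentum_Hp (hH : BurgersHyp H) (t x p : ℝ) : momentum H t x (Hp H t x p) = p :=
  (hH.strictMono_Hp t x).injective (hH.Hp_momentum t x _)

theorem fenchel (hH : BurgersHyp H) (t x v q : ℝ) :
    q * v - H t x q ≤ momentum H t x v * v - H t x (momentum H t x v) := by
  obtain ⟨p, hp⟩ := hH.exists_maximizer t x v
  have hd : HasDerivAt (fun q => q * v - H t x q) (1 * v - Hp H t x p) p :=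
    ((hasDerivAt_id p).mul_const v).sub (hH.hasDerivAt_p t x p)
  have h0 := IsLocalMax.hasDerivAt_eq_zero (f := fun q => q * v - H t x q)
    (Filter.Eventually.of_forall hp) hd
  have : momentum H t x v = p :=
    (hH.strictMono_Hp t x).injective (by rw [hH.Hp_momentum]; linarith)
  rw [this]; exact hp q

theorem Lag_eq (hH : BurgersHyp H) (t x v : ℝ) :
    Lag H t x v = momentum H t x v * v - H t x (momentum H t x v) := by
  have : IsGreatest (range fun p => p * v - H t x p)
      (momentum H t x v * v - H t x (momentum H t x v)) := by
    refine ⟨⟨_, rfl⟩, ?_⟩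
    rintro _ ⟨q, rfl⟩
    exact hH.fenchel t x v q
  exact this.csSup_eq

theorem le_Lag (hH : BurgersHyp H) (t x v p : ℝ) : p * v - H t x p ≤ Lag H t x v := by
  rw [hH.Lag_eq]; exact hH.fenchel t x v p

theorem Lag_Hp (hH : BurgersHyp H) (t x p : ℝ) :
    Lag H t x (Hp H t x p) = p * Hp H t x p - H t x p := by
  rw [hH.Lag_eq, hH.momentum_Hp]

theorem momentum_periodic (hH : BurgersHyp H) (t x v : ℝ) :
    momentum H t (x + 1) v = momentum H t x v := by
  simp only [momentum, hH.Hp_periodic]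

theorem Lag_periodic (hH : BurgersHyp H) (t x v : ℝ) : Lag H t (x + 1) v = Lag H t x v := by
  simp only [Lag, hH.per_x]

theorem continuous_momentum (hH : BurgersHyp H) :
    Continuous fun q : ℝ × ℝ × ℝ => momentum H q.1 q.2.1 q.2.2 := by
  rw [continuous_iff_continuousAt]
  rintro ⟨t, x, v⟩
  have hc : ∀ p : ℝ, Continuous fun q : ℝ × ℝ × ℝ => Hp H q.1 q.2.1 p := fun p =>
    hH.contDiff_Hp.continuous.comp (f := fun q : ℝ × ℝ × ℝ => (q.1, q.2.1, p)) (by fun_prop)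
  have hv : Continuous fun q : ℝ × ℝ × ℝ => q.2.2 := by fun_prop
  refine tendsto_order.2 ⟨fun p hp => ?_, fun p hp => ?_⟩
  · have h0 : Hp H t x p < v := by
      rw [← hH.Hp_momentum t x v]; exact hH.strictMono_Hp t x hp
    filter_upwards [((hc p).tendsto (t, x, v)).eventually_lt (hv.tendsto (t, x, v)) h0]
      with q hq
    rw [← hH.Hp_momentum q.1 q.2.1 q.2.2] at hq
    exact (hH.strictMono_Hp _ _).lt_iff_lt.1 hq
  · have h0 : v < Hp H t x p := by
      conv_lhs => rw [← hH.Hp_momentum t x v]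
      exact hH.strictMono_Hp t x hp
    filter_upwards [(hv.tendsto (t, x, v)).eventually_lt ((hc p).tendsto (t, x, v)) h0]
      with q hq
    conv_lhs at hq => rw [← hH.Hp_momentum q.1 q.2.1 q.2.2]
    exact (hH.strictMono_Hp _ _).lt_iff_lt.1 hq

theorem continuous_Lag (hH : BurgersHyp H) :
    Continuous fun q : ℝ × ℝ × ℝ => Lag H q.1 q.2.1 q.2.2 := by
  have h := hH.continuous_momentum
  simp only [hH.Lag_eq]
  refine (h.mul (by fun_prop)).sub ?_
  exact hH.continuous_H.comp
    (f := fun q : ℝ × ℝ × ℝ => (q.1, q.2.1, momentum H q.1 q.2.1 q.2.2)) (by fun_prop)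

/-- Superlinearity of the Lagrangian, uniformly on compact time intervals. -/
theorem exists_Lag_superlinear (hH : BurgersHyp H) (a b A : ℝ) :
    ∃ C, 0 < C ∧ ∀ t ∈ Icc a b, ∀ x v, A * |v| - C ≤ Lag H t x v := by
  obtain ⟨C, hC0, hC⟩ := exists_bound_of_periodic hH.continuous_H hH.per_x a b |A|
  refine ⟨C, hC0, fun t ht x v => ?_⟩
  rcases le_total 0 v with hv | hv
  · rw [abs_of_nonneg hv]
    have h1 := hH.le_Lag t x v A
    have h2 := (le_abs_self _).trans (hC t ht x A le_rfl)
    linarith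
  · rw [abs_of_nonpos hv]
    have h1 := hH.le_Lag t x v (-A)
    have h2 := (le_abs_self _).trans (hC t ht x (-A) (abs_neg A).le)
    linarith

theorem exists_momentum_bound (hH : BurgersHyp H) (a b M : ℝ) :
    ∃ R, 0 < R ∧ ∀ t ∈ Icc a b, ∀ x v, |v| ≤ M → |momentum H t x v| ≤ R :=
  exists_bound_of_periodic hH.continuous_momentum hH.momentum_periodic a b M

theorem exists_momentum_lipschitz (hH : BurgersHyp H) (a b M : ℝ) :
    ∃ C, 0 < C ∧ ∀ t ∈ Icc a b, ∀ t' ∈ Icc a b, ∀ x x' v v', |v| ≤ M → |v'| ≤ M →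
      |momentum H t x v - momentum H t' x' v'| ≤ C * (|t - t'| + |x - x'| + |v - v'|) := by
  obtain ⟨R, hR0, hR⟩ := hH.exists_momentum_bound a b M
  obtain ⟨δ, hδ0, hδ⟩ := hH.exists_Hp_strong_mono a b R
  obtain ⟨C, hC0, hC⟩ := exists_lipschitz_of_periodic hH.contDiff_Hp hH.Hp_periodic a b R
  refine ⟨(C + 1) / δ, by positivity, fun t ht t' ht' x x' v v' hv hv' => ?_⟩
  have h1 := hδ t ht x _ _ (hR t ht x v hv) (hR t' ht' x' v' hv')
  rw [hH.Hp_momentum] at h1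
  have h2 := hC t ht t' ht' x x' _ _ (hR t' ht' x' v' hv') (hR t' ht' x' v' hv')
  rw [hH.Hp_momentum t' x' v', sub_self, abs_zero, add_zero] at h2
  have h3 := abs_sub_le v v' (Hp H t x (momentum H t' x' v'))
  rw [abs_sub_comm v'] at h3
  rw [div_mul_eq_mul_div, le_div_iff₀ hδ0]
  have := abs_nonneg (t - t')
  have := abs_nonneg (x - x')
  have := abs_nonneg (v - v')
  nlinarith [mul_nonneg hC0.le (abs_nonneg (v - v'))]

theorem exists_Lag_lipschitz (hH : BurgersHyp H) (a b M : ℝ) :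
    ∃ C, 0 < C ∧ ∀ t ∈ Icc a b, ∀ x x' v v', |v| ≤ M → |v'| ≤ M →
      |Lag H t x v - Lag H t x' v'| ≤ C * (|x - x'| + |v - v'|) := by
  obtain ⟨R, hR0, hR⟩ := hH.exists_momentum_bound a b M
  obtain ⟨C, hC0, hC⟩ := exists_lipschitz_of_periodic (hH.smooth.of_le (by norm_num)) hH.per_x a b R
  refine ⟨C + R, by positivity, fun t ht => ?_⟩
  have key : ∀ x x' v v', |v| ≤ M → |v'| ≤ M →
      Lag H t x v - Lag H t x' v' ≤ (C + R) * (|x - x'| + |v - v'|) := by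
    intro x x' v v' hv hv'
    have h1 := hH.le_Lag t x' v' (momentum H t x v)
    have h2 := hH.Lag_eq t x v
    have h3 := hC t ht t ht x x' _ _ (hR t ht x v hv) (hR t ht x v hv)
    simp only [sub_self, abs_zero, zero_add, add_zero] at h3
    have h4 : momentum H t x v * (v - v') ≤ R * |v - v'| := by
      refine (le_abs_self _).trans ?_
      rw [abs_mul]
      exact mul_le_mul_of_nonneg_right (hR t ht x v hv) (abs_nonneg _)
    have h5 := neg_abs_le (H t x (momentum H t x v) - H t x' (momentum H t x v))
    nlinarith [abs_nonneg (x - x'), abs_nonneg (v - v')]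
  intro x x' v v' hv hv'
  refine abs_le.2 ⟨?_, key x x' v v' hv hv'⟩
  have := key x' x v' v hv' hv
  rw [abs_sub_comm x', abs_sub_comm v'] at this
  linarith

/-- Local semi-concavity of the Lagrangian, with explicit superdifferential. -/
theorem exists_Lag_semiconcave (hH : BurgersHyp H) (a b M : ℝ) :
    ∃ C, 0 < C ∧ ∀ t ∈ Icc a b, ∀ x v h k, |v| ≤ M → |v + k| ≤ M →
      Lag H t (x + h) (v + k) ≤ Lag H t x v + momentum H t x v * k
        - Hx H t x (momentum H t x v) * h + C * (h ^ 2 + k ^ 2) := by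
  obtain ⟨R, hR0, hR⟩ := hH.exists_momentum_bound a b M
  obtain ⟨C, hC0, hC⟩ := exists_lipschitz_of_periodic hH.contDiff_Hx hH.Hx_periodic a b R
  obtain ⟨D, hD0, hD⟩ := hH.exists_momentum_lipschitz a b M
  refine ⟨C + 2 * C * D + 2 * D, by positivity, fun t ht x v h k hv hvk => ?_⟩
  set p := momentum H t x v with hp
  set p' := momentum H t (x + h) (v + k) with hp'
  have hpp : |p' - p| ≤ D * (|h| + |k|) := by
    have := hD t ht t ht (x + h) x (v + k) v hvk hv
    simpa using this
  have hpR : |p| ≤ R := hR t ht x v hv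
  have hpR' : |p'| ≤ R := hR t ht _ _ hvk
  have h1 := hH.le_Lag t x v p'
  have h2 := hH.Lag_eq t (x + h) (v + k)
  rw [← hp'] at h2
  -- the increment of `H` in `x`
  have h3 : |H t (x + h) p' - H t x p' - Hx H t x p * h| ≤ C * (|h| + |p' - p|) * |h| := by
    have hd : ∀ y ∈ uIcc x (x + h), HasDerivWithinAt (fun y => H t y p' - Hx H t x p * y)
        (Hx H t y p' - Hx H t x p) (uIcc x (x + h)) y := by
      intro y _
      have := (hH.hasDerivAt_x t y p').sub ((hasDerivAt_id y).const_mul (Hx H t x p))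
      simp only [mul_one] at this
      exact this.hasDerivWithinAt
    have := (convex_uIcc x (x + h)).norm_image_sub_le_of_norm_hasDerivWithin_le
      (C := C * (|h| + |p' - p|)) hd (fun y hy => by
        have h4 := hC t ht t ht y x p' p hpR' hpR
        have h5 : |y - x| ≤ |h| := by
          have := abs_sub_left_of_mem_uIcc hy
          simpa using this
        rw [sub_self, abs_zero, zero_add] at h4
        refine h4.trans (mul_le_mul_of_nonneg_left (by linarith) hC0.le))
      left_mem_uIcc right_mem_uIcc
    simp only [add_sub_cancel_left, Real.norm_eq_abs] at this
    convert this using 2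
    ring
  have h4 := neg_abs_le (H t (x + h) p' - H t x p' - Hx H t x p * h)
  have h5 : (p' - p) * k ≤ D * (|h| + |k|) * |k| := by
    refine (le_abs_self _).trans ?_
    rw [abs_mul]
    exact mul_le_mul_of_nonneg_right hpp (abs_nonneg _)
  have h6 : C * (|h| + |p' - p|) * |h| ≤ C * (|h| + D * (|h| + |k|)) * |h| := by gcongr
  have hh := sq_abs h
  have hk := sq_abs k
  have hhk : |h| * |k| ≤ (h ^ 2 + k ^ 2) / 2 := by nlinarith [sq_nonneg (|h| - |k|)]
  have hCD : 0 < C * D := by positivity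
  have e1 : C * (|h| + D * (|h| + |k|)) * |h| = C * h ^ 2 + C * D * (h ^ 2 + |h| * |k|) := by
    rw [← hh]; ring
  have e2 : D * (|h| + |k|) * |k| = D * (|h| * |k| + k ^ 2) := by rw [← hk]; ring
  have e3 : C * D * (h ^ 2 + |h| * |k|) ≤ C * D * (h ^ 2 + (h ^ 2 + k ^ 2) / 2) := by gcongr
  have e4 : D * (|h| * |k| + k ^ 2) ≤ D * ((h ^ 2 + k ^ 2) / 2 + k ^ 2) := by gcongr
  nlinarith [mul_nonneg hC0.le (sq_nonneg k), mul_nonneg hCD.le (sq_nonneg k),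
    mul_nonneg hCD.le (sq_nonneg h), mul_nonneg hD0.le (sq_nonneg h),
    mul_nonneg hD0.le (sq_nonneg k)]

end BurgersHyp

theorem HasDerivAt.nonpos_of_eventually_le_left {G : ℝ → ℝ} {G' t : ℝ} (hG : HasDerivAt G G' t)
    (h : ∀ᶠ s in 𝓝[<] t, G t ≤ G s) : G' ≤ 0 := by
  have h1 := (hasDerivAt_iff_tendsto_slope.1 hG).mono_left
    (nhdsWithin_mono t (fun s (hs : s < t) => hs.ne) : 𝓝[<] t ≤ 𝓝[≠] t)
  refine le_of_tendsto h1 ?_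
  filter_upwards [h, self_mem_nhdsWithin] with s hs hst
  rw [slope_def_field]
  exact div_nonpos_of_nonneg_of_nonpos (sub_nonneg.2 hs) (sub_nonpos.2 (le_of_lt hst))

namespace BurgersHyp

variable {H : ℝ → ℝ → ℝ → ℝ} {c : ℝ}

/-- The subsolution test at a point of domination by affine curves; the test function only needs
to be differentiable at that point. -/
theorem sub_test (hH : BurgersHyp H) {u : ℝ → ℝ → ℝ} {φ : ℝ × ℝ → ℝ} {φ' : ℝ × ℝ →L[ℝ] ℝ}
    {t x : ℝ} (hφ : HasFDerivAt φ φ' (t, x))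
    (hdom : ∀ v, v = Hp H t x (c + φ' (0, 1)) → ∀ᶠ s in 𝓝[<] t, u t x ≤ u s (x - (t - s) * v) +
      ∫ σ in s..t, (Lag H σ (x - (t - σ) * v) v - c * v))
    (hmax : IsLocalMax (fun w : ℝ × ℝ => u w.1 w.2 - φ w) (t, x)) :
    φ' (1, 0) + H t x (c + φ' (0, 1)) ≤ 0 := by
  set v := Hp H t x (c + φ' (0, 1)) with hv
  have hcurve : HasDerivAt (fun s : ℝ => (s, x - (t - s) * v)) ((1:ℝ), v) t := by
    refine (hasDerivAt_id t).prodMk ?_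
    have := (((hasDerivAt_id t).const_sub t).mul_const v).const_sub x
    simpa using this
  have hz : (t, x - (t - t) * v) = (t, x) := by simp
  have hh : HasDerivAt (fun s => φ (s, x - (t - s) * v)) (φ' (1, v)) t :=
    HasFDerivAt.comp_hasDerivAt (f := fun s : ℝ => (s, x - (t - s) * v)) t (by rw [hz]; exact hφ) hcurve
  have hcont : Continuous fun σ => Lag H σ (x - (t - σ) * v) v - c * v :=
    (hH.continuous_Lag.comp (f := fun σ : ℝ => (σ, x - (t - σ) * v, v)) (by fun_prop)).sub
      continuous_const
  have hA : HasDerivAt (fun s => ∫ σ in s..t, (Lag H σ (x - (t - σ) * v) v - c * v))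
      (-(Lag H t (x - (t - t) * v) v - c * v)) t :=
    intervalIntegral.integral_hasDerivAt_left (hcont.intervalIntegrable _ _)
      (hcont.stronglyMeasurableAtFilter _ _) hcont.continuousAt
  have hG := hh.add hA
  have hneg := hG.nonpos_of_eventually_le_left ?_
  · have e1 : φ' (1, v) = φ' (1, 0) + v * φ' (0, 1) := by
      have : ((1:ℝ), v) = (1, 0) + v • ((0:ℝ), (1:ℝ)) := by simp
      rw [this, map_add, map_smul, smul_eq_mul]
    have e2 : Lag H t (x - (t - t) * v) v = (c + φ' (0, 1)) * v - H t x (c + φ' (0, 1)) := by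
      rw [sub_self, zero_mul, sub_zero, hv, hH.Lag_Hp]
    rw [e1, e2] at hneg
    linarith
  · have h1 : Tendsto (fun s : ℝ => (s, x - (t - s) * v)) (𝓝[<] t) (𝓝 (t, x)) := by
      have := hcurve.continuousAt.tendsto
      rw [hz] at this
      exact this.mono_left nhdsWithin_le_nhds
    filter_upwards [hdom v hv, h1.eventually hmax] with s hs1 hs2
    simp only [Pi.add_apply, intervalIntegral.integral_same, sub_self, zero_mul, sub_zero, add_zero]
    linarith

/-- The supersolution test at a point whose value is almost attained along backward curves; the
test function only needs to be differentiable at that point. -/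
theorem super_test (hH : BurgersHyp H) {u : ℝ → ℝ → ℝ} {φ : ℝ × ℝ → ℝ} {φ' : ℝ × ℝ →L[ℝ] ℝ}
    {t x B : ℝ} (hφ : HasFDerivAt φ φ' (t, x))
    (hB : ∀ᶠ s in 𝓝[<] t, ∀ y, -B ≤ u s y)
    (hnear : ∀ᶠ s in 𝓝[<] t, ∀ ε > 0, ∃ ξ g : ℝ → ℝ, IsAC ξ g s t ∧ ξ t = x ∧
      IntervalIntegrable (fun σ => Lag H σ (ξ σ) (g σ) - c * g σ) volume s t ∧
      u s (ξ s) + ∫ σ in s..t, (Lag H σ (ξ σ) (g σ) - c * g σ) ≤ u t x + ε)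
    (hmin : IsLocalMin (fun w : ℝ × ℝ => u w.1 w.2 - φ w) (t, x)) :
    0 ≤ φ' (1, 0) + H t x (c + φ' (0, 1)) := by
  by_contra! hneg
  set q := φ' (0, 1) with hq
  set τ := φ' (1, 0) with hτ
  obtain ⟨η, hη0, hη⟩ : ∃ η > 0, τ + H t x (c + q) < -(2 * η) := by
    refine ⟨-(τ + H t x (c + q)) / 3, by linarith, by linarith⟩
  -- continuity of `H`
  have hHc : ∀ᶠ z : ℝ × ℝ × ℝ in 𝓝 (t, x, c + q), H z.1 z.2.1 z.2.2 < -τ - 2 * η :=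
    (hH.continuous_H.tendsto (t, x, c + q)).eventually (gt_mem_nhds (by simp only; linarith))
  obtain ⟨r, hr0, hr⟩ := Metric.eventually_nhds_iff.1 hHc
  set κ := r / 2 with hκ
  have hκ0 : 0 < κ := by positivity
  have hloc : ∀ᶠ z : ℝ × ℝ in 𝓝 (t, x), u t x - φ (t, x) ≤ u z.1 z.2 - φ z ∧
      |φ z - φ (t, x) - φ' (z - (t, x))| ≤ min κ η * ‖z - (t, x)‖ :=
    hmin.and ((hasFDerivAt_iff_isLittleO.1 hφ).bound (lt_min hκ0 hη0))
  obtain ⟨ρ', hρ'0, hρ'⟩ := Metric.eventually_nhds_iff.1 hloc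
  set ρ := min ρ' r with hρ
  have hρ0 : 0 < ρ := lt_min hρ'0 hr0
  set A := (|u t x| + |B| + 2) / (ρ / 2) with hA
  have hA0 : 0 < A := by positivity
  obtain ⟨C, hC0, hC⟩ := hH.exists_Lag_superlinear (t - 1) t (A + |c|)
  have hs : ∀ᶠ s in 𝓝[<] t, t - min (min ρ 1) (min C⁻¹ η⁻¹) < s :=
    nhdsWithin_le_nhds (lt_mem_nhds (by
      have : 0 < min (min ρ 1) (min C⁻¹ η⁻¹) := by positivity
      linarith))
  obtain ⟨s, hsB, hsn, hs, hst⟩ := (hB.and (hnear.and (hs.and self_mem_nhdsWithin))).exists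
  replace hst : s < t := hst
  have hs1 : t - s < ρ := by
    have := (min_le_left (min ρ 1) (min C⁻¹ η⁻¹)).trans (min_le_left _ _); linarith
  have hs2 : t - s < 1 := by
    have := (min_le_left (min ρ 1) (min C⁻¹ η⁻¹)).trans (min_le_right _ _); linarith
  have hs3 : C * (t - s) < 1 := by
    have := (min_le_right (min ρ 1) (min C⁻¹ η⁻¹)).trans (min_le_left _ _)
    calc C * (t - s) < C * C⁻¹ := by gcongr; linarith
      _ = 1 := mul_inv_cancel₀ hC0.ne'
  have hs4 : η * (t - s) < 1 := by
    have := (min_le_right (min ρ 1) (min C⁻¹ η⁻¹)).trans (min_le_right _ _)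
    calc η * (t - s) < η * η⁻¹ := by gcongr; linarith
      _ = 1 := mul_inv_cancel₀ hη0.ne'
  obtain ⟨ξ, g, hAC, hξt, hint, hle⟩ := hsn (η * (t - s) / 2) (by
    have : 0 < t - s := by linarith
    positivity)
  have hgi := hAC.1
  have hgabs : IntervalIntegrable (fun σ => |g σ|) volume s t := hgi.abs
  have hsplit : ∀ σ ∈ Icc s t, x - ξ σ = ∫ σ in σ..t, g σ := by
    intro σ hσ
    have h1 := hAC.2 t (right_mem_Icc.2 hst.le)
    have h2 := hAC.2 σ hσ
    have h3 := intervalIntegral.integral_add_adjacent_intervals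
      (hgi.mono_set (by
        rw [uIcc_of_le hσ.1, uIcc_of_le hst.le]; exact Icc_subset_Icc_right hσ.2))
      (hgi.mono_set (a := s) (b := t) (c := σ) (d := t) (by
        rw [uIcc_of_le hσ.2, uIcc_of_le hst.le]; exact Icc_subset_Icc_left hσ.1))
    rw [← hξt, h1, h2]; linarith
  -- the curve stays close to `x`
  have hsmall : ∫ σ in s..t, |g σ| ≤ ρ / 2 := by
    have h1 : ∫ σ in s..t, (A * |g σ| - C) ≤ ∫ σ in s..t, (Lag H σ (ξ σ) (g σ) - c * g σ) := by
      refine intervalIntegral.integral_mono_on hst.le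
        ((hgabs.const_mul A).sub intervalIntegrable_const) hint fun σ hσ => ?_
      have := hC σ ⟨by linarith [hσ.1], hσ.2⟩ (ξ σ) (g σ)
      have h2 : c * g σ ≤ |c| * |g σ| := by rw [← abs_mul]; exact le_abs_self _
      linarith
    rw [intervalIntegral.integral_sub (hgabs.const_mul A) intervalIntegrable_const,
      intervalIntegral.integral_const_mul, intervalIntegral.integral_const, smul_eq_mul] at h1
    have h2 := hsB (ξ s)
    have h3 := le_abs_self (u t x)
    have h4 := le_abs_self B
    have h5 : A * ∫ σ in s..t, |g σ| ≤ |u t x| + |B| + 2 := by linarith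
    have h6 : A * (ρ / 2) = |u t x| + |B| + 2 := by rw [hA]; field_simp
    exact le_of_mul_le_mul_left (by linarith) hA0
  have hnearx : ∀ σ ∈ Icc s t, |ξ σ - x| ≤ ρ / 2 := by
    intro σ hσ
    rw [abs_sub_comm, hsplit σ hσ]
    refine (intervalIntegral.abs_integral_le_integral_abs hσ.2).trans (le_trans ?_ hsmall)
    exact intervalIntegral.integral_mono_interval hσ.1 hσ.2 le_rfl
      (Eventually.of_forall fun _ => abs_nonneg _) hgabs
  set Δ := x - ξ s with hΔ
  -- lower bound for the action
  obtain ⟨e, he1, he2⟩ : ∃ e : ℝ, |e| ≤ κ ∧ e * Δ = κ * |Δ| := by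
    rcases le_total 0 Δ with h | h
    · exact ⟨κ, (abs_of_pos hκ0).le, by rw [abs_of_nonneg h]⟩
    · exact ⟨-κ, by rw [abs_neg, abs_of_pos hκ0], by rw [abs_of_nonpos h]; ring⟩
  have hact : (q + e) * Δ + (τ + 2 * η) * (t - s) ≤
      ∫ σ in s..t, (Lag H σ (ξ σ) (g σ) - c * g σ) := by
    have h1 : ∫ σ in s..t, ((q + e) * g σ + (τ + 2 * η)) =
        (q + e) * Δ + (τ + 2 * η) * (t - s) := by
      rw [intervalIntegral.integral_add (hgi.const_mul _) intervalIntegrable_const,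
        intervalIntegral.integral_const_mul, intervalIntegral.integral_const, smul_eq_mul,
        hΔ, hsplit s (left_mem_Icc.2 hst.le)]
      ring
    rw [← h1]
    refine intervalIntegral.integral_mono_on hst.le
      ((hgi.const_mul _).add intervalIntegrable_const) hint fun σ hσ => ?_
    have h2 := hH.le_Lag σ (ξ σ) (g σ) (c + q + e)
    have h3 : H σ (ξ σ) (c + q + e) < -τ - 2 * η := by
      refine hr (y := (σ, ξ σ, c + q + e)) ?_
      rw [Prod.dist_eq, Prod.dist_eq]
      simp only [Real.dist_eq, add_sub_cancel_left]
      have h4 : ρ ≤ r := min_le_right _ _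
      refine max_lt ?_ (max_lt ?_ ?_)
      · rw [abs_sub_comm, abs_of_nonneg (by linarith [hσ.2])]; linarith [hσ.1]
      · linarith [hnearx σ hσ]
      · linarith
    linarith
  have hz := @hρ' (s, ξ s) (by
    rw [Prod.dist_eq]
    simp only [Real.dist_eq]
    have h4 : ρ ≤ ρ' := min_le_left _ _
    refine max_lt ?_ ?_
    · rw [abs_sub_comm, abs_of_nonneg (by linarith)]; linarith
    · linarith [hnearx s (left_mem_Icc.2 hst.le)])
  obtain ⟨hz1, hz2⟩ := hz
  have e1 : φ' ((s, ξ s) - (t, x)) = -(τ * (t - s)) - q * Δ := by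
    have : ((s, ξ s) - (t, x) : ℝ × ℝ) = (-(t - s)) • ((1:ℝ), (0:ℝ)) + (-Δ) • ((0:ℝ), (1:ℝ)) := by
      simp [hΔ]
    rw [this, map_add, map_smul, map_smul, smul_eq_mul, smul_eq_mul, ← hq, ← hτ]
    ring
  have e2 : ‖((s, ξ s) - (t, x) : ℝ × ℝ)‖ ≤ (t - s) + |Δ| := by
    rw [Prod.mk_sub_mk, Prod.norm_mk, Real.norm_eq_abs, Real.norm_eq_abs, abs_sub_comm s,
      abs_sub_comm (ξ s), abs_of_nonneg (by linarith : 0 ≤ t - s)]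
    exact max_le (by linarith [abs_nonneg Δ]) (by linarith)
  rw [e1] at hz2
  have hm : 0 < min κ η := lt_min hκ0 hη0
  have h5 := (neg_abs_le _).trans (le_refl (φ (s, ξ s) - φ (t, x) - (-(τ * (t - s)) - q * Δ)))
  have h6 : min κ η * ‖((s, ξ s) - (t, x) : ℝ × ℝ)‖ ≤ η * (t - s) + κ * |Δ| := by
    calc _ ≤ min κ η * ((t - s) + |Δ|) := by gcongr
      _ = min κ η * (t - s) + min κ η * |Δ| := by ring
      _ ≤ η * (t - s) + κ * |Δ| := by
        have : 0 ≤ t - s := by linarith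
        gcongr
        · exact min_le_right _ _
        · exact min_le_left _ _
  have h7 : 0 < η * (t - s) := mul_pos hη0 (by linarith)
  simp only at hz1
  linarith

end BurgersHyp

namespace BurgersHyp

variable {H : ℝ → ℝ → ℝ → ℝ} {c : ℝ}

set_option maxHeartbeats 1000000 in
/-- Comparison principle on a strip, one of the two functions being Lipschitz in space. -/
theorem comparison (hH : BurgersHyp H) {a b L m : ℝ} {U W : ℝ → ℝ → ℝ}
    (hUc : ContinuousOn (fun z : ℝ × ℝ => U z.1 z.2) (Icc a b ×ˢ univ))
    (hWc : ContinuousOn (fun z : ℝ × ℝ => W z.1 z.2) (Icc a b ×ˢ univ))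
    (hUp : ∀ t x, U t (x + 1) = U t x) (hWp : ∀ t x, W t (x + 1) = W t x)
    (hU : ViscSubSol H c 0 (Ioo a b ×ˢ univ) U) (hW : ViscSuperSol H c 0 (Ioo a b ×ˢ univ) W)
    (hLip : (∀ t ∈ Icc a b, ∀ x y, |U t x - U t y| ≤ L * |x - y|) ∨
      (∀ t ∈ Icc a b, ∀ x y, |W t x - W t y| ≤ L * |x - y|))
    (hm : ∀ x, U a x - W a x ≤ m) {t : ℝ} (ht : t ∈ Ioo a b) (x : ℝ) :
    U t x - W t x ≤ m := by
  have hL : 0 ≤ L := by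
    have hat : t ∈ Icc a b := Ioo_subset_Icc_self ht
    rcases hLip with h | h
    · simpa using (abs_nonneg _).trans (h t hat 1 0)
    · simpa using (abs_nonneg _).trans (h t hat 1 0)
  have hab : a < b := ht.1.trans ht.2
  by_contra! hgt
  obtain ⟨σ, hσ0, hσ⟩ : ∃ σ > 0, m + 4 * σ = U t x - W t x :=
    ⟨(U t x - W t x - m) / 4, by linarith, by ring⟩
  have hperU : ∀ t x (n : ℤ), U t (x + n) = U t x := fun t x n => by
    have : Function.Periodic (U t) 1 := hUp t
    simpa using this.int_mul n x
  have hperW : ∀ t x (n : ℤ), W t (x + n) = W t x := fun t x n => by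
    have : Function.Periodic (W t) 1 := hWp t
    simpa using this.int_mul n x
  -- bounds and moduli of continuity on a compact set
  have hK0 : IsCompact (Icc a b ×ˢ Icc (-1:ℝ) 2) := isCompact_Icc.prod isCompact_Icc
  have hsub : Icc a b ×ˢ Icc (-1:ℝ) 2 ⊆ Icc a b ×ˢ univ := prod_mono_right (subset_univ _)
  obtain ⟨M1, hM1⟩ := hK0.exists_bound_of_continuousOn (hUc.mono hsub)
  obtain ⟨M2, hM2⟩ := hK0.exists_bound_of_continuousOn (hWc.mono hsub)
  set N := |M1| + |M2| + |m| with hN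
  have hN0 : 0 ≤ N := by positivity
  obtain ⟨rU, hrU0, hrU⟩ := Metric.uniformContinuousOn_iff.1
    (hK0.uniformContinuousOn_of_continuous (hUc.mono hsub)) σ hσ0
  obtain ⟨rW, hrW0, hrW⟩ := Metric.uniformContinuousOn_iff.1
    (hK0.uniformContinuousOn_of_continuous (hWc.mono hsub)) σ hσ0
  obtain ⟨C, hC0, hC⟩ := exists_lipschitz_of_periodic (hH.smooth.of_le (by norm_num)) hH.per_x a b
    (|c| + 2 * L)
  set η := σ / (b - a) with hη
  have hη0 : 0 < η := div_pos hσ0 (by linarith)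
  have hηab : η * (b - a) = σ := div_mul_cancel₀ _ (by linarith)
  set r := min (min rU rW) (η / (4 * C)) with hr
  have hr0 : 0 < r := by positivity
  obtain ⟨ε, hε0, hε⟩ : ∃ ε > 0, 2 * ε * N < r ^ 2 := by
    refine ⟨r ^ 2 / (2 * (N + 1)), by positivity, ?_⟩
    have : 2 * (r ^ 2 / (2 * (N + 1))) * N = r ^ 2 * (N / (N + 1)) := by field_simp
    rw [this]
    have h1 : N / (N + 1) < 1 := by rw [div_lt_one (by linarith)]; linarith
    nlinarith [pow_pos hr0 2]
  -- the barrier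
  set d := (b - t) / 3 with hd
  have hd0 : 0 < d := by rw [hd]; linarith [ht.2]
  set Q := N + 1 + 2 / σ with hQ
  have hQ0 : 0 < Q := by positivity
  have hQσ : 2 / Q ≤ σ := by
    rw [div_le_iff₀ hQ0]
    have : σ * (2 / σ) = 2 := by field_simp
    nlinarith
  have hQ1 : 1 ≤ Q := by rw [hQ]; have : 0 < 2 / σ := by positivity
                         linarith
  set A := Real.log Q / d with hA
  have hA0 : 0 ≤ A := div_nonneg (Real.log_nonneg hQ1) hd0.le
  have hAd : A * d = Real.log Q := div_mul_cancel₀ _ hd0.ne'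
  set β : ℝ → ℝ := fun τ => Real.exp (A * (τ - (t + d))) with hβ
  have hβ0 : ∀ τ, 0 < β τ := fun τ => Real.exp_pos _
  have hβt : β t = 1 / Q := by
    simp only [hβ]
    rw [show A * (t - (t + d)) = -(A * d) by ring, hAd, Real.exp_neg, Real.exp_log hQ0, one_div]
  have hβ2 : β (t + 2 * d) = Q := by
    simp only [hβ]
    rw [show A * (t + 2 * d - (t + d)) = A * d by ring, hAd, Real.exp_log hQ0]
  have hβd : ∀ τ, HasDerivAt β (A * β τ) τ := by
    intro τ
    have := (((hasDerivAt_id τ).sub_const (t + d)).const_mul A).exp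
    simpa [hβ, mul_comm] using this
  have hβc : ContDiff ℝ 1 β := by
    simp only [hβ]
    fun_prop
  set e := t + 2 * d with he
  have heb : e < b := by rw [he, hd]; linarith [ht.2]
  have hte : t < e := by rw [he]; linarith
  -- the doubled functional
  set Φ : (ℝ × ℝ) × (ℝ × ℝ) → ℝ := fun q => U q.1.1 q.1.2 - W q.2.1 q.2.2
    - (q.1.2 - q.2.2) ^ 2 / (2 * ε) - (q.1.1 - q.2.1) ^ 2 / (2 * ε)
    - β q.1.1 - β q.2.1 - η * (q.1.1 - a) with hΦ
  have hΦc : ContinuousOn Φ ((Icc a e ×ˢ Icc (0:ℝ) 1) ×ˢ (Icc a e ×ˢ Icc (-1:ℝ) 2)) := by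
    have h1 : ContinuousOn (fun q : (ℝ × ℝ) × (ℝ × ℝ) => U q.1.1 q.1.2)
        ((Icc a e ×ˢ Icc (0:ℝ) 1) ×ˢ (Icc a e ×ˢ Icc (-1:ℝ) 2)) :=
      hUc.comp continuous_fst.continuousOn
        (fun q hq => ⟨⟨hq.1.1.1, hq.1.1.2.trans heb.le⟩, trivial⟩)
    have h2 : ContinuousOn (fun q : (ℝ × ℝ) × (ℝ × ℝ) => W q.2.1 q.2.2)
        ((Icc a e ×ˢ Icc (0:ℝ) 1) ×ˢ (Icc a e ×ˢ Icc (-1:ℝ) 2)) :=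
      hWc.comp continuous_snd.continuousOn
        (fun q hq => ⟨⟨hq.2.1.1, hq.2.1.2.trans heb.le⟩, trivial⟩)
    have h3 : Continuous β := hβc.continuous
    refine (((((h1.sub h2).sub ?_).sub ?_).sub ?_).sub ?_).sub ?_
    all_goals exact Continuous.continuousOn (by fun_prop)
  obtain ⟨⟨⟨t', x'⟩, ⟨s', y'⟩⟩, hmem, hmax0⟩ :=
    ((isCompact_Icc.prod isCompact_Icc).prod (isCompact_Icc.prod isCompact_Icc)).exists_isMaxOn
      (⟨((a, 0), (a, 0)), by
        simp only [mem_prod, mem_Icc]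
        refine ⟨⟨⟨le_rfl, by linarith [ht.1]⟩, by norm_num⟩, ⟨le_rfl, by linarith [ht.1]⟩,
          by norm_num⟩⟩) hΦc
  simp only [mem_prod] at hmem
  obtain ⟨⟨ht', hx'⟩, hs', hy'⟩ := hmem
  have hmax : ∀ τ ∈ Icc a e, ∀ ς ∈ Icc a e, ∀ x y, Φ ((τ, x), (ς, y)) ≤ Φ ((t', x'), (s', y')) := by
    intro τ hτ ς hς x y
    set n := ⌊x⌋
    set k := round (x - y)
    have hxy : |x - y - k| ≤ 1 / 2 := abs_sub_round (x - y)
    have h1 : Φ ((τ, x), (ς, y)) ≤ Φ ((τ, x - n), (ς, y + k - n)) := by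
      have e1 : U τ (x - n) = U τ x := by simpa [sub_eq_add_neg] using hperU τ x (-n)
      have e2 : W ς (y + k - n) = W ς y := by
        simpa [sub_eq_add_neg, add_assoc] using hperW ς y (k - n)
      simp only [hΦ, e1, e2]
      have e3 : (x - n - (y + k - n)) ^ 2 ≤ (x - y) ^ 2 := by
        rw [show x - n - (y + k - n) = x - y - k by ring]
        rcases eq_or_ne k 0 with hk | hk
        · simp [hk]
        · have h4 : (1:ℝ) ≤ |(k:ℝ)| := by exact_mod_cast Int.one_le_abs hk
          have h5 : |(k:ℝ)| ≤ |x - y| + |x - y - k| := by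
            have := abs_sub (x - y) (x - y - k)
            simpa using this
          exact sq_le_sq.2 (by linarith)
      have : (x - n - (y + k - n)) ^ 2 / (2 * ε) ≤ (x - y) ^ 2 / (2 * ε) := by gcongr
      linarith
    refine h1.trans (hmax0 ?_)
    have h2 := Int.floor_le x
    have h3 := (Int.lt_floor_add_one x).le
    have h4 := abs_le.1 hxy
    simp only [mem_prod]
    exact ⟨⟨hτ, ⟨by linarith, by linarith⟩⟩, hς, ⟨by linarith [h4.1, h4.2], by linarith [h4.1, h4.2]⟩⟩
  have hbdU := hM1 (t', x') ⟨⟨ht'.1, ht'.2.trans heb.le⟩, by linarith [hx'.1], by linarith [hx'.2]⟩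
  have hbdW := hM2 (s', y') ⟨⟨hs'.1, hs'.2.trans heb.le⟩, hy'⟩
  simp only [Real.norm_eq_abs] at hbdU hbdW
  have hUb : U t' x' - W s' y' - m ≤ N := by
    have := abs_le.1 hbdU
    have := abs_le.1 hbdW
    have := le_abs_self M1
    have := le_abs_self M2
    have := neg_abs_le m
    linarith
  have hpt : 0 ≤ η * (t' - a) := mul_nonneg hη0.le (by linarith [ht'.1])
  have hval : m + 2 * σ ≤ Φ ((t', x'), (s', y')) := by
    refine le_trans ?_ (hmax t ⟨ht.1.le, hte.le⟩ t ⟨ht.1.le, hte.le⟩ x x)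
    simp only [hΦ, hβt, sub_self]
    have h1 : η * (t - a) ≤ η * (b - a) := by gcongr; exact ht.2.le
    have h2 : 2 / Q = 1 / Q + 1 / Q := by ring
    have h3 : (0:ℝ) ^ 2 / (2 * ε) = 0 := by simp
    linarith
  simp only [hΦ] at hval
  have q1 : 0 ≤ (x' - y') ^ 2 / (2 * ε) := by positivity
  have q2 : 0 ≤ (t' - s') ^ 2 / (2 * ε) := by positivity
  have hdx : |x' - y'| < r := by
    have h1 : (x' - y') ^ 2 / (2 * ε) ≤ N := by linarith [hβ0 t', hβ0 s']
    rw [div_le_iff₀ (by positivity)] at h1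
    exact abs_lt_of_sq_lt_sq (by linarith) hr0.le
  have hdt : |t' - s'| < r := by
    have h1 : (t' - s') ^ 2 / (2 * ε) ≤ N := by linarith [hβ0 t', hβ0 s']
    rw [div_le_iff₀ (by positivity)] at h1
    exact abs_lt_of_sq_lt_sq (by linarith) hr0.le
  have hte' : t' < e := by
    refine lt_of_le_of_ne ht'.2 fun h => ?_
    have : β t' = Q := by rw [h]; exact hβ2
    have h2 : 0 < 2 / σ := by positivity
    linarith [hβ0 s']
  have hse' : s' < e := by
    refine lt_of_le_of_ne hs'.2 fun h => ?_
    have : β s' = Q := by rw [h]; exact hβ2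
    have h2 : 0 < 2 / σ := by positivity
    linarith [hβ0 t']
  have hrU' : r ≤ rU := (min_le_left _ _).trans (min_le_left _ _)
  have hrW' : r ≤ rW := (min_le_left _ _).trans (min_le_right _ _)
  have hat' : a < t' := by
    refine lt_of_le_of_ne ht'.1 fun h => ?_
    have h1 := hrW (a, x') ⟨⟨le_rfl, hab.le⟩, by linarith [hx'.1], by linarith [hx'.2]⟩
      (s', y') ⟨⟨hs'.1, hs'.2.trans heb.le⟩, hy'⟩ (by
        rw [Prod.dist_eq]
        simp only [Real.dist_eq]
        rw [← h] at hdt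
        exact max_lt (by linarith) (by linarith))
    rw [Real.dist_eq] at h1
    have h2 := (abs_lt.1 h1).2
    have h3 := hm x'
    rw [← h] at hval
    have : β a > 0 := hβ0 a
    rw [← h] at q2
    linarith [hβ0 s']
  have has' : a < s' := by
    refine lt_of_le_of_ne hs'.1 fun h => ?_
    have h1 := hrU (t', x') ⟨⟨ht'.1, ht'.2.trans heb.le⟩, by linarith [hx'.1], by linarith [hx'.2]⟩
      (a, y') ⟨⟨le_rfl, hab.le⟩, hy'⟩ (by
        rw [Prod.dist_eq]
        simp only [Real.dist_eq]
        rw [← h] at hdt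
        exact max_lt (by linarith) (by linarith))
    rw [Real.dist_eq] at h1
    have h2 := (abs_lt.1 h1).2
    have h3 := hm y'
    rw [← h] at hval
    have : β a > 0 := hβ0 a
    rw [← h] at q2
    linarith [hβ0 t']
  set p := (x' - y') / ε with hp
  have hpL : |p| ≤ 2 * L := by
    have hsq : (x' - y') ^ 2 / (2 * ε) ≤ L * |x' - y'| := by
      rcases hLip with h | h
      · have h1 := hmax t' ht' s' hs' y' y'
        simp only [hΦ, sub_self] at h1
        have h2 := (le_abs_self _).trans (h t' ⟨ht'.1, ht'.2.trans heb.le⟩ x' y')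
        have h3 : (0:ℝ) ^ 2 / (2 * ε) = 0 := by simp
        linarith
      · have h1 := hmax t' ht' s' hs' x' x'
        simp only [hΦ, sub_self] at h1
        have h2 := (le_abs_self _).trans (h s' ⟨hs'.1, hs'.2.trans heb.le⟩ x' y')
        have h3 : (0:ℝ) ^ 2 / (2 * ε) = 0 := by simp
        linarith
    rw [hp, abs_div, abs_of_pos hε0, div_le_iff₀ hε0]
    rw [div_le_iff₀ (by positivity), ← sq_abs] at hsq
    by_contra! hlt
    have h0 : 0 < |x' - y'| := lt_of_le_of_lt (by positivity) hlt
    nlinarith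
  -- the two tests
  have hsqd : ∀ y x : ℝ, HasDerivAt (fun x : ℝ => (x - y) ^ 2 / (2 * ε)) ((x - y) / ε) x := by
    intro y x
    have h1 : HasDerivAt (fun x : ℝ => (x - y) ^ 2 / (2 * ε)) (2 * (x - y) / (2 * ε)) x := by
      simpa using (((hasDerivAt_id x).sub_const y).pow 2).div_const (2 * ε)
    convert h1 using 1
    field_simp
  have hfd : ∀ (f g : ℝ → ℝ) (f' g' t x : ℝ), HasDerivAt f f' t → HasDerivAt g g' x →
      fderiv ℝ (fun w : ℝ × ℝ => f w.1 + g w.2) (t, x) (1, 0) = f' ∧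
      fderiv ℝ (fun w : ℝ × ℝ => f w.1 + g w.2) (t, x) (0, 1) = g' := by
    intro f g f' g' t x hf hg
    have h1 : HasFDerivAt (fun w : ℝ × ℝ => f w.1) (f' • ContinuousLinearMap.fst ℝ ℝ ℝ)
        (t, x) := HasDerivAt.comp_hasFDerivAt (t, x) hf hasFDerivAt_fst
    have h2 : HasFDerivAt (fun w : ℝ × ℝ => g w.2) (g' • ContinuousLinearMap.snd ℝ ℝ ℝ)
        (t, x) := HasDerivAt.comp_hasFDerivAt (t, x) hg hasFDerivAt_snd
    have h3 : fderiv ℝ (fun w : ℝ × ℝ => f w.1 + g w.2) (t, x) = _ := (h1.add h2).fderiv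
    rw [h3]
    simp
  have hnhds : ∀ τ x : ℝ, a < τ → τ < e → ∀ᶠ w : ℝ × ℝ in 𝓝 (τ, x), w.1 ∈ Icc a e := by
    intro τ x h1 h2
    have : Tendsto (fun w : ℝ × ℝ => w.1) (𝓝 (τ, x)) (𝓝 τ) := continuous_fst.tendsto _
    exact this.eventually (Icc_mem_nhds h1 h2)
  have hsubt := hU (fun w => ((w.1 - s') ^ 2 / (2 * ε) + β w.1 + η * (w.1 - a)) +
    (w.2 - y') ^ 2 / (2 * ε)) (by fun_prop) (t', x') ⟨⟨hat', hte'.trans heb⟩, trivial⟩ (by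
      filter_upwards [hnhds t' x' hat' hte'] with w hw
      have := hmax w.1 hw s' hs' w.2 y'
      simp only [hΦ] at this
      linarith)
  have hsupt := hW (fun w => (-((w.1 - t') ^ 2 / (2 * ε)) - β w.1) +
    -((w.2 - x') ^ 2 / (2 * ε))) (by fun_prop) (s', y') ⟨⟨has', hse'.trans heb⟩, trivial⟩ (by
      filter_upwards [hnhds s' y' has' hse'] with w hw
      have := hmax t' ht' w.1 hw x' w.2
      simp only [hΦ] at this
      rw [← neg_sub t' w.1, ← neg_sub x' w.2, ← neg_sub t' s', ← neg_sub x' y']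
      simp only [even_two, Even.neg_pow]
      linarith)
  obtain ⟨d1, d2⟩ := hfd (fun τ => (τ - s') ^ 2 / (2 * ε) + β τ + η * (τ - a))
    (fun x => (x - y') ^ 2 / (2 * ε)) _ _ t' x'
    (((hsqd s' t').add (hβd t')).add (((hasDerivAt_id t').sub_const a).const_mul η)) (hsqd y' x')
  obtain ⟨d3, d4⟩ := hfd (fun τ => -((τ - t') ^ 2 / (2 * ε)) - β τ)
    (fun x => -((x - x') ^ 2 / (2 * ε))) _ _ s' y'
    ((hsqd t' s').neg.sub (hβd s')) (hsqd x' y').neg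
  simp only at hsubt hsupt
  rw [d1, d2] at hsubt
  rw [d3, d4] at hsupt
  have e1 : -((y' - x') / ε) = p := by rw [hp]; ring
  have e2 : -((s' - t') / ε) = (t' - s') / ε := by ring
  rw [e1, e2] at hsupt
  rw [← hp] at hsubt
  have hcp : |c + p| ≤ |c| + 2 * L := (abs_add_le _ _).trans (by linarith)
  have hH' := hC s' ⟨hs'.1, hs'.2.trans heb.le⟩ t' ⟨ht'.1, ht'.2.trans heb.le⟩ y' x' (c + p) (c + p)
    hcp hcp
  rw [sub_self, abs_zero, add_zero, abs_sub_comm s', abs_sub_comm y'] at hH'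
  have h1 := (le_abs_self _).trans hH'
  have h2 : r ≤ η / (4 * C) := min_le_right _ _
  have h3 : C * (|t' - s'| + |x' - y'|) ≤ C * (η / (4 * C) + η / (4 * C)) := by
    gcongr <;> linarith
  have h4 : C * (η / (4 * C) + η / (4 * C)) = η / 2 := by field_simp; ring
  have h5 := mul_nonneg hA0 (hβ0 t').le
  have h6 := mul_nonneg hA0 (hβ0 s').le
  linarith

end BurgersHyp

/-- A function whose increments are controlled by an integral and whose derivative is almost
everywhere bounded by `k` has increment bounded by the integral of `k`. -/
theorem sub_le_integral_of_ae_hasDerivAt_le {f h k : ℝ → ℝ} {a b : ℝ} (hab : a ≤ b)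
    (hh : IntervalIntegrable h volume a b) (hk : IntervalIntegrable k volume a b)
    (hf : ∀ r ∈ Icc a b, ∀ s ∈ Icc a b, |f s - f r| ≤ |∫ σ in r..s, h σ|)
    (hd : ∀ᵐ s, s ∈ Ioo a b → ∃ f', HasDerivAt f f' s ∧ f' ≤ k s) :
    f b - f a ≤ ∫ s in a..b, k s := by
  have hac : AbsolutelyContinuousOnInterval f a b := by
    have h1 := hh.absolutelyContinuousOnInterval_intervalIntegral (c := a) left_mem_uIcc
    unfold AbsolutelyContinuousOnInterval at h1 ⊢
    refine squeeze_zero' (Eventually.of_forall fun E => Finset.sum_nonneg fun _ _ => dist_nonneg)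
      ?_ h1
    have h2 : ∀ᶠ E in AbsolutelyContinuousOnInterval.totalLengthFilter ⊓
        𝓟 (AbsolutelyContinuousOnInterval.disjWithin a b),
        E ∈ AbsolutelyContinuousOnInterval.disjWithin a b :=
      eventually_inf_principal.2 (Eventually.of_forall fun _ h => h)
    filter_upwards [h2] with E hE
    refine Finset.sum_le_sum fun i hi => ?_
    obtain ⟨h3, h4⟩ := hE.1 i hi
    have hsub : ∀ r ∈ uIcc a b, IntervalIntegrable h volume a r := fun r hr =>
      hh.mono_set (uIcc_subset_uIcc left_mem_uIcc hr)
    rw [Real.dist_eq, Real.dist_eq, intervalIntegral.integral_interval_sub_left (hsub _ h3)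
      (hsub _ h4)]
    rw [uIcc_of_le hab] at h3 h4
    exact hf _ h4 _ h3
  rw [← hac.integral_deriv_eq_sub]
  refine intervalIntegral.integral_mono_ae_restrict hab hac.intervalIntegrable_deriv hk ?_
  have h5 : ∀ᵐ s ∂volume.restrict (Icc a b), s ∈ Ioo a b := by
    rw [← restrict_Ioo_eq_restrict_Icc]
    exact ae_restrict_mem measurableSet_Ioo
  filter_upwards [ae_restrict_of_ae hd, h5] with s hs hs'
  obtain ⟨f', h6, h7⟩ := hs hs'
  rw [h6.deriv]; exact h7

/-- A Lipschitz function on the strip is differentiable almost everywhere in its interior. -/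
theorem ae_differentiableAt_strip {u : ℝ → ℝ → ℝ} {a b K : ℝ} (hK : 0 ≤ K)
    (hu : ∀ t ∈ Icc a b, ∀ s ∈ Icc a b, ∀ x y, |u t x - u s y| ≤ K * (|t - s| + |x - y|)) :
    ∀ᵐ z ∂(volume.restrict (Ioo a b ×ˢ (univ : Set ℝ))),
      DifferentiableAt ℝ (fun w : ℝ × ℝ => u w.1 w.2) z := by
  have hopen : IsOpen (Ioo a b ×ˢ (univ : Set ℝ)) := isOpen_Ioo.prod isOpen_univ
  have hL : LipschitzOnWith (Real.toNNReal (2 * K)) (fun w : ℝ × ℝ => u w.1 w.2)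
      (Ioo a b ×ˢ (univ : Set ℝ)) := by
    refine LipschitzOnWith.of_dist_le_mul fun z hz w hw => ?_
    rw [Real.coe_toNNReal _ (by positivity), Real.dist_eq, Prod.dist_eq, Real.dist_eq, Real.dist_eq]
    refine (hu _ (Ioo_subset_Icc_self hz.1) _ (Ioo_subset_Icc_self hw.1) _ _).trans ?_
    have h1 := le_max_left |z.1 - w.1| |z.2 - w.2|
    have h2 := le_max_right |z.1 - w.1| |z.2 - w.2|
    nlinarith
  rw [ae_restrict_iff' hopen.measurableSet]
  filter_upwards [hL.ae_differentiableWithinAt_of_mem (μ := volume)] with z hz hmem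
  exact (hz hmem).differentiableAt (hopen.mem_nhds hmem)

/-- The partial derivatives of a Lipschitz function are bounded. -/
theorem abs_fderiv_apply_le_strip {u : ℝ → ℝ → ℝ} {a b K : ℝ} (hK : 0 ≤ K)
    (hu : ∀ t ∈ Icc a b, ∀ s ∈ Icc a b, ∀ x y, |u t x - u s y| ≤ K * (|t - s| + |x - y|))
    {z : ℝ × ℝ} (hz : z.1 ∈ Ioo a b) (w : ℝ × ℝ) :
    |fderiv ℝ (fun w : ℝ × ℝ => u w.1 w.2) z w| ≤ 2 * K * ‖w‖ := by
  have h : ‖fderiv ℝ (fun w : ℝ × ℝ => u w.1 w.2) z‖ ≤ 2 * K := by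
    refine norm_fderiv_le_of_lip' ℝ (by positivity) ?_
    have h1 : ∀ᶠ w : ℝ × ℝ in 𝓝 z, w.1 ∈ Ioo a b :=
      (continuous_fst.tendsto z).eventually (isOpen_Ioo.mem_nhds hz)
    filter_upwards [h1] with w hw
    rw [Real.norm_eq_abs, Prod.norm_def]
    refine (hu _ (Ioo_subset_Icc_self hw) _ (Ioo_subset_Icc_self hz) _ _).trans ?_
    have h1 := le_max_left |w.1 - z.1| |w.2 - z.2|
    have h2 := le_max_right |w.1 - z.1| |w.2 - z.2|
    simp only [Prod.fst_sub, Prod.snd_sub, Real.norm_eq_abs]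
    nlinarith
  rw [← Real.norm_eq_abs]
  exact (ContinuousLinearMap.le_opNorm _ _).trans (by gcongr)

namespace BurgersHyp

variable {H : ℝ → ℝ → ℝ → ℝ} {c : ℝ}

/-- A Lipschitz almost everywhere subsolution is dominated by the action. -/
theorem le_action_of_ae (hH : BurgersHyp H) {u : ℝ → ℝ → ℝ} {a b K : ℝ} (hab : a ≤ b) (hK : 0 ≤ K)
    (hu : ∀ t ∈ Icc a b, ∀ s ∈ Icc a b, ∀ x y, |u t x - u s y| ≤ K * (|t - s| + |x - y|))
    (hae : ∀ᵐ z ∂(volume.restrict (Ioo a b ×ˢ (univ : Set ℝ))),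
      DifferentiableAt ℝ (fun w : ℝ × ℝ => u w.1 w.2) z ∧
      fderiv ℝ (fun w : ℝ × ℝ => u w.1 w.2) z (1, 0)
        + H z.1 z.2 (c + fderiv ℝ (fun w : ℝ × ℝ => u w.1 w.2) z (0, 1)) ≤ 0)
    {ξ g : ℝ → ℝ} (hAC : IsAC ξ g a b)
    (hint : IntervalIntegrable (fun s => Lag H s (ξ s) (g s) - c * g s) volume a b) :
    u b (ξ b) ≤ u a (ξ a) + ∫ s in a..b, (Lag H s (ξ s) (g s) - c * g s) := by
  set F : ℝ × ℝ → ℝ := fun w => u w.1 w.2 with hF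
  set P : ℝ × ℝ → Prop := fun z => z.1 ∈ Ioo a b → DifferentiableAt ℝ F z ∧
      fderiv ℝ F z (1, 0) + H z.1 z.2 (c + fderiv ℝ F z (0, 1)) ≤ 0 with hP
  have hae' : ∀ᵐ z : ℝ × ℝ, P z := by
    rw [ae_restrict_iff' (measurableSet_Ioo.prod MeasurableSet.univ)] at hae
    filter_upwards [hae] with z hz h1 using hz ⟨h1, trivial⟩
  obtain ⟨N, hN1, hN2, hN3⟩ := exists_measurable_superset_of_null hae'
  have hgi := hAC.1
  -- a continuous extension of the curve
  obtain ⟨η, hηc, hη⟩ : ∃ η : ℝ → ℝ, Continuous η ∧ ∀ s ∈ Icc a b, η s = ξ s := by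
    have hc : ContinuousOn ξ (Icc a b) := by
      have h1 : ContinuousOn (fun t => ξ a + ∫ s in a..t, g s) (Icc a b) := by
        have := intervalIntegral.continuousOn_primitive_interval' hgi left_mem_uIcc
        rw [uIcc_of_le hab] at this
        exact continuousOn_const.add this
      exact h1.congr hAC.2
    exact ⟨IccExtend hab ((Icc a b).domRestrict ξ), (continuousOn_iff_continuous_domRestrict.1 hc).Icc_extend',
      fun s hs => by rw [IccExtend_of_mem hab _ hs]; rfl⟩
  have hgood : ∀ᵐ y : ℝ, ∀ᵐ s : ℝ, (s, η s + y) ∉ N := by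
    have hmeas : MeasurableSet {q : ℝ × ℝ | (q.1, η q.1 + q.2) ∉ N} := by
      have : Measurable fun q : ℝ × ℝ => (q.1, η q.1 + q.2) := by fun_prop
      exact this hN2.compl
    rw [← Measure.ae_ae_comm (p := fun s y => (s, η s + y) ∉ N) hmeas]
    have h1 : ∀ᵐ z ∂((volume : Measure ℝ).prod (volume : Measure ℝ)), z ∉ N := by
      rw [← Measure.volume_eq_prod]
      exact compl_mem_ae_iff.2 hN3
    filter_upwards [Measure.ae_ae_of_ae_prod h1] with s hs
    exact (measurePreserving_add_left volume (η s)).quasiMeasurePreserving.ae hs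
  obtain ⟨C, hC0, hC⟩ := exists_lipschitz_of_periodic (hH.smooth.of_le (by norm_num)) hH.per_x a b
    (|c| + 2 * K)
  have hstep : ∀ y : ℝ, (∀ᵐ s : ℝ, (s, η s + y) ∉ N) →
      u b (ξ b + y) - u a (ξ a + y) ≤
        (∫ s in a..b, (Lag H s (ξ s) (g s) - c * g s)) + C * |y| * (b - a) := by
    intro y hy
    have hξη : ∀ s ∈ Icc a b, ∀ r ∈ Icc a b, ξ s - ξ r = ∫ σ in r..s, g σ := by
      intro s hs r hr
      have hsub : ∀ r ∈ Icc a b, IntervalIntegrable g volume a r := fun r hr =>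
        hgi.mono_set (uIcc_subset_uIcc left_mem_uIcc (by rwa [uIcc_of_le hab]))
      rw [hAC.2 s hs, hAC.2 r hr, ← intervalIntegral.integral_interval_sub_left (hsub s hs)
        (hsub r hr)]
      ring
    have hk : IntervalIntegrable (fun s => Lag H s (ξ s) (g s) - c * g s + C * |y|) volume a b :=
      hint.add intervalIntegrable_const
    have key := sub_le_integral_of_ae_hasDerivAt_le (f := fun s => u s (ξ s + y))
      (h := fun s => K * (1 + |g s|)) hab
      ((intervalIntegrable_const.add hgi.abs).const_mul K) hk ?_ ?_
    · rw [intervalIntegral.integral_add hint intervalIntegrable_const,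
        intervalIntegral.integral_const, smul_eq_mul] at key
      linarith
    · have hrs : ∀ r ∈ Icc a b, ∀ s ∈ Icc a b, r ≤ s →
          |u s (ξ s + y) - u r (ξ r + y)| ≤ |∫ σ in r..s, K * (1 + |g σ|)| := by
        intro r hr s hs hle
        refine le_trans ?_ (le_abs_self _)
        have hi : IntervalIntegrable g volume r s := hgi.mono_set (by
          rw [uIcc_of_le hle, uIcc_of_le hab]; exact Icc_subset_Icc hr.1 hs.2)
        rw [intervalIntegral.integral_const_mul, intervalIntegral.integral_add
          intervalIntegrable_const hi.abs, intervalIntegral.integral_const, smul_eq_mul, mul_one]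
        refine (hu s hs r hr _ _).trans ?_
        rw [abs_of_nonneg (sub_nonneg.2 hle), add_sub_add_right_eq_sub, hξη s hs r hr]
        gcongr
        exact intervalIntegral.abs_integral_le_integral_abs hle
      intro r hr s hs
      rcases le_total r s with h | h
      · exact hrs r hr s hs h
      · rw [abs_sub_comm, intervalIntegral.integral_symm, abs_neg]
        exact hrs s hs r hr h
    · filter_upwards [hy, hgi.ae_hasDerivAt_integral] with s hs1 hs2 hs
      have hsI : s ∈ Icc a b := Ioo_subset_Icc_self hs
      have hg : HasDerivAt (fun s => ξ s + y) (g s) s := by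
        have h1 := hs2 (by rwa [uIcc_of_le hab]) a left_mem_uIcc
        have h2 := (h1.const_add (ξ a)).add_const y
        refine h2.congr_of_eventuallyEq ?_
        filter_upwards [Icc_mem_nhds hs.1 hs.2] with r hr
        rw [hAC.2 r hr]
      obtain ⟨h1, h2⟩ : DifferentiableAt ℝ F (s, ξ s + y) ∧
          fderiv ℝ F (s, ξ s + y) (1, 0) + H s (ξ s + y) (c + fderiv ℝ F (s, ξ s + y) (0, 1)) ≤ 0 := by
        by_contra hcon
        rw [hη s hsI] at hs1
        refine hs1 (hN1 fun hp => hcon (hp hs))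
      refine ⟨fderiv ℝ F (s, ξ s + y) (1, g s), ?_, ?_⟩
      · exact HasFDerivAt.comp_hasDerivAt (f := fun s => (s, ξ s + y)) s h1.hasFDerivAt
          ((hasDerivAt_id s).prodMk hg)
      · have e1 : ((1:ℝ), g s) = (1, 0) + g s • ((0:ℝ), (1:ℝ)) := by simp
        rw [e1, map_add, map_smul, smul_eq_mul]
        set p := fderiv ℝ F (s, ξ s + y) (0, 1)
        have hp : |c + p| ≤ |c| + 2 * K := by
          have := abs_fderiv_apply_le_strip hK hu (z := (s, ξ s + y)) hs (0, 1)
          have hn : ‖((0:ℝ), (1:ℝ))‖ = 1 := by simp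
          rw [hn, mul_one] at this
          exact (abs_add_le _ _).trans (by linarith)
        have h3 := hH.le_Lag s (ξ s) (g s) (c + p)
        have h4 := hC s hsI s hsI (ξ s) (ξ s + y) (c + p) (c + p) hp hp
        rw [sub_self, sub_self, abs_zero, zero_add, add_zero, sub_add_cancel_left, abs_neg] at h4
        have h5 := (abs_le.1 h4).2
        linarith
  refine le_of_forall_pos_le_add fun ε hε => ?_
  set D := 2 * K + C * (b - a) + 1 with hD
  have hD0 : 0 < D := by
    have : 0 ≤ b - a := by linarith
    positivity
  have hex : ∃ y : ℝ, |y| < ε / D ∧ ∀ᵐ s : ℝ, (s, η s + y) ∉ N := by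
    by_contra! hcon
    have h0 : volume (Metric.ball (0:ℝ) (ε / D)) = 0 :=
      measure_mono_null (fun y hy => hcon y (by simpa using hy)) hgood
    exact (Metric.measure_ball_pos volume (0:ℝ) (by positivity)).ne' h0
  obtain ⟨y, hy1, hy2⟩ := hex
  have h1 := hstep y hy2
  have h2 := hu b (right_mem_Icc.2 hab) b (right_mem_Icc.2 hab) (ξ b) (ξ b + y)
  have h3 := hu a (left_mem_Icc.2 hab) a (left_mem_Icc.2 hab) (ξ a + y) (ξ a)
  rw [sub_self, abs_zero, zero_add, sub_add_cancel_left, abs_neg] at h2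
  rw [sub_self, abs_zero, zero_add, add_sub_cancel_left] at h3
  have h4 := (abs_le.1 h2).2
  have h5 := (abs_le.1 h3).2
  rw [lt_div_iff₀ hD0, hD] at hy1
  nlinarith [abs_nonneg y]

end BurgersHyp

namespace BurgersHyp

variable {H : ℝ → ℝ → ℝ → ℝ}

theorem Hp_add_int (hH : BurgersHyp H) (t x p : ℝ) (n : ℤ) : Hp H t (x + n) p = Hp H t x p := by
  have h : Function.Periodic (fun y => Hp H t y p) 1 := fun y => hH.Hp_periodic t y p
  simpa using h.int_mul n x

theorem Hx_add_int (hH : BurgersHyp H) (t x p : ℝ) (n : ℤ) : Hx H t (x + n) p = Hx H t x p := by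
  have h : Function.Periodic (fun y => Hx H t y p) 1 := fun y => hH.Hx_periodic t y p
  simpa using h.int_mul n x

/-- The local version of the a priori bound on approximate trajectories of the Hamiltonian flow. -/
theorem exists_flow_bound_nhds (hH : BurgersHyp H) {a b s x₀ p₀ : ℝ} (hs : s ∈ Icc a b) :
    ∃ R, 0 < R ∧ ∃ δ, 0 < δ ∧ ∀ s₀ s₁, a ≤ s₀ → s₀ ≤ s₁ → s₁ ≤ b → ∀ ξ p ξ' p' : ℝ → ℝ,
      ContinuousOn ξ (Icc s₀ s₁) → ContinuousOn p (Icc s₀ s₁) →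
      (∀ σ ∈ Ico s₀ s₁, HasDerivWithinAt ξ (ξ' σ) (Ici σ) σ) →
      (∀ σ ∈ Ico s₀ s₁, HasDerivWithinAt p (p' σ) (Ici σ) σ) →
      (∀ σ ∈ Ico s₀ s₁, |p σ| ≤ R → |ξ' σ - Hp H σ (ξ σ) (p σ)| ≤ δ ∧
        |p' σ + Hx H σ (ξ σ) (p σ)| ≤ δ) →
      |s₀ - s| < δ → |ξ s₀ - x₀| < δ → |p s₀ - p₀| < δ → ∀ σ ∈ Icc s₀ s₁, |p σ| ≤ R := by
  obtain ⟨γ, hγs, hγ⟩ := hH.complete s (x₀, p₀)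
  have hγc : Continuous γ := continuous_iff_continuousAt.2 fun t => (hγ t).continuousAt
  obtain ⟨ρ, hρ⟩ := (isCompact_Icc (a := a) (b := b)).exists_bound_of_continuousOn
    (f := fun t => (γ t).2) (by fun_prop)
  have hρ0 : 0 ≤ ρ := (norm_nonneg _).trans (hρ s hs)
  set R := ρ + 1 with hR
  obtain ⟨C₁, hC₁0, hC₁⟩ := exists_lipschitz_of_periodic hH.contDiff_Hp hH.Hp_periodic a b R
  obtain ⟨C₂, hC₂0, hC₂⟩ := exists_lipschitz_of_periodic hH.contDiff_Hx hH.Hx_periodic a b R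
  set K : ℝ := 2 * (C₁ + C₂) + 1 with hK
  have hK1 : 1 ≤ K := by rw [hK]; linarith
  have hLip : ∀ t ∈ Icc a b, LipschitzOnWith K.toNNReal (HamVF H t) {z | |z.2| ≤ R} := by
    intro t ht
    refine LipschitzOnWith.of_dist_le_mul fun z hz w hw => ?_
    rw [Real.coe_toNNReal _ (by linarith), Prod.dist_eq, Real.dist_eq, Real.dist_eq]
    have e1 := hC₁ t ht t ht z.1 w.1 z.2 w.2 hz hw
    have e2 := hC₂ t ht t ht z.1 w.1 z.2 w.2 hz hw
    have d1 : |z.1 - w.1| ≤ dist z w := by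
      rw [Prod.dist_eq, ← Real.dist_eq]; exact le_max_left _ _
    have d2 : |z.2 - w.2| ≤ dist z w := by
      rw [Prod.dist_eq, ← Real.dist_eq]; exact le_max_right _ _
    rw [sub_self, abs_zero, zero_add] at e1 e2
    have hd : 0 ≤ dist z w := dist_nonneg
    refine max_le ?_ ?_
    · change |Hp H t z.1 z.2 - Hp H t w.1 w.2| ≤ _
      nlinarith
    · change |-Hx H t z.1 z.2 - -Hx H t w.1 w.2| ≤ _
      rw [neg_sub_neg, abs_sub_comm]
      nlinarith
  set E := Real.exp (K * (b - a)) with hE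
  have hE1 : 1 ≤ E := Real.one_le_exp (mul_nonneg (by linarith) (by linarith [hs.1, hs.2]))
  set θ := 1 / (4 * E) with hθ
  have hθ0 : 0 < θ := by positivity
  obtain ⟨r, hr0, hr⟩ := Metric.continuousAt_iff.1 (hγc.continuousAt (x := s)) (θ / 2) (by positivity)
  refine ⟨R, by linarith, min (θ / 2) r, by positivity, ?_⟩
  intro s₀ s₁ has h01 hsb ξ p ξ' p' hξ hp hξ' hp' happ hs0 hx0 hp0
  by_contra hcon
  push Not at hcon
  obtain ⟨σ₁, hσ₁, hσ₁R⟩ := hcon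
  -- the first time at which the bound is attained
  have hcl : IsCompact (Icc s₀ s₁ ∩ (fun σ => |p σ|) ⁻¹' (Ici R)) :=
    isCompact_Icc.of_isClosed_subset (hp.abs.preimage_isClosed_of_isClosed isClosed_Icc isClosed_Ici)
      inter_subset_left
  obtain ⟨τ, ⟨hτ, hτR⟩, hτmin⟩ := hcl.exists_isLeast ⟨σ₁, hσ₁, hσ₁R.le⟩
  have hlt : ∀ σ ∈ Ico s₀ τ, |p σ| < R := by
    intro σ hσ
    by_contra h
    exact absurd (hτmin ⟨⟨hσ.1, hσ.2.le.trans hτ.2⟩, not_lt.1 h⟩) (not_le.2 hσ.2)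
  have hIco : ∀ σ ∈ Ico s₀ τ, σ ∈ Ico s₀ s₁ := fun σ hσ => ⟨hσ.1, hσ.2.trans_le hτ.2⟩
  have hab : ∀ σ ∈ Ico s₀ τ, σ ∈ Icc a b := fun σ hσ =>
    ⟨has.trans hσ.1, (hIco σ hσ).2.le.trans hsb⟩
  have hgr := dist_le_of_approx_trajectories_ODE_of_mem (E := ℝ × ℝ) (v := HamVF H)
    (s := fun _ => {z | |z.2| ≤ R})
    (f := fun σ => (ξ σ, p σ)) (f' := fun σ => (ξ' σ, p' σ)) (g := γ) (g' := fun σ => HamVF H σ (γ σ))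
    (a := s₀) (b := τ) (K := K.toNNReal) (εf := θ) (εg := 0) (δ := θ)
    (fun t ht => hLip t (hab t ht))
    ((hξ.mono (Icc_subset_Icc_right hτ.2)).prodMk (hp.mono (Icc_subset_Icc_right hτ.2)))
    (fun t ht => (hξ' t (hIco t ht)).prodMk (hp' t (hIco t ht)))
    (fun t ht => by
      obtain ⟨h1, h2⟩ := happ t (hIco t ht) (hlt t ht).le
      have h3 : min (θ / 2) r ≤ θ := (min_le_left _ _).trans (by linarith)
      rw [Prod.dist_eq, Real.dist_eq, Real.dist_eq]
      refine max_le (h1.trans h3) ?_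
      change |p' t - -Hx H t (ξ t) (p t)| ≤ θ
      rw [sub_neg_eq_add]
      exact h2.trans h3)
    (fun t ht => (hlt t ht).le)
    hγc.continuousOn (fun t _ => (hγ t).hasDerivWithinAt) (fun t _ => by rw [dist_self])
    (fun t ht => by
      have := hρ t (hab t ht)
      rw [Real.norm_eq_abs] at this
      change |(γ t).2| ≤ R
      linarith)
    (by
      have h1 := hr (x := s₀) (by rw [Real.dist_eq]; exact hs0.trans_le (min_le_right _ _))
      rw [hγs] at h1
      have h2 : dist ((ξ s₀, p s₀) : ℝ × ℝ) (x₀, p₀) ≤ θ / 2 := by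
        rw [Prod.dist_eq, Real.dist_eq, Real.dist_eq]
        exact max_le (hx0.le.trans (min_le_left _ _)) (hp0.le.trans (min_le_left _ _))
      have h3 := dist_triangle_right ((ξ s₀, p s₀) : ℝ × ℝ) (γ s₀) (x₀, p₀)
      linarith) τ ⟨hτ.1, le_rfl⟩
  rw [gronwallBound_of_K_ne_0 (by rw [Real.coe_toNNReal _ (by linarith)]; linarith),
    Real.coe_toNNReal _ (by linarith : 0 ≤ K)] at hgr
  have hexp : Real.exp (K * (τ - s₀)) ≤ E :=
    Real.exp_le_exp.2 (mul_le_mul_of_nonneg_left (by linarith [hτ.2]) (by linarith))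
  have h1e : 1 ≤ Real.exp (K * (τ - s₀)) :=
    Real.one_le_exp (mul_nonneg (by linarith) (by linarith [hτ.1]))
  have hdiv : (θ + 0) / K ≤ θ := by
    rw [add_zero]; exact div_le_self hθ0.le hK1
  have hθE : θ * E = 1 / 4 := by rw [hθ]; field_simp
  have hfin : dist ((ξ τ, p τ) : ℝ × ℝ) (γ τ) ≤ 1 / 2 := by
    refine hgr.trans ?_
    dsimp only
    have e1 : θ * Real.exp (K * (τ - s₀)) ≤ θ * E := mul_le_mul_of_nonneg_left hexp hθ0.le
    have e2 : (θ + 0) / K * (Real.exp (K * (τ - s₀)) - 1) ≤ θ * (E - 1) :=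
      mul_le_mul hdiv (by linarith) (by linarith) hθ0.le
    nlinarith
  have hpτ : |p τ - (γ τ).2| ≤ 1 / 2 := by
    refine le_trans ?_ hfin
    rw [Prod.dist_eq, ← Real.dist_eq]; exact le_max_right _ _
  have hγτ := hρ τ ⟨has.trans hτ.1, hτ.2.trans hsb⟩
  rw [Real.norm_eq_abs] at hγτ
  have hRτ : R ≤ |p τ| := hτR
  have := abs_sub_abs_le_abs_sub (p τ) (γ τ).2
  linarith

/-- Approximate trajectories of the Hamiltonian flow starting with a bounded momentum keep a
bounded momentum. -/
theorem exists_flow_bound (hH : BurgersHyp H) (a b R : ℝ) :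
    ∃ R', 0 < R' ∧ ∃ δ, 0 < δ ∧ ∀ s₀ s₁, a ≤ s₀ → s₀ ≤ s₁ → s₁ ≤ b → ∀ ξ p ξ' p' : ℝ → ℝ,
      ContinuousOn ξ (Icc s₀ s₁) → ContinuousOn p (Icc s₀ s₁) →
      (∀ σ ∈ Ico s₀ s₁, HasDerivWithinAt ξ (ξ' σ) (Ici σ) σ) →
      (∀ σ ∈ Ico s₀ s₁, HasDerivWithinAt p (p' σ) (Ici σ) σ) →
      (∀ σ ∈ Ico s₀ s₁, |p σ| ≤ R' → |ξ' σ - Hp H σ (ξ σ) (p σ)| ≤ δ ∧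
        |p' σ + Hx H σ (ξ σ) (p σ)| ≤ δ) →
      |p s₀| ≤ R → ∀ σ ∈ Icc s₀ s₁, |p σ| ≤ R' := by
  have hK : IsCompact (Icc a b ×ˢ (Icc (0:ℝ) 1 ×ˢ Icc (-R) R)) :=
    isCompact_Icc.prod (isCompact_Icc.prod isCompact_Icc)
  have hloc : ∀ q : ℝ × ℝ × ℝ, ∃ R > 0, ∃ δ > 0, q.1 ∈ Icc a b → ∀ s₀ s₁, a ≤ s₀ → s₀ ≤ s₁ → s₁ ≤ b →
      ∀ ξ p ξ' p' : ℝ → ℝ,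
      ContinuousOn ξ (Icc s₀ s₁) → ContinuousOn p (Icc s₀ s₁) →
      (∀ σ ∈ Ico s₀ s₁, HasDerivWithinAt ξ (ξ' σ) (Ici σ) σ) →
      (∀ σ ∈ Ico s₀ s₁, HasDerivWithinAt p (p' σ) (Ici σ) σ) →
      (∀ σ ∈ Ico s₀ s₁, |p σ| ≤ R → |ξ' σ - Hp H σ (ξ σ) (p σ)| ≤ δ ∧
        |p' σ + Hx H σ (ξ σ) (p σ)| ≤ δ) →
      |s₀ - q.1| < δ → |ξ s₀ - q.2.1| < δ → |p s₀ - q.2.2| < δ → ∀ σ ∈ Icc s₀ s₁, |p σ| ≤ R := by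
    intro q
    by_cases hq : q.1 ∈ Icc a b
    · obtain ⟨R, hR, δ, hδ, h⟩ := hH.exists_flow_bound_nhds (x₀ := q.2.1) (p₀ := q.2.2) hq
      exact ⟨R, hR, δ, hδ, fun _ => h⟩
    · exact ⟨1, one_pos, 1, one_pos, fun h => absurd h hq⟩
  choose ρ hρ0 δ hδ0 hmain using hloc
  obtain ⟨T, hT, hcov⟩ := hK.elim_nhds_subcover (fun q => Metric.ball q (δ q))
    (fun q _ => Metric.ball_mem_nhds q (hδ0 q))
  obtain ⟨R', hR'⟩ := (T.image ρ).bddAbove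
  have hR'T : ∀ q ∈ T, ρ q ≤ R' := fun q hq => hR' (Finset.mem_coe.2 (Finset.mem_image_of_mem ρ hq))
  obtain ⟨d, hd0, hd⟩ : ∃ d, 0 < d ∧ ∀ q ∈ T, d ≤ δ q := by
    clear hcov hR' hR'T hT
    induction T using Finset.induction_on with
    | empty => exact ⟨1, one_pos, by simp⟩
    | insert q T _ ih =>
      obtain ⟨d, hd0, hd⟩ := ih
      refine ⟨min d (δ q), lt_min hd0 (hδ0 q), fun r hr => ?_⟩
      rcases Finset.mem_insert.1 hr with rfl | hr
      · exact min_le_right _ _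
      · exact (min_le_left _ _).trans (hd r hr)
  refine ⟨max R' 1, by positivity, d, hd0, ?_⟩
  intro s₀ s₁ has h01 hsb ξ p ξ' p' hξ hp hξ' hp' happ hR0 σ hσ
  set n : ℤ := ⌊ξ s₀⌋ with hn
  have hmem : (s₀, ξ s₀ - n, p s₀) ∈ Icc a b ×ˢ (Icc (0:ℝ) 1 ×ˢ Icc (-R) R) :=
    ⟨⟨has, h01.trans hsb⟩, ⟨sub_nonneg.2 (Int.floor_le _), by linarith [Int.lt_floor_add_one (ξ s₀)]⟩,
      abs_le.1 hR0⟩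
  have hq := hcov hmem
  simp only [mem_iUnion, exists_prop] at hq
  obtain ⟨q, hqT, hq⟩ := hq
  rw [Metric.mem_ball, Prod.dist_eq, Prod.dist_eq, max_lt_iff, max_lt_iff] at hq
  simp only [Real.dist_eq] at hq
  have hsh : ∀ t, ξ t - n = ξ t + ((-n : ℤ) : ℝ) := fun t => by push_cast; ring
  refine (hmain q (hT q hqT).1 s₀ s₁ has h01 hsb (fun t => ξ t - n) p ξ' p'
    (hξ.sub continuousOn_const) hp (fun t ht => (hξ' t ht).sub_const _) hp' ?_ hq.1 hq.2.1 hq.2.2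
    σ hσ).trans ((hR'T q hqT).trans (le_max_left _ _))
  intro t ht hpt
  rw [hsh, hH.Hp_add_int, hH.Hx_add_int]
  obtain ⟨h1, h2⟩ := happ t ht (hpt.trans ((hR'T q hqT).trans (le_max_left _ _)))
  exact ⟨h1.trans (hd q hqT), h2.trans (hd q hqT)⟩

end BurgersHyp

/-- The curve with velocity `g` which is at `x` at time `t`. -/
noncomputable def traj (g : ℝ → ℝ) (t x s : ℝ) : ℝ := x - ∫ σ in s..t, g σ

/-- The action, with initial cost `w` at time `a`, of the curve with velocity `g` which is at `x`
at time `t`. -/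
noncomputable def ctrlAction (H : ℝ → ℝ → ℝ → ℝ) (c : ℝ) (w : ℝ → ℝ) (a t x : ℝ) (g : ℝ → ℝ) : ℝ :=
  w (traj g t x a) + ∫ s in a..t, (Lag H s (traj g t x s) (g s) - c * g s)

/-- Measurable velocities bounded by `M`. -/
structure IsCtrl (M : ℝ) (g : ℝ → ℝ) : Prop where
  measurable : Measurable g
  bound : ∀ s, |g s| ≤ M

/-- The value function of the problem with velocities bounded by `M`. -/
noncomputable def ctrlValue (H : ℝ → ℝ → ℝ → ℝ) (c : ℝ) (w : ℝ → ℝ) (a M t x : ℝ) : ℝ :=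
  sInf {r | ∃ g, IsCtrl M g ∧ r = ctrlAction H c w a t x g}

theorem Measurable.intervalIntegrable_of_abs_le {f : ℝ → ℝ} (hf : Measurable f) {C a b : ℝ}
    (hC : ∀ s ∈ uIoc a b, |f s| ≤ C) : IntervalIntegrable f volume a b := by
  rw [intervalIntegrable_iff]
  refine Measure.integrableOn_of_bounded (M := C) (by simp [uIoc]) hf.aestronglyMeasurable ?_
  exact (ae_restrict_iff' measurableSet_uIoc).2 (ae_of_all _ hC)

namespace IsCtrl

variable {M : ℝ} {g g' : ℝ → ℝ}

theorem zero (hM : 0 ≤ M) : IsCtrl M fun _ => 0 := ⟨measurable_const, fun _ => by simpa using hM⟩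

theorem nonneg (hg : IsCtrl M g) : 0 ≤ M := (abs_nonneg _).trans (hg.bound 0)

theorem intervalIntegrable (hg : IsCtrl M g) (a b : ℝ) : IntervalIntegrable g volume a b :=
  hg.measurable.intervalIntegrable_of_abs_le fun s _ => hg.bound s

theorem ite (hg : IsCtrl M g) (hg' : IsCtrl M g') {s : Set ℝ} [DecidablePred (· ∈ s)]
    (hs : MeasurableSet s) : IsCtrl M fun t => if t ∈ s then g t else g' t :=
  ⟨Measurable.ite hs hg.measurable hg'.measurable, fun t => by
    split_ifs; exacts [hg.bound t, hg'.bound t]⟩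

theorem mono (hg : IsCtrl M g) {M' : ℝ} (h : M ≤ M') : IsCtrl M' g :=
  ⟨hg.measurable, fun s => (hg.bound s).trans h⟩

theorem traj_sub_traj (hg : IsCtrl M g) (t x s r : ℝ) :
    traj g t x r - traj g t x s = ∫ σ in s..r, g σ := by
  have := intervalIntegral.integral_add_adjacent_intervals (hg.intervalIntegrable s r)
    (hg.intervalIntegrable r t)
  unfold traj
  linarith

theorem abs_traj_sub_le (hg : IsCtrl M g) (t x s r : ℝ) :
    |traj g t x r - traj g t x s| ≤ M * |r - s| := by
  rw [hg.traj_sub_traj]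
  have := intervalIntegral.norm_integral_le_of_norm_le_const (f := g) (a := s) (b := r) (C := M)
    fun σ _ => hg.bound σ
  simpa using this

theorem continuous_traj (hg : IsCtrl M g) (t x : ℝ) : Continuous (traj g t x) := by
  have : LipschitzWith M.toNNReal (traj g t x) := LipschitzWith.of_dist_le_mul fun s r => by
    rw [Real.coe_toNNReal _ hg.nonneg, Real.dist_eq, Real.dist_eq]
    exact hg.abs_traj_sub_le t x r s
  exact this.continuous

theorem traj_traj (hg : IsCtrl M g) (t x s r : ℝ) : traj g s (traj g t x s) r = traj g t x r := by
  have := hg.traj_sub_traj t x r s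
  unfold traj at *
  linarith

theorem isAC_traj (hg : IsCtrl M g) (a b t x : ℝ) : IsAC (traj g t x) g a b :=
  ⟨hg.intervalIntegrable _ _, fun s _ => by linarith [hg.traj_sub_traj t x a s]⟩

end IsCtrl

theorem traj_self (g : ℝ → ℝ) (t x : ℝ) : traj g t x t = x := by simp [traj]

theorem traj_add (g : ℝ → ℝ) (t x y s : ℝ) : traj g t (x + y) s = traj g t x s + y := by
  unfold traj; ring

theorem traj_congr {g g' : ℝ → ℝ} {r t : ℝ} (h : ∀ σ ∈ Ioo r t, g σ = g' σ) (x : ℝ) {s : ℝ}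
    (hs : s ∈ Icc r t) : traj g t x s = traj g' t x s := by
  unfold traj
  congr 1
  refine intervalIntegral.integral_congr_ae ?_
  filter_upwards [compl_mem_ae_iff.2 (measure_singleton t)] with σ hσt hσ
  rw [uIoc_of_le hs.2] at hσ
  exact h σ ⟨hs.1.trans_lt hσ.1, lt_of_le_of_ne hσ.2 hσt⟩

namespace BurgersHyp

variable {H : ℝ → ℝ → ℝ → ℝ} {c : ℝ} {w : ℝ → ℝ} {M : ℝ}

theorem measurable_action (hH : BurgersHyp H) {ξ g : ℝ → ℝ} (hξ : Measurable ξ) (hg : Measurable g) :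
    Measurable fun s => Lag H s (ξ s) (g s) - c * g s :=
  (hH.continuous_Lag.measurable.comp (measurable_id.prodMk (hξ.prodMk hg))).sub (hg.const_mul c)

theorem exists_action_bound (hH : BurgersHyp H) (c a b M : ℝ) :
    ∃ C, 0 < C ∧ ∀ t ∈ Icc a b, ∀ x v, |v| ≤ M → |Lag H t x v - c * v| ≤ C := by
  obtain ⟨C, hC0, hC⟩ := exists_bound_of_periodic hH.continuous_Lag hH.Lag_periodic a b M
  refine ⟨C + |c| * |M|, by positivity, fun t ht x v hv => ?_⟩
  refine (abs_sub _ _).trans (add_le_add (hC t ht x v hv) ?_)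
  rw [abs_mul]
  exact mul_le_mul_of_nonneg_left (hv.trans (le_abs_self M)) (abs_nonneg c)

theorem action_intervalIntegrable (hH : BurgersHyp H) {g : ℝ → ℝ} (hg : IsCtrl M g) (t x a b : ℝ) :
    IntervalIntegrable (fun s => Lag H s (traj g t x s) (g s) - c * g s) volume a b := by
  obtain ⟨C, -, hC⟩ := hH.exists_action_bound c (min a b) (max a b) M
  exact (hH.measurable_action (hg.continuous_traj t x).measurable hg.measurable).intervalIntegrable_of_abs_le
    fun s hs => hC s (Ioc_subset_Icc_self hs) _ _ (hg.bound s)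

theorem ctrlAction_mem_hloSet (hH : BurgersHyp H) {g : ℝ → ℝ} (hg : IsCtrl M g) (a t x : ℝ) :
    ctrlAction H c w a t x g ∈ hloSet H c a t w x :=
  ⟨traj g t x, g, hg.isAC_traj _ _ _ _, traj_self _ _ _, hH.action_intervalIntegrable hg _ _ _ _, rfl⟩

theorem ctrlAction_congr {g g' : ℝ → ℝ} {a t : ℝ} (hat : a ≤ t) (h : ∀ s ∈ Ioo a t, g s = g' s)
    (x : ℝ) : ctrlAction H c w a t x g = ctrlAction H c w a t x g' := by
  unfold ctrlAction
  rw [traj_congr h x ⟨le_rfl, hat⟩]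
  congr 1
  refine intervalIntegral.integral_congr_ae ?_
  filter_upwards [compl_mem_ae_iff.2 (measure_singleton t)] with s hst hs
  rw [uIoc_of_le hat] at hs
  rw [traj_congr h x (Ioc_subset_Icc_self hs), h s ⟨hs.1, lt_of_le_of_ne hs.2 hst⟩]

theorem ctrlAction_split (hH : BurgersHyp H) {g : ℝ → ℝ} (hg : IsCtrl M g) (a s t x : ℝ) :
    ctrlAction H c w a t x g = ctrlAction H c w a s (traj g t x s) g +
      ∫ σ in s..t, (Lag H σ (traj g t x σ) (g σ) - c * g σ) := by
  unfold ctrlAction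
  simp only [hg.traj_traj]
  rw [add_assoc, intervalIntegral.integral_add_adjacent_intervals
    (hH.action_intervalIntegrable hg _ _ _ _) (hH.action_intervalIntegrable hg _ _ _ _)]

theorem ctrlAction_periodic (hH : BurgersHyp H) (hw : ∀ x, w (x + 1) = w x) (a t x : ℝ) (g : ℝ → ℝ) :
    ctrlAction H c w a t (x + 1) g = ctrlAction H c w a t x g := by
  unfold ctrlAction
  simp only [traj_add, hw, hH.Lag_periodic]

theorem exists_ctrlAction_bound (hH : BurgersHyp H) {B : ℝ} (hw : ∀ x, |w x| ≤ B) (c a b M : ℝ) :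
    ∃ C, ∀ t ∈ Icc a b, ∀ x g, IsCtrl M g → |ctrlAction H c w a t x g| ≤ C := by
  obtain ⟨C, hC0, hC⟩ := hH.exists_action_bound c a b M
  refine ⟨B + C * (b - a), fun t ht x g hg => (abs_add_le _ _).trans (add_le_add (hw _) ?_)⟩
  have := intervalIntegral.norm_integral_le_of_norm_le_const (a := a) (b := t) (C := C)
    (f := fun s => Lag H s (traj g t x s) (g s) - c * g s) fun s hs => by
      rw [uIoc_of_le ht.1] at hs
      exact hC s ⟨hs.1.le, hs.2.trans ht.2⟩ _ _ (hg.bound s)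
  rw [Real.norm_eq_abs, abs_of_nonneg (sub_nonneg.2 ht.1)] at this
  exact this.trans (mul_le_mul_of_nonneg_left (by linarith [ht.2]) hC0.le)

theorem bddBelow_ctrl (hH : BurgersHyp H) {B : ℝ} (hw : ∀ x, |w x| ≤ B) {a t : ℝ} (hat : a ≤ t)
    (c M x : ℝ) : BddBelow {r | ∃ g, IsCtrl M g ∧ r = ctrlAction H c w a t x g} := by
  obtain ⟨C, hC⟩ := hH.exists_ctrlAction_bound hw c a t M
  refine ⟨-C, ?_⟩
  rintro _ ⟨g, hg, rfl⟩
  exact (abs_le.1 (hC t ⟨hat, le_rfl⟩ x g hg)).1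

theorem ctrlValue_le (hH : BurgersHyp H) {B : ℝ} (hw : ∀ x, |w x| ≤ B) {a t : ℝ} (hat : a ≤ t)
    (x : ℝ) {g : ℝ → ℝ} (hg : IsCtrl M g) : ctrlValue H c w a M t x ≤ ctrlAction H c w a t x g :=
  csInf_le (hH.bddBelow_ctrl hw hat c M x) ⟨g, hg, rfl⟩

theorem exists_ctrlAction_lt (hM : 0 ≤ M) (a t x : ℝ) {r : ℝ} (hr : ctrlValue H c w a M t x < r) :
    ∃ g, IsCtrl M g ∧ ctrlAction H c w a t x g < r := by
  unfold ctrlValue at hr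
  obtain ⟨_, ⟨g, hg, rfl⟩, h⟩ := exists_lt_of_csInf_lt (by exact ⟨_, _, IsCtrl.zero hM, rfl⟩) hr
  exact ⟨g, hg, h⟩

theorem ctrlValue_periodic (hH : BurgersHyp H) (hw : ∀ x, w (x + 1) = w x) (a t x : ℝ) :
    ctrlValue H c w a M t (x + 1) = ctrlValue H c w a M t x := by
  unfold ctrlValue
  simp only [hH.ctrlAction_periodic hw]

theorem ctrlValue_initial (hM : 0 ≤ M) (a x : ℝ) : ctrlValue H c w a M a x = w x := by
  have : {r | ∃ g, IsCtrl M g ∧ r = ctrlAction H c w a a x g} = {w x} := by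
    ext r
    simp only [ctrlAction, traj_self, intervalIntegral.integral_same, add_zero, mem_ofPred_eq,
      mem_singleton_iff]
    exact ⟨fun ⟨g, _, h⟩ => h, fun h => ⟨_, IsCtrl.zero hM, h⟩⟩
  rw [ctrlValue, this, csInf_singleton]

theorem ctrlValue_le_of_ctrl (hH : BurgersHyp H) {B : ℝ} (hw : ∀ x, |w x| ≤ B) {a s t : ℝ}
    (has : a ≤ s) (hst : s ≤ t) (x : ℝ) {g : ℝ → ℝ} (hg : IsCtrl M g) :
    ctrlValue H c w a M t x ≤ ctrlValue H c w a M s (traj g t x s) +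
      ∫ σ in s..t, (Lag H σ (traj g t x σ) (g σ) - c * g σ) := by
  refine le_of_forall_pos_le_add fun ε hε => ?_
  obtain ⟨g', hg', hlt⟩ := exists_ctrlAction_lt (H := H) (c := c) (w := w) hg.nonneg a s (traj g t x s)
    (lt_add_of_pos_right _ hε)
  classical
  have hk := hg'.ite hg (measurableSet_Iic (a := s))
  have h1 := hH.ctrlValue_le (c := c) hw (has.trans hst) x hk
  rw [hH.ctrlAction_split hk a s t x] at h1
  have e1 : ∀ σ ∈ Icc s t, traj (fun t => if t ∈ Iic s then g' t else g t) t x σ = traj g t x σ :=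
    fun σ hσ => traj_congr (r := s) (fun τ hτ => if_neg (not_le.2 hτ.1)) x hσ
  have e2 : ∀ y, ctrlAction H c w a s y (fun t => if t ∈ Iic s then g' t else g t) =
      ctrlAction H c w a s y g' := fun y => ctrlAction_congr has (fun τ hτ => if_pos hτ.2.le) y
  have e3 : ∫ σ in s..t, (Lag H σ (traj (fun t => if t ∈ Iic s then g' t else g t) t x σ)
      (if σ ∈ Iic s then g' σ else g σ) - c * (if σ ∈ Iic s then g' σ else g σ)) =
      ∫ σ in s..t, (Lag H σ (traj g t x σ) (g σ) - c * g σ) := by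
    refine intervalIntegral.integral_congr_ae (ae_of_all _ fun σ hσ => ?_)
    rw [uIoc_of_le hst] at hσ
    have hn : σ ∉ Iic s := not_le.2 hσ.1
    rw [e1 σ (Ioc_subset_Icc_self hσ), if_neg hn]
  rw [e1 s ⟨le_rfl, hst⟩, e2, e3] at h1
  linarith

theorem exists_ctrl_le_ctrlValue (hH : BurgersHyp H) {B : ℝ} (hw : ∀ x, |w x| ≤ B) (hM : 0 ≤ M)
    {a s t : ℝ} (has : a ≤ s) (x : ℝ) {ε : ℝ} (hε : 0 < ε) : ∃ g, IsCtrl M g ∧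
    ctrlValue H c w a M s (traj g t x s) +
      ∫ σ in s..t, (Lag H σ (traj g t x σ) (g σ) - c * g σ) ≤ ctrlValue H c w a M t x + ε := by
  obtain ⟨g, hg, hlt⟩ := exists_ctrlAction_lt (H := H) (c := c) (w := w) hM a t x
    (lt_add_of_pos_right _ hε)
  refine ⟨g, hg, ?_⟩
  rw [hH.ctrlAction_split hg a s t x] at hlt
  linarith [hH.ctrlValue_le (c := c) hw has (traj g t x s) hg]

/-- Lipschitz dependence of the action on the velocity and the end point. -/
theorem exists_ctrlAction_lipschitz (hH : BurgersHyp H) {K : ℝ} (hK : ∀ x y, |w x - w y| ≤ K * |x - y|)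
    (c a b M : ℝ) : ∃ C, 0 < C ∧ ∀ t ∈ Icc a b, ∀ x y g g', IsCtrl M g → IsCtrl M g' →
      |ctrlAction H c w a t x g - ctrlAction H c w a t y g'| ≤
        C * (|x - y| + ∫ s in a..t, |g s - g' s|) := by
  have hK0 : 0 ≤ K := by
    have := (abs_nonneg _).trans (hK 1 0)
    simpa using this
  obtain ⟨C, hC0, hC⟩ := hH.exists_Lag_lipschitz a b M
  refine ⟨K + C * |b - a| + C + |c|, by positivity, fun t ht x y g g' hg hg' => ?_⟩
  have hi : ∀ s r, IntervalIntegrable (fun σ => |g σ - g' σ|) volume s r := fun s r =>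
    ((hg.intervalIntegrable s r).sub (hg'.intervalIntegrable s r)).abs
  set I := ∫ s in a..t, |g s - g' s| with hI
  have hI0 : 0 ≤ I := intervalIntegral.integral_nonneg ht.1 fun s _ => abs_nonneg _
  have htr : ∀ s ∈ Icc a t, |traj g t x s - traj g' t y s| ≤ |x - y| + I := by
    intro s hs
    have e : traj g t x s - traj g' t y s = (x - y) - ∫ σ in s..t, (g σ - g' σ) := by
      rw [intervalIntegral.integral_sub (hg.intervalIntegrable s t) (hg'.intervalIntegrable s t)]
      unfold traj; ring
    rw [e]
    refine (abs_sub _ _).trans (add_le_add le_rfl ?_)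
    refine (intervalIntegral.abs_integral_le_integral_abs hs.2).trans ?_
    exact intervalIntegral.integral_mono_interval hs.1 hs.2 le_rfl (ae_of_all _ fun σ => abs_nonneg _)
      (hi a t)
  have h1 : |w (traj g t x a) - w (traj g' t y a)| ≤ K * (|x - y| + I) :=
    (hK _ _).trans (mul_le_mul_of_nonneg_left (htr a ⟨le_rfl, ht.1⟩) hK0)
  have h2 : |(∫ s in a..t, (Lag H s (traj g t x s) (g s) - c * g s)) -
      ∫ s in a..t, (Lag H s (traj g' t y s) (g' s) - c * g' s)| ≤
      ∫ s in a..t, (C * (|x - y| + I) + (C + |c|) * |g s - g' s|) := by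
    rw [← intervalIntegral.integral_sub (hH.action_intervalIntegrable hg _ _ _ _)
      (hH.action_intervalIntegrable hg' _ _ _ _)]
    refine (intervalIntegral.abs_integral_le_integral_abs ht.1).trans ?_
    refine intervalIntegral.integral_mono_on ht.1 ?_ ?_ fun s hs => ?_
    · exact ((hH.action_intervalIntegrable hg _ _ _ _).sub
        (hH.action_intervalIntegrable hg' _ _ _ _)).abs
    · exact (intervalIntegrable_const).add ((hi a t).const_mul _)
    · have e1 := hC s ⟨hs.1, hs.2.trans ht.2⟩ (traj g t x s) (traj g' t y s) (g s) (g' s)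
        (hg.bound s) (hg'.bound s)
      have e2 := htr s hs
      have e3 : |c * (g s - g' s)| = |c| * |g s - g' s| := abs_mul _ _
      have e4 : Lag H s (traj g t x s) (g s) - c * g s - (Lag H s (traj g' t y s) (g' s) - c * g' s) =
        (Lag H s (traj g t x s) (g s) - Lag H s (traj g' t y s) (g' s)) - c * (g s - g' s) := by ring
      rw [e4]
      refine (abs_sub _ _).trans ?_
      rw [e3]
      have := mul_le_mul_of_nonneg_left e2 hC0.le
      nlinarith
  rw [intervalIntegral.integral_add intervalIntegrable_const ((hi a t).const_mul _),
    intervalIntegral.integral_const, intervalIntegral.integral_const_mul, smul_eq_mul, ← hI] at h2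
  have h3 : (t - a) * (C * (|x - y| + I)) ≤ C * |b - a| * (|x - y| + I) := by
    have : t - a ≤ |b - a| := (by linarith [ht.2] : t - a ≤ b - a).trans (le_abs_self _)
    have h0 : 0 ≤ C * (|x - y| + I) := by positivity
    nlinarith
  have e : ctrlAction H c w a t x g - ctrlAction H c w a t y g' =
    (w (traj g t x a) - w (traj g' t y a)) +
    ((∫ s in a..t, (Lag H s (traj g t x s) (g s) - c * g s)) -
      ∫ s in a..t, (Lag H s (traj g' t y s) (g' s) - c * g' s)) := by unfold ctrlAction; ring
  rw [e]
  refine (abs_add_le _ _).trans ((add_le_add h1 h2).trans ?_)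
  have h4 : 0 ≤ (C + |c|) * |x - y| := by positivity
  nlinarith

end BurgersHyp

/-- The velocity which is constant equal to `v i` on `[a + i h, a + (i + 1) h)`. -/
noncomputable def stepCtrl (a h : ℝ) (v : ℕ → ℝ) (s : ℝ) : ℝ := v ⌊(s - a) / h⌋₊

/-- The step velocity associated to `v` minimizes the action among step velocities. -/
structure IsStepMin (H : ℝ → ℝ → ℝ → ℝ) (c : ℝ) (w : ℝ → ℝ) (a M h t x : ℝ) (v : ℕ → ℝ) : Prop where
  bound : ∀ i, |v i| ≤ M
  le : ∀ v' : ℕ → ℝ, (∀ i, |v' i| ≤ M) →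
    ctrlAction H c w a t x (stepCtrl a h v) ≤ ctrlAction H c w a t x (stepCtrl a h v')

theorem measurable_stepCtrl (a h : ℝ) (v : ℕ → ℝ) : Measurable (stepCtrl a h v) :=
  (measurable_from_nat (f := v)).comp
    (Nat.measurable_floor.comp ((measurable_id.sub_const a).div_const h))

theorem isCtrl_stepCtrl {M : ℝ} (a h : ℝ) {v : ℕ → ℝ} (hv : ∀ i, |v i| ≤ M) :
    IsCtrl M (stepCtrl a h v) := ⟨measurable_stepCtrl a h v, fun _ => hv _⟩

theorem abs_sub_floor_le {a h s : ℝ} (hh : 0 < h) (hs : a ≤ s) :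
    a + ⌊(s - a) / h⌋₊ * h ≤ s ∧ s < a + (⌊(s - a) / h⌋₊ + 1) * h := by
  have h0 : 0 ≤ (s - a) / h := div_nonneg (by linarith) hh.le
  have h1 := (le_div_iff₀ hh).1 (Nat.floor_le h0)
  have h2 := (div_lt_iff₀ hh).1 (Nat.lt_floor_add_one ((s - a) / h))
  constructor <;> linarith

/-- Density of step velocities. -/
theorem IsCtrl.exists_stepCtrl_near {M : ℝ} {g : ℝ → ℝ} (hg : IsCtrl M g) {a t : ℝ} (hat : a ≤ t)
    {ε : ℝ} (hε : 0 < ε) : ∃ h₀, 0 < h₀ ∧ ∀ h, 0 < h → h < h₀ → ∃ v : ℕ → ℝ, (∀ i, |v i| ≤ M) ∧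
      ∫ s in a..t, |stepCtrl a h v s - g s| ≤ ε := by
  have hM := hg.nonneg
  have hgi : Integrable (indicator (Ioc a t) g) := by
    rw [integrable_indicator_iff measurableSet_Ioc]
    exact (intervalIntegrable_iff_integrableOn_Ioc_of_le hat).1 (hg.intervalIntegrable a t)
  obtain ⟨f, hfc, hf1, hfcont, hfi⟩ := hgi.exists_hasCompactSupport_integral_sub_le (half_pos hε)
  have hfu := Metric.uniformContinuous_iff.1 (hfc.uniformContinuous_of_continuous hfcont)
  obtain ⟨h₀, hh₀, hfu⟩ := hfu (ε / (2 * (t - a + 1))) (div_pos hε (by linarith))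
  set F : ℝ → ℝ := fun s => max (-M) (min M (f s)) with hF
  have hclamp : ∀ p q : ℝ, |max (-M) (min M p) - max (-M) (min M q)| ≤ |p - q| := by
    intro p q
    refine (abs_max_sub_max_le_max _ _ _ _).trans ?_
    rw [sub_self, abs_zero]
    refine max_le (abs_nonneg _) ((abs_min_sub_min_le_max _ _ _ _).trans ?_)
    rw [sub_self, abs_zero]
    exact max_le (abs_nonneg _) le_rfl
  have hFg : ∀ s ∈ Ioc a t, |F s - g s| ≤ ‖indicator (Ioc a t) g s - f s‖ := by
    intro s hs
    rw [indicator_of_mem hs, Real.norm_eq_abs, abs_sub_comm (g s)]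
    have e : max (-M) (min M (g s)) = g s := by
      obtain ⟨h1, h2⟩ := abs_le.1 (hg.bound s)
      rw [min_eq_right h2, max_eq_right h1]
    have := hclamp (f s) (g s)
    rwa [e] at this
  refine ⟨h₀, hh₀, fun h hh hhh => ⟨fun i => F (a + i * h), fun i => abs_le.2 ⟨le_max_left _ _,
    max_le (by linarith) (min_le_left _ _)⟩, ?_⟩⟩
  have hpt : ∀ s ∈ Icc a t, |stepCtrl a h (fun i => F (a + i * h)) s - g s| ≤
      ε / (2 * (t - a + 1)) + |F s - g s| := by
    intro s hs
    obtain ⟨h1, h2⟩ := abs_sub_floor_le hh hs.1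
    refine (abs_sub_le _ (F s) _).trans (add_le_add ?_ le_rfl)
    refine (hclamp _ _).trans ?_
    rw [← Real.dist_eq]
    refine (hfu ?_).le
    rw [Real.dist_eq, abs_lt]
    constructor <;> linarith
  have hFc : Continuous F := by fun_prop
  have hFi : IntervalIntegrable (fun s => |F s - g s|) volume a t :=
    ((hFc.intervalIntegrable a t).sub (hg.intervalIntegrable a t)).abs
  have hnn : IntegrableOn (fun s => ‖indicator (Ioc a t) g s - f s‖) (Ioc a t) :=
    (hgi.sub hfi).norm.integrableOn
  have hI : ∫ s in a..t, |F s - g s| ≤ ε / 2 := by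
    rw [intervalIntegral.integral_of_le hat]
    refine le_trans (setIntegral_mono_on ?_ hnn measurableSet_Ioc hFg) ?_
    · exact (intervalIntegrable_iff_integrableOn_Ioc_of_le hat).1 hFi
    · exact (setIntegral_le_integral (hgi.sub hfi).norm (ae_of_all _ fun s => norm_nonneg _)).trans hf1
  calc ∫ s in a..t, |stepCtrl a h (fun i => F (a + i * h)) s - g s|
      ≤ ∫ s in a..t, (ε / (2 * (t - a + 1)) + |F s - g s|) := by
        refine intervalIntegral.integral_mono_on hat ?_ (intervalIntegrable_const.add hFi) hpt
        have hst : IsCtrl M (stepCtrl a h fun i => F (a + i * h)) := isCtrl_stepCtrl a h fun i =>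
          abs_le.2 ⟨le_max_left _ _, max_le (by linarith) (min_le_left _ _)⟩
        exact ((hst.intervalIntegrable a t).sub (hg.intervalIntegrable a t)).abs
    _ = (t - a) * (ε / (2 * (t - a + 1))) + ∫ s in a..t, |F s - g s| := by
        rw [intervalIntegral.integral_add intervalIntegrable_const hFi,
          intervalIntegral.integral_const, smul_eq_mul]
    _ ≤ ε / 2 + ε / 2 := by
        refine add_le_add ?_ hI
        rw [mul_div_assoc', div_le_div_iff₀ (by linarith) two_pos]
        nlinarith
    _ = ε := by ring

namespace BurgersHyp

variable {H : ℝ → ℝ → ℝ → ℝ} {c : ℝ} {w : ℝ → ℝ} {M : ℝ}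

theorem exists_isStepMin (hH : BurgersHyp H) {K : ℝ} (hK : ∀ x y, |w x - w y| ≤ K * |x - y|)
    (hM : 0 ≤ M) {a t : ℝ} (hat : a ≤ t) (h x : ℝ) : ∃ v, IsStepMin H c w a M h t x v := by
  obtain ⟨C, hC0, hC⟩ := hH.exists_ctrlAction_lipschitz hK c a t M
  have hcomp : IsCompact (univ.pi fun _ : ℕ => Icc (-M) M) := isCompact_univ_pi fun _ => isCompact_Icc
  have hmem : ∀ v : ℕ → ℝ, v ∈ (univ.pi fun _ : ℕ => Icc (-M) M) ↔ ∀ i, |v i| ≤ M := fun v => by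
    simp only [Set.mem_pi, mem_univ, true_implies, mem_Icc, abs_le]
  have hcont : ContinuousOn (fun v => ctrlAction H c w a t x (stepCtrl a h v))
      (univ.pi fun _ : ℕ => Icc (-M) M) := by
    intro v hv
    rw [ContinuousWithinAt, tendsto_iff_dist_tendsto_zero]
    have hlim : Tendsto (fun v' : ℕ → ℝ => ∫ s in a..t, |stepCtrl a h v' s - stepCtrl a h v s|)
        (𝓝[univ.pi fun _ : ℕ => Icc (-M) M] v) (𝓝 (∫ s in a..t, (0:ℝ))) := by
      refine intervalIntegral.tendsto_integral_filter_of_dominated_convergence (fun _ => 2 * M) ?_ ?_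
        intervalIntegrable_const ?_
      · exact Eventually.of_forall fun v' =>
          ((measurable_stepCtrl a h v').sub (measurable_stepCtrl a h v)).abs.aestronglyMeasurable
      · filter_upwards [self_mem_nhdsWithin] with v' hv'
        refine ae_of_all _ fun s _ => ?_
        rw [Real.norm_eq_abs, abs_abs, two_mul]
        exact (abs_sub _ _).trans (add_le_add ((hmem v').1 hv' _) ((hmem v).1 hv _))
      · refine ae_of_all _ fun s _ => ?_
        have : Tendsto (fun v' : ℕ → ℝ => v' ⌊(s - a) / h⌋₊)
            (𝓝[univ.pi fun _ : ℕ => Icc (-M) M] v) (𝓝 (v ⌊(s - a) / h⌋₊)) :=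
          ((continuous_apply _).tendsto v).mono_left nhdsWithin_le_nhds
        have h2 := (this.sub_const (v ⌊(s - a) / h⌋₊)).abs
        rw [sub_self, abs_zero] at h2
        exact h2
    rw [intervalIntegral.integral_zero] at hlim
    have hlim' := hlim.const_mul C
    rw [mul_zero] at hlim'
    refine squeeze_zero' (Eventually.of_forall fun _ => dist_nonneg) ?_ hlim'
    filter_upwards [self_mem_nhdsWithin] with v' hv'
    have := hC t ⟨hat, le_rfl⟩ x x _ _ (isCtrl_stepCtrl a h ((hmem v').1 hv'))
      (isCtrl_stepCtrl a h ((hmem v).1 hv))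
    rwa [sub_self, abs_zero, zero_add, ← Real.dist_eq] at this
  obtain ⟨v, hv, hmin⟩ := hcomp.exists_isMinOn
    ⟨fun _ => 0, (hmem _).2 fun _ => by simpa using hM⟩ hcont
  exact ⟨v, (hmem v).1 hv, fun k hk => hmin ((hmem k).2 hk)⟩

/-- Step minimizers are asymptotically optimal. -/
theorem exists_isStepMin_le (hH : BurgersHyp H) {K : ℝ} (hK : ∀ x y, |w x - w y| ≤ K * |x - y|)
    (hM : 0 ≤ M) {a t : ℝ} (hat : a ≤ t) (x : ℝ) {ε : ℝ} (hε : 0 < ε) : ∃ h₀, 0 < h₀ ∧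
      ∀ h, 0 < h → h < h₀ → ∀ v, IsStepMin H c w a M h t x v →
        ctrlAction H c w a t x (stepCtrl a h v) ≤ ctrlValue H c w a M t x + ε := by
  obtain ⟨C, hC0, hC⟩ := hH.exists_ctrlAction_lipschitz hK c a t M
  obtain ⟨g, hg, hlt⟩ := exists_ctrlAction_lt (H := H) (c := c) (w := w) hM a t x
    (lt_add_of_pos_right _ (half_pos hε))
  obtain ⟨h₀, hh₀, hstep⟩ := hg.exists_stepCtrl_near hat (ε := ε / (2 * C)) (by positivity)
  refine ⟨h₀, hh₀, fun h hh hhh v hv => ?_⟩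
  obtain ⟨v', hv', hle⟩ := hstep h hh hhh
  have h1 := hv.le v' hv'
  have h2 := hC t ⟨hat, le_rfl⟩ x x _ _ (isCtrl_stepCtrl a h hv') hg
  rw [sub_self, abs_zero, zero_add] at h2
  have h3 := mul_le_mul_of_nonneg_left hle hC0.le
  have h4 : C * (ε / (2 * C)) = ε / 2 := by field_simp
  have h5 := le_abs_self (ctrlAction H c w a t x (stepCtrl a h v') - ctrlAction H c w a t x g)
  linarith

end BurgersHyp

/-- The momentum along the curve with velocity `g` obtained by integrating the Euler-Lagrange
equation from the transversality condition at the initial time. -/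
noncomputable def costate (H : ℝ → ℝ → ℝ → ℝ) (c : ℝ) (w : ℝ → ℝ) (a t x : ℝ) (g : ℝ → ℝ)
    (s : ℝ) : ℝ :=
  c + deriv w (traj g t x a) -
    ∫ σ in a..s, Hx H σ (traj g t x σ) (momentum H σ (traj g t x σ) (g σ))

theorem integral_mul_primitive_add {f k : ℝ → ℝ} {a t : ℝ} (hf : IntervalIntegrable f volume a t)
    (hk : IntervalIntegrable k volume a t) :
    ∫ s in a..t, (f s * (∫ σ in t..s, k σ) + (∫ σ in a..s, f σ) * k s) = 0 := by
  have h1 := hf.absolutelyContinuousOnInterval_intervalIntegral left_mem_uIcc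
  have h2 := hk.absolutelyContinuousOnInterval_intervalIntegral right_mem_uIcc
  have h3 := h1.integral_deriv_mul_eq_sub h2
  simp only [intervalIntegral.integral_same, mul_zero, zero_mul, sub_zero] at h3
  rw [← h3]
  refine intervalIntegral.integral_congr_ae ?_
  filter_upwards [hf.ae_hasDerivAt_integral, hk.ae_hasDerivAt_integral] with s hs1 hs2 hs
  have hs' := uIoc_subset_uIcc hs
  rw [(hs1 hs' a left_mem_uIcc).deriv, (hs2 hs' t right_mem_uIcc).deriv]

theorem traj_add_smul {M M' : ℝ} {g k : ℝ → ℝ} (hg : IsCtrl M g) (hk : IsCtrl M' k) (ε t x s : ℝ) :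
    traj (fun σ => g σ + ε * k σ) t x s = traj g t x s + ε * traj k t 0 s := by
  unfold traj
  rw [intervalIntegral.integral_add (hg.intervalIntegrable _ _)
    ((hk.intervalIntegrable _ _).const_mul ε), intervalIntegral.integral_const_mul]
  ring

namespace BurgersHyp

variable {H : ℝ → ℝ → ℝ → ℝ} {c : ℝ} {w : ℝ → ℝ} {M : ℝ}

theorem measurable_momentum_traj (hH : BurgersHyp H) {g : ℝ → ℝ} (hg : IsCtrl M g) (t x : ℝ) :
    Measurable fun s => momentum H s (traj g t x s) (g s) :=
  hH.continuous_momentum.measurable.comp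
    (measurable_id.prodMk ((hg.continuous_traj t x).measurable.prodMk hg.measurable))

theorem measurable_Hx_traj (hH : BurgersHyp H) {g : ℝ → ℝ} (hg : IsCtrl M g) (t x : ℝ) :
    Measurable fun s => Hx H s (traj g t x s) (momentum H s (traj g t x s) (g s)) :=
  hH.contDiff_Hx.continuous.measurable.comp
    (measurable_id.prodMk ((hg.continuous_traj t x).measurable.prodMk (hH.measurable_momentum_traj hg t x)))

theorem momentum_intervalIntegrable (hH : BurgersHyp H) {g : ℝ → ℝ} (hg : IsCtrl M g) (t x a b : ℝ) :
    IntervalIntegrable (fun s => momentum H s (traj g t x s) (g s)) volume a b := by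
  obtain ⟨C, -, hC⟩ := hH.exists_momentum_bound (min a b) (max a b) M
  exact (hH.measurable_momentum_traj hg t x).intervalIntegrable_of_abs_le
    fun s hs => hC s (Ioc_subset_Icc_self hs) _ _ (hg.bound s)

/-- Uniform bound for the forces along controlled curves. -/
theorem exists_Hx_traj_bound (hH : BurgersHyp H) (a b M : ℝ) : ∃ C, 0 < C ∧ ∀ s ∈ Icc a b,
    ∀ x v, |v| ≤ M → |Hx H s x (momentum H s x v)| ≤ C := by
  obtain ⟨R, -, hR⟩ := hH.exists_momentum_bound a b M
  obtain ⟨C, hC0, hC⟩ := exists_bound_of_periodic hH.contDiff_Hx.continuous hH.Hx_periodic a b R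
  exact ⟨C, hC0, fun s hs x v hv => hC s hs x _ (hR s hs x v hv)⟩

theorem Hx_intervalIntegrable (hH : BurgersHyp H) {g : ℝ → ℝ} (hg : IsCtrl M g) (t x a b : ℝ) :
    IntervalIntegrable (fun s => Hx H s (traj g t x s) (momentum H s (traj g t x s) (g s)))
      volume a b := by
  obtain ⟨C, -, hC⟩ := hH.exists_Hx_traj_bound (min a b) (max a b) M
  exact (hH.measurable_Hx_traj hg t x).intervalIntegrable_of_abs_le
    fun s hs => hC s (Ioc_subset_Icc_self hs) _ _ (hg.bound s)

theorem costate_sub_costate (hH : BurgersHyp H) {g : ℝ → ℝ} (hg : IsCtrl M g) (a t x s r : ℝ) :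
    costate H c w a t x g r - costate H c w a t x g s =
      -∫ σ in s..r, Hx H σ (traj g t x σ) (momentum H σ (traj g t x σ) (g σ)) := by
  have := intervalIntegral.integral_add_adjacent_intervals (hH.Hx_intervalIntegrable hg t x a s)
    (hH.Hx_intervalIntegrable hg t x s r)
  unfold costate
  linarith

/-- The first order optimality condition in a direction `k`. -/
theorem first_variation (hH : BurgersHyp H) (hw : Differentiable ℝ w) {a t x : ℝ} (hat : a ≤ t)
    {g k : ℝ → ℝ} {M' : ℝ} (hg : IsCtrl M g) (hk : IsCtrl M' k)
    (hadm : ∀ ε, 0 < ε → ε ≤ 1 → (∀ s, |g s + ε * k s| ≤ M) ∧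
      ctrlAction H c w a t x g ≤ ctrlAction H c w a t x fun s => g s + ε * k s) :
    0 ≤ ∫ s in a..t, (momentum H s (traj g t x s) (g s) - costate H c w a t x g s) * k s := by
  obtain ⟨C, hC0, hC⟩ := hH.exists_Lag_semiconcave a t M
  set ξ := traj g t x with hξ
  set y := traj k t 0 with hy
  set P := fun s => momentum H s (ξ s) (g s) with hP
  set F := fun s => Hx H s (ξ s) (P s) with hF
  have hPi : IntervalIntegrable P volume a t := hH.momentum_intervalIntegrable hg t x a t
  have hFi : IntervalIntegrable F volume a t := hH.Hx_intervalIntegrable hg t x a t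
  have hyc : Continuous y := hk.continuous_traj t 0
  have hki : IntervalIntegrable k volume a t := hk.intervalIntegrable a t
  have hPk : IntervalIntegrable (fun s => P s * k s) volume a t := by
    obtain ⟨R, -, hR⟩ := hH.exists_momentum_bound a t M
    refine ((hH.measurable_momentum_traj hg t x).mul hk.measurable).intervalIntegrable_of_abs_le
      (C := R * M') fun s hs => ?_
    rw [uIoc_of_le hat] at hs
    rw [Pi.mul_apply, abs_mul]
    have := hR s (Ioc_subset_Icc_self hs) (ξ s) (g s) (hg.bound s)
    exact mul_le_mul this (hk.bound s) (abs_nonneg _) ((abs_nonneg _).trans this)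
  have hFy : IntervalIntegrable (fun s => F s * y s) volume a t := hFi.mul_continuousOn hyc.continuousOn
  have hk2 : IntervalIntegrable (fun s => k s ^ 2) volume a t :=
    (hk.measurable.pow_const 2).intervalIntegrable_of_abs_le (C := M' ^ 2) fun s _ => by
      rw [abs_pow]; exact pow_le_pow_left₀ (abs_nonneg _) (hk.bound s) 2
  have hy2 : IntervalIntegrable (fun s => y s ^ 2) volume a t := (hyc.pow 2).intervalIntegrable _ _
  set I₁ := ∫ s in a..t, (P s * k s - F s * y s - c * k s) with hI₁
  set I₂ := ∫ s in a..t, C * (y s ^ 2 + k s ^ 2) with hI₂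
  have hi1 : IntervalIntegrable (fun s => P s * k s - F s * y s - c * k s) volume a t :=
    (hPk.sub hFy).sub (hki.const_mul c)
  have hi2 : IntervalIntegrable (fun s => C * (y s ^ 2 + k s ^ 2)) volume a t :=
    (hy2.add hk2).const_mul C
  have hmain : ∀ ε, 0 < ε → ε ≤ 1 → 0 ≤ (w (ξ a + ε * y a) - w (ξ a)) + ε * I₁ + ε ^ 2 * I₂ := by
    intro ε hε0 hε1
    obtain ⟨hb, hle⟩ := hadm ε hε0 hε1
    have hge : IsCtrl M fun s => g s + ε * k s := ⟨hg.measurable.add (hk.measurable.const_mul ε), hb⟩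
    have hle' := hle
    unfold ctrlAction at hle'
    simp only [traj_add_smul hg hk, ← hξ, ← hy] at hle'
    have hact : IntervalIntegrable (fun s => Lag H s (ξ s + ε * y s) (g s + ε * k s) -
        c * (g s + ε * k s)) volume a t := by
      have := hH.action_intervalIntegrable (c := c) hge t x a t
      simpa only [traj_add_smul hg hk, ← hξ, ← hy] using this
    have hint : ∫ s in a..t, (Lag H s (ξ s + ε * y s) (g s + ε * k s) - c * (g s + ε * k s)) ≤
        ∫ s in a..t, ((Lag H s (ξ s) (g s) - c * g s) +
          (ε * (P s * k s - F s * y s - c * k s) + ε ^ 2 * (C * (y s ^ 2 + k s ^ 2)))) := by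
      refine intervalIntegral.integral_mono_on hat hact ?_ fun s hs => ?_
      · exact (hH.action_intervalIntegrable hg t x a t).add ((hi1.const_mul ε).add (hi2.const_mul _))
      · have := hC s hs (ξ s) (g s) (ε * y s) (ε * k s) (hg.bound s) (hb s)
        simp only [hF, hP]
        linarith
    rw [intervalIntegral.integral_add (hH.action_intervalIntegrable hg t x a t)
      ((hi1.const_mul ε).add (hi2.const_mul _)), intervalIntegral.integral_add (hi1.const_mul ε)
      (hi2.const_mul _), intervalIntegral.integral_const_mul, intervalIntegral.integral_const_mul,
      ← hI₁, ← hI₂] at hint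
    linarith
  have hlim : 0 ≤ deriv w (ξ a) * y a + I₁ := by
    have hd : HasDerivAt (fun ε => (w (ξ a + ε * y a) - w (ξ a)) + ε * I₁ + ε ^ 2 * I₂)
        (deriv w (ξ a) * y a + I₁) 0 := by
      have h1 : HasDerivAt (fun ε : ℝ => ξ a + ε * y a) (y a) 0 := by
        simpa using ((hasDerivAt_id (0:ℝ)).mul_const (y a)).const_add (ξ a)
      have h2 : HasDerivAt (fun ε => w (ξ a + ε * y a)) (deriv w (ξ a) * y a) 0 := by
        have := (hw (ξ a + 0 * y a)).hasDerivAt.comp (0:ℝ) h1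
        simpa using! this
      have h3 : HasDerivAt (fun ε : ℝ => ε * I₁) I₁ 0 := by
        simpa using (hasDerivAt_id (0:ℝ)).mul_const I₁
      have h4 : HasDerivAt (fun ε : ℝ => ε ^ 2 * I₂) 0 0 := by
        simpa using ((hasDerivAt_pow 2 (0:ℝ)).mul_const I₂)
      simpa using! ((h2.sub_const (w (ξ a))).add h3).add h4
    have htend := (hasDerivAt_iff_tendsto_slope.1 hd).mono_left
      (nhdsWithin_mono 0 (fun s (hs : 0 < s) => hs.ne') : 𝓝[>] (0:ℝ) ≤ 𝓝[≠] 0)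
    refine ge_of_tendsto htend ?_
    filter_upwards [self_mem_nhdsWithin, Ioc_mem_nhdsGT (zero_lt_one (α := ℝ))] with ε hε hε'
    rw [slope_def_field]
    have := hmain ε hε'.1 hε'.2
    refine div_nonneg ?_ (by linarith [hε'.1])
    simp only [zero_mul, add_zero, sub_self, ne_eq, OfNat.ofNat_ne_zero, not_false_eq_true, zero_pow]
    linarith
  have hIBP := integral_mul_primitive_add hFi hki
  have hyeq : ∀ s, y s = ∫ σ in t..s, k σ := fun s => by
    rw [hy, intervalIntegral.integral_symm]; simp [traj]
  simp only [← hyeq] at hIBP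
  have hPc : Continuous fun s => ∫ σ in a..s, F σ :=
    intervalIntegral.continuous_primitive (fun _ _ => hH.Hx_intervalIntegrable hg t x _ _) a
  have hFk : IntervalIntegrable (fun s => (∫ σ in a..s, F σ) * k s) volume a t :=
    hki.continuousOn_mul hPc.continuousOn
  rw [intervalIntegral.integral_add hFy hFk] at hIBP
  have hya : y a = -∫ s in a..t, k s := by rw [hyeq, intervalIntegral.integral_symm]
  have e : ∫ s in a..t, (P s - costate H c w a t x g s) * k s =
      ∫ s in a..t, ((P s * k s - F s * y s - c * k s) + (F s * y s + (∫ σ in a..s, F σ) * k s) -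
        deriv w (ξ a) * k s) := by
    refine intervalIntegral.integral_congr fun s _ => ?_
    simp only [costate]
    ring
  have e2 : ∫ s in a..t, ((P s * k s - F s * y s - c * k s) +
      (F s * y s + (∫ σ in a..s, F σ) * k s) - deriv w (ξ a) * k s) =
      I₁ + 0 - deriv w (ξ a) * ∫ s in a..t, k s := by
    rw [intervalIntegral.integral_sub (hi1.add (hFy.add hFk)) (hki.const_mul _),
      intervalIntegral.integral_add hi1 (hFy.add hFk), intervalIntegral.integral_const_mul,
      intervalIntegral.integral_add hFy hFk, hIBP]
  rw [e, e2]
  rw [hya] at hlim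
  linarith

end BurgersHyp

theorem stepCtrl_eq {a h : ℝ} (hh : 0 < h) {s σ : ℝ} (hs : a ≤ s) (hsσ : s ≤ σ)
    (hσ : σ < a + (⌊(s - a) / h⌋₊ + 1) * h) (v : ℕ → ℝ) : stepCtrl a h v σ = stepCtrl a h v s := by
  have h0 := abs_sub_floor_le hh hs
  unfold stepCtrl
  congr 1
  rw [Nat.floor_eq_iff (div_nonneg (by linarith) hh.le), le_div_iff₀ hh, div_lt_iff₀ hh]
  constructor <;> linarith

theorem stepCtrl_eventually_eq {a h : ℝ} (hh : 0 < h) {s : ℝ} (hs : a ≤ s) (v : ℕ → ℝ) :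
    ∀ᶠ σ in 𝓝[≥] s, stepCtrl a h v σ = stepCtrl a h v s := by
  filter_upwards [Ico_mem_nhdsGE (abs_sub_floor_le hh hs).2] with σ hσ
  exact stepCtrl_eq hh hs hσ.1 hσ.2 v

namespace BurgersHyp

variable {H : ℝ → ℝ → ℝ → ℝ} {c : ℝ} {w : ℝ → ℝ} {M : ℝ}

theorem exists_stepMin_variation (hH : BurgersHyp H) (hw : Differentiable ℝ w) (a b : ℝ) (hM : 0 < M) :
    ∃ C, 0 < C ∧ ∀ h, 0 < h → ∀ t ≤ b, ∀ x v, IsStepMin H c w a M h t x v → ∀ s ∈ Ico a t,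
      (stepCtrl a h v s < M → -(C * h) ≤ momentum H s (traj (stepCtrl a h v) t x s)
        (stepCtrl a h v s) - costate H c w a t x (stepCtrl a h v) s) ∧
      (-M < stepCtrl a h v s → momentum H s (traj (stepCtrl a h v) t x s)
        (stepCtrl a h v s) - costate H c w a t x (stepCtrl a h v) s ≤ C * h) := by
  obtain ⟨C1, hC10, hC1⟩ := hH.exists_momentum_lipschitz a b M
  obtain ⟨C2, hC20, hC2⟩ := hH.exists_Hx_traj_bound a b M
  refine ⟨C1 * (1 + M) + C2, by positivity, fun h hh t htb x v hv s hs => ?_⟩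
  have hg := isCtrl_stepCtrl a h hv.bound
  set g := stepCtrl a h v with hgdef
  set D := fun σ => momentum H σ (traj g t x σ) (g σ) - costate H c w a t x g σ with hD
  set C := C1 * (1 + M) + C2 with hC
  have hCpos : 0 < C := by positivity
  set i := ⌊(s - a) / h⌋₊ with hi
  have hgs : g s = v i := rfl
  have hosc : ∀ σ ∈ Icc a t, ⌊(σ - a) / h⌋₊ = i → |D σ - D s| ≤ C * h := by
    intro σ hσ hσi
    have hgσ : g σ = g s := congrArg v hσi
    have e1 := abs_sub_floor_le hh hσ.1
    have e2 := abs_sub_floor_le hh hs.1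
    rw [hσi] at e1
    have e3 : |σ - s| ≤ h := abs_le.2 ⟨by linarith, by linarith⟩
    have k1 := hC1 σ ⟨hσ.1, hσ.2.trans htb⟩ s ⟨hs.1, hs.2.le.trans htb⟩ (traj g t x σ) (traj g t x s) (g σ) (g s)
      (hg.bound _) (hg.bound _)
    have k2 := hg.abs_traj_sub_le t x s σ
    have k3 := hH.costate_sub_costate (c := c) (w := w) hg a t x s σ
    have k4 : |∫ r in s..σ, Hx H r (traj g t x r) (momentum H r (traj g t x r) (g r))| ≤
        C2 * |σ - s| := by
      rw [← Real.norm_eq_abs]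
      refine intervalIntegral.norm_integral_le_of_norm_le_const fun r hr => ?_
      have : r ∈ uIcc s σ := uIoc_subset_uIcc hr
      refine hC2 r ?_ _ _ (hg.bound r)
      have := uIcc_subset_Icc (a₂ := a) (b₂ := b) ⟨hs.1, hs.2.le.trans htb⟩ ⟨hσ.1, hσ.2.trans htb⟩ this
      exact this
    rw [hgσ, sub_self, abs_zero, add_zero] at k1
    have k5 : D σ - D s = (momentum H σ (traj g t x σ) (g s) - momentum H s (traj g t x s) (g s)) +
        ∫ r in s..σ, Hx H r (traj g t x r) (momentum H r (traj g t x r) (g r)) := by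
      simp only [hD]
      rw [hgσ]; linarith
    rw [k5]
    refine (abs_add_le _ _).trans ?_
    have k6 : C1 * (|σ - s| + |traj g t x σ - traj g t x s|) ≤ C1 * (h + M * h) := by
      have := mul_le_mul_of_nonneg_left e3 hM.le
      gcongr
      linarith
    have k7 := mul_le_mul_of_nonneg_left e3 hC20.le
    rw [hC]
    nlinarith
  have hvar : ∀ z, |z| ≤ M → -(C * h) * |z - v i| ≤ (z - v i) * D s := by
    intro z hz
    by_contra! hlt
    set k := stepCtrl a h (fun j => if j = i then z - v i else 0) with hk
    have hkb : IsCtrl (|z - v i|) k := isCtrl_stepCtrl a h fun j => by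
      split_ifs
      · exact le_rfl
      · simp
    have hfv := hH.first_variation (c := c) (t := t) (x := x) hw (hs.1.trans hs.2.le) hg hkb (by
      intro ε hε0 hε1
      have heq : (fun σ => g σ + ε * k σ) =
          stepCtrl a h (fun j => v j + ε * (if j = i then z - v i else 0)) := rfl
      have hb : ∀ j, |v j + ε * (if j = i then z - v i else 0)| ≤ M := by
        intro j
        split_ifs with hj
        · rw [hj]
          have h1 := abs_le.1 hz
          have h2 := abs_le.1 (hv.bound i)
          rw [abs_le]
          constructor <;> nlinarith
        · simpa using hv.bound j
      refine ⟨fun σ => hb _, ?_⟩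
      rw [heq]
      exact hv.le _ hb)
    set f := fun σ => (momentum H σ (traj g t x σ) (g σ) - costate H c w a t x g σ) * k σ with hf
    set η := -((z - v i) * D s + (C * h) * |z - v i|) with hη
    have hη0 : 0 < η := by rw [hη]; linarith
    have hfi : ∀ σ ∈ Icc a t, ⌊(σ - a) / h⌋₊ = i → f σ ≤ -η := by
      intro σ hσ hσi
      have hkσ : k σ = z - v i := by
        simp only [hk, stepCtrl, hσi, if_true]
      have h1 := hosc σ hσ hσi
      have h2 : f σ = (z - v i) * D s + (z - v i) * (D σ - D s) := by
        simp only [hf, hkσ, hD]; ring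
      have h3 : (z - v i) * (D σ - D s) ≤ |z - v i| * (C * h) := by
        refine (le_abs_self _).trans ?_
        rw [abs_mul]
        exact mul_le_mul_of_nonneg_left h1 (abs_nonneg _)
      rw [h2, hη]; linarith
    have hf0 : ∀ σ ∈ Icc a t, f σ ≤ 0 := by
      intro σ hσ
      by_cases hσi : ⌊(σ - a) / h⌋₊ = i
      · linarith [hfi σ hσ hσi]
      · have hkσ : k σ = 0 := by simp only [hk, stepCtrl, hσi, if_false]
        simp only [hf, hkσ, mul_zero, le_refl]
    have hfint : ∀ r r', IntervalIntegrable f volume r r' := by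
      intro r r'
      have hcost : Continuous (costate H c w a t x g) := by
        unfold costate
        exact continuous_const.sub (intervalIntegral.continuous_primitive
          (fun r r' => hH.Hx_intervalIntegrable hg t x r r') a)
      have hk' : IntervalIntegrable (fun σ => momentum H σ (traj g t x σ) (g σ) * k σ) volume r r' := by
        obtain ⟨R, -, hR⟩ := hH.exists_momentum_bound (min r r') (max r r') M
        refine ((hH.measurable_momentum_traj hg t x).mul hkb.measurable).intervalIntegrable_of_abs_le
          (C := R * |z - v i|) fun s hs => ?_
        rw [Pi.mul_apply, abs_mul]
        have := hR s (Ioc_subset_Icc_self hs) (traj g t x s) (g s) (hg.bound s)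
        exact mul_le_mul this (hkb.bound s) (abs_nonneg _) ((abs_nonneg _).trans this)
      have := hk'.sub ((hkb.intervalIntegrable r r').continuousOn_mul hcost.continuousOn)
      refine this.congr (fun σ _ => ?_)
      simp only [hf]; ring
    obtain ⟨s', hs's, hs't, hs'i⟩ : ∃ s', s < s' ∧ s' ≤ t ∧ ∀ σ ∈ Ico s s', ⌊(σ - a) / h⌋₊ = i := by
      refine ⟨min t (a + (i + 1) * h), lt_min hs.2 (abs_sub_floor_le hh hs.1).2, min_le_left _ _, ?_⟩
      intro σ hσ
      have h0 := abs_sub_floor_le hh hs.1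
      have h1 := hσ.2.trans_le (min_le_right _ _)
      rw [Nat.floor_eq_iff (div_nonneg (by linarith [hs.1, hσ.1]) hh.le), le_div_iff₀ hh, div_lt_iff₀ hh]
      constructor <;> linarith [hσ.1]
    have i1 : ∫ σ in a..s, f σ ≤ ∫ σ in a..s, (0:ℝ) :=
      intervalIntegral.integral_mono_on hs.1 (hfint _ _) intervalIntegrable_const
        fun σ hσ => hf0 σ ⟨hσ.1, hσ.2.trans hs.2.le⟩
    have i2 : ∫ σ in s..s', f σ ≤ ∫ σ in s..s', -η :=
      intervalIntegral.integral_mono_on_of_le_Ioo hs's.le (hfint _ _) intervalIntegrable_const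
        fun σ hσ => hfi σ ⟨hs.1.trans hσ.1.le, hσ.2.le.trans hs't⟩ (hs'i σ ⟨hσ.1.le, hσ.2⟩)
    have i3 : ∫ σ in s'..t, f σ ≤ ∫ σ in s'..t, (0:ℝ) :=
      intervalIntegral.integral_mono_on hs't (hfint _ _) intervalIntegrable_const
        fun σ hσ => hf0 σ ⟨hs.1.trans (hs's.le.trans hσ.1), hσ.2⟩
    have i4 := intervalIntegral.integral_add_adjacent_intervals (hfint a s) (hfint s s')
    have i5 := intervalIntegral.integral_add_adjacent_intervals (hfint a s') (hfint s' t)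
    simp only [intervalIntegral.integral_const, smul_eq_mul, mul_zero] at i1 i2 i3
    nlinarith
  have hb := abs_le.1 (hv.bound i)
  constructor
  · intro hlt
    have h1 := hvar M (abs_of_pos hM).le
    rw [hgs] at hlt
    rw [abs_of_pos (by linarith), mul_comm (M - v i)] at h1
    exact le_of_mul_le_mul_right h1 (by linarith)
  · intro hlt
    have h1 := hvar (-M) (by rw [abs_neg, abs_of_pos hM])
    rw [hgs] at hlt
    rw [abs_of_neg (by linarith)] at h1
    have h2 : D s * (v i + M) ≤ (C * h) * (v i + M) := by linarith
    exact le_of_mul_le_mul_right h2 (by linarith)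

/-- Data of a discrete curve which solves the Hamiltonian system up to a small error. -/
structure IsApproxChar (H : ℝ → ℝ → ℝ → ℝ) (c : ℝ) (w : ℝ → ℝ) (a t x : ℝ) (g : ℝ → ℝ) (M δ : ℝ) :
    Prop where
  bound : ∀ s ∈ Ico a t, |g s| ≤ M
  momentum_sub : ∀ s ∈ Ico a t,
    |momentum H s (traj g t x s) (g s) - costate H c w a t x g s| ≤ δ
  vel_sub : ∀ s ∈ Ico a t, |g s - Hp H s (traj g t x s) (costate H c w a t x g s)| ≤ δ
  force_sub : ∀ s ∈ Ico a t, |-Hx H s (traj g t x s) (momentum H s (traj g t x s) (g s)) +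
    Hx H s (traj g t x s) (costate H c w a t x g s)| ≤ δ
  continuous_costate : Continuous (costate H c w a t x g)
  hasDerivWithinAt_traj : ∀ s ∈ Ico a t, HasDerivWithinAt (traj g t x) (g s) (Ici s) s
  hasDerivWithinAt_costate : ∀ s ∈ Ico a t, HasDerivWithinAt (costate H c w a t x g)
    (-Hx H s (traj g t x s) (momentum H s (traj g t x s) (g s))) (Ici s) s

theorem continuous_costate (hH : BurgersHyp H) {g : ℝ → ℝ} (hg : IsCtrl M g) (a t x : ℝ) :
    Continuous (costate H c w a t x g) := by
  unfold costate
  exact continuous_const.sub (intervalIntegral.continuous_primitive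
    (fun r r' => hH.Hx_intervalIntegrable hg t x r r') a)

theorem hasDerivWithinAt_traj_stepCtrl {v : ℕ → ℝ} (hv : ∀ i, |v i| ≤ M) {a h s : ℝ} (hh : 0 < h)
    (hs : a ≤ s) (t x : ℝ) :
    HasDerivWithinAt (traj (stepCtrl a h v) t x) (stepCtrl a h v s) (Ici s) s := by
  have hg := isCtrl_stepCtrl a h hv
  have h1 : HasDerivWithinAt (fun r => ∫ σ in s..r, stepCtrl a h v σ) (stepCtrl a h v s) (Ici s) s := by
    refine intervalIntegral.integral_hasDerivWithinAt_right (hg.intervalIntegrable s s)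
      (hg.measurable.stronglyMeasurable.stronglyMeasurableAtFilter) ?_ (t := Ioi s) (s := Ici s)
    exact ContinuousWithinAt.mono (tendsto_const_nhds.congr' ((stepCtrl_eventually_eq hh hs v).mono
      fun σ hσ => hσ.symm)) (Ioi_subset_Ici_self)
  have h2 := h1.const_add (traj (stepCtrl a h v) t x s)
  refine h2.congr (fun r _ => ?_) ?_
  · linarith [hg.traj_sub_traj t x s r]
  · simp

theorem hasDerivWithinAt_costate_stepCtrl (hH : BurgersHyp H) {v : ℕ → ℝ} (hv : ∀ i, |v i| ≤ M)
    {a h s : ℝ} (hh : 0 < h) (hs : a ≤ s) (t x : ℝ) :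
    HasDerivWithinAt (costate H c w a t x (stepCtrl a h v))
      (-Hx H s (traj (stepCtrl a h v) t x s)
        (momentum H s (traj (stepCtrl a h v) t x s) (stepCtrl a h v s))) (Ici s) s := by
  have hg := isCtrl_stepCtrl a h hv
  set g := stepCtrl a h v with hgdef
  have hcg : Tendsto g (𝓝[≥] s) (𝓝 (g s)) :=
    tendsto_const_nhds.congr' ((stepCtrl_eventually_eq hh hs v).mono fun σ hσ => hσ.symm)
  have hct : Tendsto (traj g t x) (𝓝[≥] s) (𝓝 (traj g t x s)) :=
    ((hg.continuous_traj t x).tendsto s).mono_left nhdsWithin_le_nhds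
  have hcs : Tendsto (fun σ : ℝ => σ) (𝓝[≥] s) (𝓝 s) := nhdsWithin_le_nhds
  have hcm : Tendsto (fun σ => momentum H σ (traj g t x σ) (g σ)) (𝓝[≥] s)
      (𝓝 (momentum H s (traj g t x s) (g s))) :=
    (hH.continuous_momentum.tendsto (s, traj g t x s, g s)).comp
      (hcs.prodMk_nhds (hct.prodMk_nhds hcg))
  have hcF : Tendsto (fun σ => Hx H σ (traj g t x σ) (momentum H σ (traj g t x σ) (g σ))) (𝓝[≥] s)
      (𝓝 (Hx H s (traj g t x s) (momentum H s (traj g t x s) (g s)))) :=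
    (hH.contDiff_Hx.continuous.tendsto (s, traj g t x s, momentum H s (traj g t x s) (g s))).comp
      (hcs.prodMk_nhds (hct.prodMk_nhds hcm))
  have h1 : HasDerivWithinAt (fun r => ∫ σ in s..r,
      Hx H σ (traj g t x σ) (momentum H σ (traj g t x σ) (g σ)))
      (Hx H s (traj g t x s) (momentum H s (traj g t x s) (g s))) (Ici s) s := by
    refine intervalIntegral.integral_hasDerivWithinAt_right (hH.Hx_intervalIntegrable hg t x s s)
      ((hH.measurable_Hx_traj hg t x).stronglyMeasurable.stronglyMeasurableAtFilter) ?_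
      (t := Ioi s) (s := Ici s)
    exact ContinuousWithinAt.mono hcF Ioi_subset_Ici_self
  have h2 := h1.const_sub (costate H c w a t x g s)
  refine h2.congr (fun r _ => ?_) ?_
  · linarith [hH.costate_sub_costate (c := c) (w := w) hg a t x s r]
  · simp

theorem exists_isApproxChar (hH : BurgersHyp H) (hw : Differentiable ℝ w) {K : ℝ}
    (hK : ∀ x, |deriv w x| ≤ K) (a b : ℝ) : ∃ M₁, 0 < M₁ ∧ ∀ M, M₁ < M → ∀ δ, 0 < δ →
      ∃ h₀, 0 < h₀ ∧ ∀ h, 0 < h → h < h₀ → ∀ t, a ≤ t → t ≤ b → ∀ x v, IsStepMin H c w a M h t x v →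
        IsApproxChar H c w a t x (stepCtrl a h v) M₁ δ := by
  obtain ⟨R, hR0, δ₀, hδ₀, hflow⟩ := hH.exists_flow_bound a b (|c| + K)
  obtain ⟨M₁, hM₁0, hM₁⟩ := exists_bound_of_periodic hH.contDiff_Hp.continuous hH.Hp_periodic a b (R + 1)
  obtain ⟨Cp, hCp0, hCp⟩ := exists_lipschitz_of_periodic hH.contDiff_Hp hH.Hp_periodic a b (R + 1)
  obtain ⟨Cx, hCx0, hCx⟩ := exists_lipschitz_of_periodic hH.contDiff_Hx hH.Hx_periodic a b (R + 1)
  refine ⟨M₁, hM₁0, fun M hM δ hδ => ?_⟩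
  obtain ⟨C, hC0, hC⟩ := hH.exists_stepMin_variation (c := c) hw a b (hM₁0.trans hM)
  set E := C * (1 + Cp + Cx) with hE
  have hE0 : 0 < E := by positivity
  have hCE : C ≤ E := by rw [hE]; nlinarith
  have hpE : Cp * C ≤ E := by rw [hE]; nlinarith
  have hxE : Cx * C ≤ E := by rw [hE]; nlinarith
  refine ⟨min (min δ δ₀) 1 / E, by positivity, fun h hh hhh t hat htb x v hv => ?_⟩
  have hEh : E * h < min (min δ δ₀) 1 := by rwa [lt_div_iff₀' hE0] at hhh
  have hEδ : E * h < δ := hEh.trans_le ((min_le_left _ _).trans (min_le_left _ _))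
  have hEδ₀ : E * h < δ₀ := hEh.trans_le ((min_le_left _ _).trans (min_le_right _ _))
  have hE1 : E * h < 1 := hEh.trans_le (min_le_right _ _)
  have hg := isCtrl_stepCtrl a h hv.bound
  have hvar := hC h hh t htb x v hv
  set g := stepCtrl a h v with hgdef
  set ξ := traj g t x with hξ
  set p := costate H c w a t x g with hp
  have hCh : C * h ≤ E * h := mul_le_mul_of_nonneg_right hCE hh.le
  have key : ∀ s ∈ Ico a t, |p s| ≤ R → |g s| ≤ M₁ ∧ |momentum H s (ξ s) (g s) - p s| ≤ C * h ∧
      |g s - Hp H s (ξ s) (p s)| ≤ E * h ∧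
      |-Hx H s (ξ s) (momentum H s (ξ s) (g s)) + Hx H s (ξ s) (p s)| ≤ E * h := by
    intro s hs hps
    obtain ⟨hv1, hv2⟩ := hvar s hs
    have hsI : s ∈ Icc a b := ⟨hs.1, hs.2.le.trans htb⟩
    have hgs := abs_le.1 (hg.bound s)
    have hps' := abs_le.1 hps
    have hmon := hH.strictMono_Hp s (ξ s)
    have hlt : g s < M := by
      by_contra! hge
      have h1 := hv2 (by linarith)
      have h2 : momentum H s (ξ s) (g s) ≤ R + 1 := by linarith
      have h3 := hmon.monotone h2
      rw [hH.Hp_momentum] at h3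
      have h4 := hM₁ s hsI (ξ s) (R + 1) (by rw [abs_of_pos (by linarith)])
      linarith [le_abs_self (Hp H s (ξ s) (R + 1)), Real.norm_eq_abs (Hp H s (ξ s) (R + 1))]
    have hgt : -M < g s := by
      by_contra! hge
      have h1 := hv1 (by linarith)
      have h2 : -(R + 1) ≤ momentum H s (ξ s) (g s) := by linarith
      have h3 := hmon.monotone h2
      rw [hH.Hp_momentum] at h3
      have h4 := hM₁ s hsI (ξ s) (-(R + 1)) (by rw [abs_neg, abs_of_pos (by linarith)])
      linarith [neg_abs_le (Hp H s (ξ s) (-(R + 1))), Real.norm_eq_abs (Hp H s (ξ s) (-(R + 1)))]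
    have hPp : |momentum H s (ξ s) (g s) - p s| ≤ C * h := abs_le.2 ⟨hv1 hlt, hv2 hgt⟩
    have hP : |momentum H s (ξ s) (g s)| ≤ R + 1 := by
      have := abs_le.1 hPp
      rw [abs_le]; constructor <;> linarith
    have hpR : |p s| ≤ R + 1 := by linarith
    refine ⟨?_, hPp, ?_, ?_⟩
    · have := hM₁ s hsI (ξ s) _ hP
      rwa [hH.Hp_momentum] at this
    · have := hCp s hsI s hsI (ξ s) (ξ s) _ _ hP hpR
      rw [hH.Hp_momentum, sub_self, sub_self, abs_zero, zero_add, zero_add] at this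
      have h1 := mul_le_mul_of_nonneg_left hPp hCp0.le
      have h2 := mul_le_mul_of_nonneg_right hpE hh.le
      linarith
    · have := hCx s hsI s hsI (ξ s) (ξ s) _ _ hP hpR
      rw [sub_self, sub_self, abs_zero, zero_add, zero_add] at this
      have h1 := mul_le_mul_of_nonneg_left hPp hCx0.le
      have h2 := mul_le_mul_of_nonneg_right hxE hh.le
      rw [neg_add_eq_sub, abs_sub_comm]
      linarith
  have hdξ : ∀ s ∈ Ico a t, HasDerivWithinAt ξ (g s) (Ici s) s := fun s hs =>
    hasDerivWithinAt_traj_stepCtrl hv.bound hh hs.1 t x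
  have hdp : ∀ s ∈ Ico a t, HasDerivWithinAt p (-Hx H s (ξ s) (momentum H s (ξ s) (g s))) (Ici s) s :=
    fun s hs => hH.hasDerivWithinAt_costate_stepCtrl hv.bound hh hs.1 t x
  have hpR : ∀ s ∈ Icc a t, |p s| ≤ R := by
    refine hflow a t le_rfl hat htb ξ p _ _ (hg.continuous_traj t x).continuousOn
      (hH.continuous_costate hg a t x).continuousOn hdξ hdp (fun s hs hps => ?_) ?_
    · obtain ⟨-, -, h3, h4⟩ := key s hs hps
      exact ⟨h3.trans hEδ₀.le, h4.trans hEδ₀.le⟩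
    · simp only [hp, costate, intervalIntegral.integral_same, sub_zero]
      exact (abs_add_le _ _).trans (by linarith [hK (traj g t x a)])
  have key' := fun s (hs : s ∈ Ico a t) => key s hs (hpR s ⟨hs.1, hs.2.le⟩)
  exact ⟨fun s hs => (key' s hs).1, fun s hs => (key' s hs).2.1.trans (hCh.trans hEδ.le),
    fun s hs => (key' s hs).2.2.1.trans hEδ.le, fun s hs => (key' s hs).2.2.2.trans hEδ.le,
    hH.continuous_costate hg a t x, hdξ, hdp⟩

end BurgersHyp

/-- Approximate quadratic supergradient bounds. -/
def QuadSup (K : ℝ) (f : ℝ → ℝ) : Prop :=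
  ∀ x, ∀ ε > 0, ∃ l, |l| ≤ K ∧ ∀ y, f (x + y) ≤ f x + ε + l * y + K * y ^ 2

theorem abs_sub_le_of_deriv_bound {w : ℝ → ℝ} (hw : Differentiable ℝ w) {K : ℝ}
    (hK : ∀ x, |deriv w x| ≤ K) (x y : ℝ) : |w x - w y| ≤ K * |x - y| := by
  have := Convex.norm_image_sub_le_of_norm_deriv_le (s := univ) (f := w) (C := K)
    (fun x _ => hw x) (fun x _ => hK x) convex_univ (mem_univ y) (mem_univ x)
  simpa using this

theorem IsCtrl.indicator {M M₁ : ℝ} {g : ℝ → ℝ} (hg : IsCtrl M g) (h₁ : 0 ≤ M₁) {a t : ℝ}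
    (hb : ∀ s ∈ Ico a t, |g s| ≤ M₁) : IsCtrl M₁ (indicator (Ico a t) g) := by
  refine ⟨hg.measurable.indicator measurableSet_Ico, fun s => ?_⟩
  by_cases hs : s ∈ Ico a t
  · rw [indicator_of_mem hs]; exact hb s hs
  · rw [indicator_of_notMem hs, abs_zero]; exact h₁

namespace BurgersHyp

variable {H : ℝ → ℝ → ℝ → ℝ} {c : ℝ} {w : ℝ → ℝ} {M : ℝ}

theorem exists_near_min (hH : BurgersHyp H) (hw : Differentiable ℝ w) {K : ℝ}
    (hK : ∀ x, |deriv w x| ≤ K) (c a b : ℝ) : ∃ M₁, 0 < M₁ ∧ ∀ M, M₁ < M → ∀ δ, 0 < δ →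
      ∀ t, a ≤ t → t ≤ b → ∀ x, ∀ ε, 0 < ε → ∃ g, IsCtrl M g ∧
        ctrlAction H c w a t x g ≤ ctrlValue H c w a M t x + ε ∧
        IsApproxChar H c w a t x g M₁ δ := by
  obtain ⟨M₁, hM₁, hC⟩ := hH.exists_isApproxChar (c := c) hw hK a b
  refine ⟨M₁, hM₁, fun M hM δ hδ t hat htb x ε hε => ?_⟩
  obtain ⟨h₀, hh₀, h₁⟩ := hC M hM δ hδ
  have hM0 : 0 ≤ M := (hM₁.trans hM).le
  have hKL := abs_sub_le_of_deriv_bound hw hK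
  obtain ⟨h₂, hh₂, h₃⟩ := hH.exists_isStepMin_le (c := c) hKL hM0 hat x hε
  have hmin : 0 < min h₀ h₂ / 2 := by positivity
  have hlt : min h₀ h₂ / 2 < min h₀ h₂ := by linarith
  obtain ⟨v, hv⟩ := hH.exists_isStepMin (c := c) hKL hM0 hat (min h₀ h₂ / 2) x
  exact ⟨_, isCtrl_stepCtrl a _ hv.bound, h₃ _ hmin (hlt.trans_le (min_le_right _ _)) v hv,
    h₁ _ hmin (hlt.trans_le (min_le_left _ _)) t hat htb x v hv⟩

theorem exists_ctrlValue_lipschitz (hH : BurgersHyp H) (hw : Differentiable ℝ w) {K B : ℝ}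
    (hK : ∀ x, |deriv w x| ≤ K) (hB : ∀ x, |w x| ≤ B) (c a b : ℝ) : ∃ M₁ Λ, 0 < M₁ ∧ 0 ≤ Λ ∧
      ∀ M, M₁ < M → ∀ t ∈ Icc a b, ∀ x y,
        |ctrlValue H c w a M t x - ctrlValue H c w a M t y| ≤ Λ * |x - y| := by
  obtain ⟨M₁, hM₁, hmin⟩ := hH.exists_near_min hw hK c a b
  have hKL := abs_sub_le_of_deriv_bound hw hK
  obtain ⟨Λ, hΛ0, hΛ⟩ := hH.exists_ctrlAction_lipschitz hKL c a b M₁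
  refine ⟨M₁, Λ, hM₁, hΛ0.le, fun M hM t ht => ?_⟩
  have key : ∀ x y, ctrlValue H c w a M t y ≤ ctrlValue H c w a M t x + Λ * |x - y| := by
    intro x y
    refine le_of_forall_pos_le_add fun ε hε => ?_
    obtain ⟨g, hg, hle, hch⟩ := hmin M hM 1 one_pos t ht.1 ht.2 x ε hε
    have hg' := hg.indicator hM₁.le hch.bound
    have h1 := hΛ t ht x y _ _ hg' hg'
    have h2 : ctrlAction H c w a t x (indicator (Ico a t) g) = ctrlAction H c w a t x g :=
      ctrlAction_congr ht.1 (fun s hs => indicator_of_mem (Ioo_subset_Ico_self hs) g) x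
    have h3 := hH.ctrlValue_le (c := c) hB ht.1 y (hg'.mono hM.le)
    simp only [sub_self, abs_zero, intervalIntegral.integral_zero, add_zero] at h1
    have := abs_le.1 h1
    linarith
  intro x y
  rw [abs_le]
  constructor
  · linarith [key x y]
  · have := key y x
    rw [abs_sub_comm] at this
    linarith

theorem ctrlValue_le_perturb (hH : BurgersHyp H) {B : ℝ} (hB : ∀ x, |w x| ≤ B) {g : ℝ → ℝ}
    (hg : IsCtrl M g) {a s t : ℝ} (has : a ≤ s) (hst : s < t) (x κ : ℝ)
    (hb : ∀ σ ∈ Ico s t, |g σ + κ| ≤ M) :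
    ctrlValue H c w a M t (x + κ * (t - s)) ≤ ctrlAction H c w a t x g +
      ((∫ σ in s..t, (Lag H σ (traj g t x σ + κ * (σ - s)) (g σ + κ) - c * (g σ + κ))) -
        ∫ σ in s..t, (Lag H σ (traj g t x σ) (g σ) - c * g σ)) := by
  classical
  set g' := fun σ => if σ ∈ Ico s t then g σ + κ else g σ with hg'
  have hc' : IsCtrl M g' := by
    refine ⟨Measurable.ite measurableSet_Ico (hg.measurable.add_const κ) hg.measurable, fun σ => ?_⟩
    simp only [hg']
    split_ifs with h
    · exact hb σ h
    · exact hg.bound σ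
  have hκ : IsCtrl 1 fun _ => (1:ℝ) := ⟨measurable_const, fun _ => by simp⟩
  have htr : ∀ σ ∈ Icc s t, traj g' t (x + κ * (t - s)) σ = traj g t x σ + κ * (σ - s) := by
    intro σ hσ
    rw [traj_congr (g' := fun σ => g σ + κ * 1) (r := s) (fun τ hτ => ?_) _ hσ,
      traj_add_smul hg hκ, traj_add]
    · have : traj (fun _ => (1:ℝ)) t 0 σ = -(t - σ) := by simp [traj]
      rw [this]; ring
    · simp only [hg', if_pos (Ioo_subset_Ico_self hτ), mul_one]
  have h1 := hH.ctrlValue_le (c := c) hB (has.trans hst.le) (x + κ * (t - s)) hc'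
  rw [hH.ctrlAction_split hc' a s t, htr s ⟨le_rfl, hst.le⟩, sub_self, mul_zero, add_zero] at h1
  have h2 : ctrlAction H c w a s (traj g t x s) g' = ctrlAction H c w a s (traj g t x s) g :=
    ctrlAction_congr has (fun τ hτ => if_neg fun h => absurd h.1 (not_le.2 hτ.2)) _
  have h3 := hH.ctrlAction_split (c := c) (w := w) hg a s t x
  have h4 : ∫ σ in s..t, (Lag H σ (traj g' t (x + κ * (t - s)) σ) (g' σ) - c * g' σ) =
      ∫ σ in s..t, (Lag H σ (traj g t x σ + κ * (σ - s)) (g σ + κ) - c * (g σ + κ)) := by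
    refine intervalIntegral.integral_congr_ae ?_
    filter_upwards [compl_mem_ae_iff.2 (measure_singleton t)] with σ hσt hσ
    rw [uIoc_of_le hst.le] at hσ
    rw [htr σ (Ioc_subset_Icc_self hσ)]
    simp only [hg', if_pos (show σ ∈ Ico s t from ⟨hσ.1.le, lt_of_le_of_ne hσ.2 hσt⟩)]
  linarith

theorem ctrlValue_bounds (hH : BurgersHyp H) (c a b : ℝ) : ∃ C, 0 < C ∧
    (∀ t ∈ Icc a b, ∀ x v, |v| - C ≤ Lag H t x v - c * v) ∧
    ∀ t ∈ Icc a b, ∀ (w : ℝ → ℝ) (B M : ℝ), 0 ≤ M → (∀ x, |w x| ≤ B) → ∀ x,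
      |ctrlValue H c w a M t x| ≤ B + C * (b - a) := by
  obtain ⟨C₁, hC₁0, hC₁⟩ := hH.exists_action_bound c a b 0
  obtain ⟨C₂, hC₂0, hC₂⟩ := hH.exists_Lag_superlinear a b (|c| + 1)
  have hlow : ∀ t ∈ Icc a b, ∀ x v, |v| - (C₁ + C₂) ≤ Lag H t x v - c * v := by
    intro t ht x v
    have h1 := hC₂ t ht x v
    have h2 := (le_abs_self (c * v)).trans (abs_mul c v).le
    linarith
  refine ⟨C₁ + C₂, by positivity, hlow, fun t ht w B M hM hB x => ?_⟩
  have hz : IsCtrl M fun _ => (0:ℝ) := IsCtrl.zero hM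
  rw [abs_le]
  constructor
  · refine le_of_forall_pos_le_add fun ε hε => ?_
    obtain ⟨g, hg, hlt⟩ := exists_ctrlAction_lt (H := H) (c := c) (w := w) hM a t x
      (lt_add_of_pos_right _ hε)
    have h1 : ∫ s in a..t, -(C₁ + C₂) ≤ ∫ s in a..t, (Lag H s (traj g t x s) (g s) - c * g s) :=
      intervalIntegral.integral_mono_on ht.1 intervalIntegrable_const
        (hH.action_intervalIntegrable hg t x a t) fun s hs => by
          linarith [hlow s ⟨hs.1, hs.2.trans ht.2⟩ (traj g t x s) (g s), abs_nonneg (g s)]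
    rw [intervalIntegral.integral_const, smul_eq_mul] at h1
    unfold ctrlAction at hlt
    have h2 := (abs_le.1 (hB (traj g t x a))).1
    have h3 : (t - a) * (C₁ + C₂) ≤ (b - a) * (C₁ + C₂) :=
      mul_le_mul_of_nonneg_right (by linarith [ht.2]) (by positivity)
    linarith
  · refine (hH.ctrlValue_le hB ht.1 x hz).trans ?_
    have h1 : ∫ s in a..t, (Lag H s (traj (fun _ => 0) t x s) 0 - c * 0) ≤ ∫ s in a..t, C₁ :=
      intervalIntegral.integral_mono_on ht.1 (hH.action_intervalIntegrable hz t x a t)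
        intervalIntegrable_const fun s hs => (le_abs_self _).trans
          (hC₁ s ⟨hs.1, hs.2.trans ht.2⟩ _ _ (by simp))
    rw [intervalIntegral.integral_const, smul_eq_mul] at h1
    unfold ctrlAction
    have h2 := (abs_le.1 (hB (traj (fun _ => 0) t x a))).2
    have h3 : (t - a) * C₁ ≤ (b - a) * (C₁ + C₂) := by
      have := ht.1; have := ht.2
      exact mul_le_mul (by linarith) (by linarith) hC₁0.le (by linarith)
    linarith

end BurgersHyp

namespace BurgersHyp

variable {H : ℝ → ℝ → ℝ → ℝ} {c : ℝ} {w : ℝ → ℝ} {M : ℝ}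

/-- Approximate optimal curves have velocities bounded in terms of a bound on the initial
condition only, on a time interval of controlled length. -/
theorem exists_velocity_bound (hH : BurgersHyp H) (c : ℝ) {a b τ B : ℝ} (hτ : 0 < τ) :
    ∃ G δ, 0 < G ∧ 0 < δ ∧ ∀ w : ℝ → ℝ, (∀ x, |w x| ≤ B) → ∀ M M₁, 0 ≤ M → ∀ t x g, IsCtrl M g →
      a + τ ≤ t → t ≤ b → ctrlAction H c w a t x g ≤ ctrlValue H c w a M t x + 1 →
      IsApproxChar H c w a t x g M₁ δ →
      ∃ s, a ≤ s ∧ s + τ / 2 ≤ t ∧ ∀ σ ∈ Ico s t, |g σ| ≤ G := by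
  obtain ⟨C, hC0, hlow, hbd⟩ := hH.ctrlValue_bounds c a b
  set Q := B + C * (b - a) + 1 + B + C * (b - a) with hQ
  set G₀ := 2 * Q / τ + 1 with hG₀
  obtain ⟨R, hR0, hR⟩ := hH.exists_momentum_bound a b G₀
  obtain ⟨R', hR'0, δ, hδ0, hflow⟩ := hH.exists_flow_bound a b (R + 1)
  obtain ⟨G, hG0, hG⟩ := exists_bound_of_periodic hH.contDiff_Hp.continuous hH.Hp_periodic a b R'
  refine ⟨G + 1, min δ 1, by positivity, by positivity, ?_⟩
  intro w hB M M₁ hM t x g hg hat htb hle hch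
  have hat' : a ≤ t := by linarith
  obtain ⟨s, has, hst, hgs⟩ : ∃ s, a ≤ s ∧ s + τ / 2 ≤ t ∧ |g s| ≤ G₀ := by
    by_contra! hcon
    have h1 := (abs_le.1 (hbd t ⟨hat', htb⟩ w B M hM hB x)).2
    unfold ctrlAction at hle
    have h2 := (abs_le.1 (hB (traj g t x a))).1
    have hgi := (hg.intervalIntegrable a t).abs
    have hgi' : ∀ r r', IntervalIntegrable (fun s => |g s|) volume r r' :=
      fun r r' => (hg.intervalIntegrable r r').abs
    have h3 : ∫ s in a..t, (|g s| - C) ≤ ∫ s in a..t, (Lag H s (traj g t x s) (g s) - c * g s) :=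
      intervalIntegral.integral_mono_on hat' (hgi.sub intervalIntegrable_const)
        (hH.action_intervalIntegrable hg t x a t) fun s hs => hlow s ⟨hs.1, hs.2.trans htb⟩ _ _
    rw [intervalIntegral.integral_sub hgi intervalIntegrable_const, intervalIntegral.integral_const,
      smul_eq_mul] at h3
    have h4 := intervalIntegral.integral_add_adjacent_intervals (hgi' a (a + τ / 2)) (hgi' (a + τ / 2) t)
    have h5 : 0 ≤ ∫ s in (a + τ / 2)..t, |g s| :=
      intervalIntegral.integral_nonneg (by linarith) fun _ _ => abs_nonneg _
    have h6 : ∫ s in a..(a + τ / 2), G₀ ≤ ∫ s in a..(a + τ / 2), |g s| :=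
      intervalIntegral.integral_mono_on (by linarith) intervalIntegrable_const (hgi' _ _)
        fun s hs => (hcon s hs.1 (by linarith [hs.2])).le
    rw [intervalIntegral.integral_const, smul_eq_mul] at h6
    have h7 : (a + τ / 2 - a) * G₀ = Q + τ / 2 := by
      rw [hG₀]; field_simp; ring
    have h8 : (t - a) * C ≤ (b - a) * C := mul_le_mul_of_nonneg_right (by linarith) hC0.le
    linarith
  refine ⟨s, has, hst, ?_⟩
  have hst' : s < t := by linarith
  have hps : |costate H c w a t x g s| ≤ R + 1 := by
    have h1 := hch.momentum_sub s ⟨has, hst'⟩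
    have h2 := hR s ⟨has, by linarith⟩ (traj g t x s) (g s) hgs
    have h3 := h1.trans (min_le_right _ _)
    rw [abs_le] at *
    constructor <;> linarith
  have hp := hflow s t has hst'.le htb (traj g t x) (costate H c w a t x g) g _
    (hg.continuous_traj t x).continuousOn hch.continuous_costate.continuousOn
    (fun σ hσ => hch.hasDerivWithinAt_traj σ ⟨has.trans hσ.1, hσ.2⟩)
    (fun σ hσ => hch.hasDerivWithinAt_costate σ ⟨has.trans hσ.1, hσ.2⟩)
    (fun σ hσ _ => ⟨(hch.vel_sub σ ⟨has.trans hσ.1, hσ.2⟩).trans (min_le_left _ _),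
      (hch.force_sub σ ⟨has.trans hσ.1, hσ.2⟩).trans (min_le_left _ _)⟩) hps
  intro σ hσ
  have h1 := (hch.vel_sub σ ⟨has.trans hσ.1, hσ.2⟩).trans (min_le_right _ _)
  have h2 := hG σ ⟨has.trans hσ.1, hσ.2.le.trans htb⟩ (traj g t x σ) _ (hp σ ⟨hσ.1, hσ.2.le⟩)
  rw [Real.norm_eq_abs] at h2
  rw [abs_le] at *
  constructor <;> linarith

theorem exists_ctrlValue_quadSup (hH : BurgersHyp H) (c : ℝ) {a b τ B : ℝ} (hτ : 0 < τ)
    (hB0 : 0 ≤ B) : ∃ K, 0 ≤ K ∧ ∀ w : ℝ → ℝ, Differentiable ℝ w → (∃ K', ∀ x, |deriv w x| ≤ K') →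
      (∀ x, |w x| ≤ B) → ∃ M₂, ∀ M, M₂ < M → ∀ t, a + τ ≤ t → t ≤ b →
        QuadSup K (ctrlValue H c w a M t) := by
  by_cases hab : a ≤ b
  swap
  · exact ⟨0, le_rfl, fun w _ _ _ => ⟨0, fun M _ t h1 h2 => absurd (h1.trans h2) (by linarith)⟩⟩
  obtain ⟨G, δ, hG0, hδ0, hvel⟩ := hH.exists_velocity_bound c (a := a) (b := b) (B := B) hτ
  obtain ⟨C, hC0, -, hbd⟩ := hH.ctrlValue_bounds c a b
  obtain ⟨P, hP0, hP⟩ := hH.exists_momentum_bound a b G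
  obtain ⟨F, hF0, hF⟩ := hH.exists_Hx_traj_bound a b G
  obtain ⟨D, hD0, hD⟩ := hH.exists_Lag_semiconcave a b (G + 1)
  set S := (P + F * (b - a) + |c|) * (2 / τ) * (b - a) with hS
  set E := D * ((b - a) ^ 2 + 1) * (2 / τ) ^ 2 * (b - a) with hE
  set V := 2 * (B + C * (b - a)) with hV
  have hba : 0 ≤ b - a := by linarith
  have hS0 : 0 ≤ S := by positivity
  have hE0 : 0 ≤ E := by positivity
  have hV0 : 0 ≤ V := by positivity
  set r := τ / 2 with hr
  have hr0 : 0 < r := by positivity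
  refine ⟨S + E + V / r ^ 2 + S / r, by positivity, fun w hw ⟨K', hK'⟩ hB => ?_⟩
  obtain ⟨M₁, hM₁, hmin⟩ := hH.exists_near_min hw hK' c a b
  refine ⟨max M₁ (G + 1), fun M hM t hat htb x ε hε => ?_⟩
  have hM1 : M₁ < M := (le_max_left _ _).trans_lt hM
  have hMG : G + 1 ≤ M := ((le_max_right _ _).trans_lt hM).le
  have hM0 : 0 ≤ M := (hM₁.trans hM1).le
  have hat' : a ≤ t := by linarith
  obtain ⟨g, hg, hle, hch⟩ := hmin M hM1 δ hδ0 t hat' htb x (min ε 1) (by positivity)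
  obtain ⟨s, has, hst, hgG⟩ := hvel w hB M M₁ hM0 t x g hg hat htb
    (hle.trans (by linarith [min_le_right ε 1])) hch
  have hT : r ≤ t - s := by linarith
  have hT0 : 0 < t - s := by linarith
  have hTb : t - s ≤ b - a := by linarith
  set q := fun σ => (momentum H σ (traj g t x σ) (g σ) -
    Hx H σ (traj g t x σ) (momentum H σ (traj g t x σ) (g σ)) * (σ - s) - c) / (t - s) with hq
  have hqi : IntervalIntegrable q volume s t := by
    refine IntervalIntegrable.div_const ?_ _
    refine ((hH.momentum_intervalIntegrable hg t x s t).sub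
      ((hH.Hx_intervalIntegrable hg t x s t).mul_continuousOn ?_)).sub intervalIntegrable_const
    fun_prop
  have hqb : ∀ σ ∈ Ioo s t, |q σ| ≤ (P + F * (b - a) + |c|) * (2 / τ) := by
    intro σ hσ
    have hσI : σ ∈ Icc a b := ⟨has.trans hσ.1.le, hσ.2.le.trans htb⟩
    have h1 := hP σ hσI (traj g t x σ) (g σ) (hgG σ (Ioo_subset_Ico_self hσ))
    have h2 := hF σ hσI (traj g t x σ) (g σ) (hgG σ (Ioo_subset_Ico_self hσ))
    have h3 : |σ - s| ≤ b - a := by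
      rw [abs_of_pos (by linarith [hσ.1])]; linarith [hσ.2]
    simp only [hq]
    rw [abs_div, abs_of_pos hT0, div_eq_mul_inv]
    have h4 : (t - s)⁻¹ ≤ 2 / τ := by
      rw [show 2 / τ = r⁻¹ by rw [hr, inv_div]]
      exact inv_anti₀ hr0 hT
    have h5 := mul_le_mul h2 h3 (abs_nonneg _) hF0.le
    rw [← abs_mul] at h5
    refine mul_le_mul ?_ h4 (by positivity) (by positivity)
    refine (abs_sub _ _).trans (add_le_add ((abs_sub _ _).trans (add_le_add h1 h5)) le_rfl)
  set l := ∫ σ in s..t, q σ with hl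
  have hlS : |l| ≤ S := by
    have h1 : |l| ≤ ∫ σ in s..t, |q σ| := intervalIntegral.abs_integral_le_integral_abs (by linarith)
    have h2 : ∫ σ in s..t, |q σ| ≤ ∫ σ in s..t, (P + F * (b - a) + |c|) * (2 / τ) :=
      intervalIntegral.integral_mono_on_of_le_Ioo (by linarith) hqi.abs intervalIntegrable_const hqb
    rw [intervalIntegral.integral_const, smul_eq_mul] at h2
    have h3 : (t - s) * ((P + F * (b - a) + |c|) * (2 / τ)) ≤
      (b - a) * ((P + F * (b - a) + |c|) * (2 / τ)) := mul_le_mul_of_nonneg_right hTb (by positivity)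
    rw [hS]; linarith
  have hloc : ∀ y, |y| ≤ r → ctrlValue H c w a M t (x + y) ≤
      ctrlValue H c w a M t x + ε + l * y + E * y ^ 2 := by
    intro y hy
    set κ := y / (t - s) with hκ
    have hκy : κ * (t - s) = y := div_mul_cancel₀ _ hT0.ne'
    have hκ2 : |κ| ≤ |y| * (2 / τ) := by
      rw [hκ, abs_div, abs_of_pos hT0, div_eq_mul_inv]
      refine mul_le_mul_of_nonneg_left ?_ (abs_nonneg _)
      rw [show 2 / τ = r⁻¹ by rw [hr, inv_div]]
      exact inv_anti₀ hr0 hT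
    have hκ1 : |κ| ≤ 1 := by
      refine hκ2.trans ?_
      rw [show 2 / τ = r⁻¹ by rw [hr, inv_div], ← div_eq_mul_inv, div_le_one hr0]
      exact hy
    have hGκ : ∀ σ ∈ Ico s t, |g σ + κ| ≤ G + 1 := fun σ hσ =>
      (abs_add_le _ _).trans (add_le_add (hgG σ hσ) hκ1)
    have h1 := hH.ctrlValue_le_perturb (c := c) hB hg has (by linarith) x κ
      (fun σ hσ => (hGκ σ hσ).trans hMG)
    rw [hκy] at h1
    set Z := D * ((b - a) ^ 2 + 1) * (2 / τ) ^ 2 with hZ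
    have h2 : ∫ σ in s..t, (Lag H σ (traj g t x σ + κ * (σ - s)) (g σ + κ) - c * (g σ + κ)) ≤
        ∫ σ in s..t, ((Lag H σ (traj g t x σ) (g σ) - c * g σ) + (q σ * y + Z * y ^ 2)) := by
      refine intervalIntegral.integral_mono_on_of_le_Ioo (by linarith) ?_ ?_ ?_
      · have hκc : IsCtrl 1 fun _ => (1:ℝ) := ⟨measurable_const, fun _ => by simp⟩
        have hgc : IsCtrl (M + 1) fun σ => g σ + κ := ⟨hg.measurable.add_const κ, fun σ =>
          (abs_add_le _ _).trans (add_le_add (hg.bound σ) hκ1)⟩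
        refine (hH.action_intervalIntegrable (c := c) hgc t (x + y) s t).congr fun σ _ => ?_
        have : traj (fun σ => g σ + κ) t (x + y) σ = traj g t x σ + κ * (σ - s) := by
          have h3 := traj_add_smul hg hκc κ t (x + y) σ
          simp only [mul_one] at h3
          rw [h3, traj_add, ← hκy]
          have : traj (fun _ => (1:ℝ)) t 0 σ = -(t - σ) := by simp [traj]
          rw [this]; ring
        simp only [this]
      · exact (hH.action_intervalIntegrable hg t x s t).add
          ((hqi.mul_const y).add intervalIntegrable_const)
      · intro σ hσ
        have hσI : σ ∈ Icc a b := ⟨has.trans hσ.1.le, hσ.2.le.trans htb⟩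
        have hσ' := Ioo_subset_Ico_self hσ
        have h3 := hD σ hσI (traj g t x σ) (g σ) (κ * (σ - s)) κ
          ((hgG σ hσ').trans (by linarith)) (hGκ σ hσ')
        have h4 : q σ * y = momentum H σ (traj g t x σ) (g σ) * κ -
            Hx H σ (traj g t x σ) (momentum H σ (traj g t x σ) (g σ)) * (κ * (σ - s)) - c * κ := by
          simp only [hq]
          rw [← hκy]
          field_simp
        have h5 : κ ^ 2 ≤ (2 / τ) ^ 2 * y ^ 2 := by
          rw [← sq_abs κ, ← sq_abs y, ← mul_pow, mul_comm (2 / τ)]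
          exact pow_le_pow_left₀ (abs_nonneg _) hκ2 2
        have h6 : (σ - s) ^ 2 ≤ (b - a) ^ 2 :=
          pow_le_pow_left₀ (by linarith [hσ.1]) (by linarith [hσ.2]) 2
        have h7 : (κ * (σ - s)) ^ 2 + κ ^ 2 ≤ ((b - a) ^ 2 + 1) * ((2 / τ) ^ 2 * y ^ 2) := by
          have : (κ * (σ - s)) ^ 2 + κ ^ 2 = ((σ - s) ^ 2 + 1) * κ ^ 2 := by ring
          rw [this]
          exact mul_le_mul (by linarith) h5 (sq_nonneg _) (by positivity)
        have h8 := mul_le_mul_of_nonneg_left h7 hD0.le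
        have h9 : Z * y ^ 2 = D * (((b - a) ^ 2 + 1) * ((2 / τ) ^ 2 * y ^ 2)) := by rw [hZ]; ring
        linarith
    rw [intervalIntegral.integral_add (hH.action_intervalIntegrable hg t x s t)
      ((hqi.mul_const y).add intervalIntegrable_const), intervalIntegral.integral_add
      (hqi.mul_const y) intervalIntegrable_const, intervalIntegral.integral_mul_const,
      intervalIntegral.integral_const, smul_eq_mul] at h2
    have h3 : (t - s) * (Z * y ^ 2) ≤ (b - a) * (Z * y ^ 2) :=
      mul_le_mul_of_nonneg_right hTb (by positivity)
    have h4 : (b - a) * (Z * y ^ 2) = E * y ^ 2 := by rw [hE]; ring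
    linarith [min_le_left ε 1]
  have hK1 : S ≤ S + E + V / r ^ 2 + S / r := by
    have : 0 ≤ V / r ^ 2 := by positivity
    have : 0 ≤ S / r := by positivity
    linarith
  refine ⟨l, hlS.trans hK1, fun y => ?_⟩
  by_cases hy : |y| ≤ r
  · refine (hloc y hy).trans ?_
    have : E ≤ S + E + V / r ^ 2 + S / r := by
      have : 0 ≤ V / r ^ 2 := by positivity
      have : 0 ≤ S / r := by positivity
      linarith
    have := mul_le_mul_of_nonneg_right this (sq_nonneg y)
    linarith
  · push Not at hy
    have h1 := (abs_le.1 (hbd t ⟨hat', htb⟩ w B M hM0 hB (x + y))).2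
    have h2 := (abs_le.1 (hbd t ⟨hat', htb⟩ w B M hM0 hB x)).1
    have h3 : V ≤ V / r ^ 2 * y ^ 2 := by
      rw [div_mul_eq_mul_div, le_div_iff₀ (by positivity)]
      refine mul_le_mul_of_nonneg_left ?_ hV0
      rw [← sq_abs y]
      exact pow_le_pow_left₀ hr0.le hy.le 2
    have h4 : -(l * y) ≤ S / r * y ^ 2 := by
      have h5 : -(l * y) ≤ S * |y| := by
        refine (neg_le_abs _).trans ?_
        rw [abs_mul]
        exact mul_le_mul_of_nonneg_right hlS (abs_nonneg _)
      refine h5.trans ?_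
      rw [div_mul_eq_mul_div, le_div_iff₀ hr0, mul_assoc, ← sq_abs y]
      refine mul_le_mul_of_nonneg_left ?_ hS0
      rw [sq]
      exact mul_le_mul_of_nonneg_left hy.le (abs_nonneg _)
    have h5 : 0 ≤ S * y ^ 2 := by positivity
    have h6 : 0 ≤ E * y ^ 2 := by positivity
    have h7 : (S + E + V / r ^ 2 + S / r) * y ^ 2 =
      S * y ^ 2 + E * y ^ 2 + V / r ^ 2 * y ^ 2 + S / r * y ^ 2 := by ring
    linarith

end BurgersHyp

namespace BurgersHyp

variable {H : ℝ → ℝ → ℝ → ℝ} {c : ℝ} {w : ℝ → ℝ} {M : ℝ}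

theorem line_isAC (s t x v : ℝ) : IsAC (fun σ => x - (t - σ) * v) (fun _ => v) s t := by
  refine ⟨intervalIntegrable_const, fun σ _ => ?_⟩
  rw [intervalIntegral.integral_const, smul_eq_mul]; ring

theorem line_action_intervalIntegrable (hH : BurgersHyp H) (c s t x v : ℝ) :
    IntervalIntegrable (fun σ => Lag H σ (x - (t - σ) * v) v - c * v) volume s t :=
  ((hH.continuous_Lag.comp (f := fun σ : ℝ => (σ, x - (t - σ) * v, v)) (by fun_prop)).sub
    continuous_const).intervalIntegrable _ _

theorem viscSubSol_of_dominated (hH : BurgersHyp H) {u : ℝ → ℝ → ℝ} {a b : ℝ}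
    (hdom : ∀ s t, a < s → s < t → t < b → ∀ ξ g, IsAC ξ g s t →
      IntervalIntegrable (fun σ => Lag H σ (ξ σ) (g σ) - c * g σ) volume s t →
      u t (ξ t) ≤ u s (ξ s) + ∫ σ in s..t, (Lag H σ (ξ σ) (g σ) - c * g σ)) :
    ViscSubSol H c 0 (Ioo a b ×ˢ univ) u := by
  rintro φ hφ ⟨t, x⟩ hz hmax
  have ht : t ∈ Ioo a b := hz.1
  refine hH.sub_test ((hφ.differentiable (by norm_num)) (t, x)).hasFDerivAt (fun v _ => ?_) hmax
  filter_upwards [Ioo_mem_nhdsLT ht.1] with s hs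
  have h1 := hdom s t hs.1 hs.2 ht.2 _ _ (line_isAC s t x v)
    (hH.line_action_intervalIntegrable c s t x v)
  simpa using h1

theorem viscSuperSol_of_near (hH : BurgersHyp H) {u : ℝ → ℝ → ℝ} {a b B : ℝ}
    (hB : ∀ t ∈ Ioo a b, ∀ y, -B ≤ u t y)
    (hnear : ∀ s t, a < s → s < t → t < b → ∀ x, ∀ ε > 0, ∃ ξ g, IsAC ξ g s t ∧ ξ t = x ∧
      IntervalIntegrable (fun σ => Lag H σ (ξ σ) (g σ) - c * g σ) volume s t ∧
      u s (ξ s) + ∫ σ in s..t, (Lag H σ (ξ σ) (g σ) - c * g σ) ≤ u t x + ε) :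
    ViscSuperSol H c 0 (Ioo a b ×ˢ univ) u := by
  rintro φ hφ ⟨t, x⟩ hz hmin
  have ht : t ∈ Ioo a b := hz.1
  refine hH.super_test ((hφ.differentiable (by norm_num)) (t, x)).hasFDerivAt (B := B) ?_ ?_ hmin
  · filter_upwards [Ioo_mem_nhdsLT ht.1] with s hs
    exact hB s ⟨hs.1, hs.2.trans ht.2⟩
  · filter_upwards [Ioo_mem_nhdsLT ht.1] with s hs
    exact hnear s t hs.1 hs.2 ht.2 x

theorem exists_ctrlValue_time_lipschitz (hH : BurgersHyp H) {B Λ a b : ℝ} (hB : ∀ x, |w x| ≤ B)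
    (hM : 0 ≤ M) (hΛ0 : 0 ≤ Λ) (hΛ : ∀ t ∈ Icc a b, ∀ x y,
      |ctrlValue H c w a M t x - ctrlValue H c w a M t y| ≤ Λ * |x - y|) :
    ∃ K, 0 ≤ K ∧ ∀ t ∈ Icc a b, ∀ s ∈ Icc a b, ∀ x y,
      |ctrlValue H c w a M t x - ctrlValue H c w a M s y| ≤ K * (|t - s| + |x - y|) := by
  obtain ⟨C, hC0, hC⟩ := hH.exists_action_bound c a b M
  have hint : ∀ g, IsCtrl M g → ∀ s t x, a ≤ s → s ≤ t → t ≤ b →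
      |∫ σ in s..t, (Lag H σ (traj g t x σ) (g σ) - c * g σ)| ≤ C * (t - s) := by
    intro g hg s t x has hst htb
    have := intervalIntegral.norm_integral_le_of_norm_le_const (a := s) (b := t) (C := C)
      (f := fun σ => Lag H σ (traj g t x σ) (g σ) - c * g σ) (fun σ hσ => by
        rw [uIoc_of_le hst] at hσ
        exact hC σ ⟨has.trans hσ.1.le, hσ.2.trans htb⟩ _ _ (hg.bound σ))
    rwa [abs_of_nonneg (by linarith : (0:ℝ) ≤ t - s)] at this
  have key : ∀ s ∈ Icc a b, ∀ t ∈ Icc a b, s ≤ t → ∀ x,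
      |ctrlValue H c w a M t x - ctrlValue H c w a M s x| ≤ (C + Λ * M) * (t - s) := by
    intro s hs t ht hst x
    rw [abs_le]
    constructor
    · refine neg_le_iff_add_nonneg.2 ?_
      refine le_of_forall_pos_le_add fun ε hε => ?_
      obtain ⟨g, hg, hle⟩ := hH.exists_ctrl_le_ctrlValue (c := c) hB hM hs.1 x hε (t := t)
      have h1 := (abs_le.1 (hint g hg s t x hs.1 hst ht.2)).1
      have h2 := (abs_le.1 (hΛ s hs (traj g t x s) x)).1
      have h3 := hg.abs_traj_sub_le t x t s
      rw [traj_self, abs_sub_comm s t, abs_of_nonneg (by linarith : (0:ℝ) ≤ t - s)] at h3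
      have h4 := mul_le_mul_of_nonneg_left h3 hΛ0
      linarith
    · have hz : IsCtrl M fun _ => (0:ℝ) := IsCtrl.zero hM
      have h1 := hH.ctrlValue_le_of_ctrl (c := c) hB hs.1 hst x hz
      have h2 := (abs_le.1 (hint _ hz s t x hs.1 hst ht.2)).2
      have h3 : traj (fun _ => 0) t x s = x := by simp [traj]
      rw [h3] at h1
      have h4 : 0 ≤ Λ * M * (t - s) := by have : 0 ≤ t - s := by linarith
                                          positivity
      linarith
  refine ⟨C + Λ * M + Λ, by positivity, fun t ht s hs x y => ?_⟩
  have h1 : |ctrlValue H c w a M t x - ctrlValue H c w a M s x| ≤ (C + Λ * M) * |t - s| := by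
    rcases le_total s t with h | h
    · rw [abs_of_nonneg (by linarith : (0:ℝ) ≤ t - s)]; exact key s hs t ht h x
    · rw [abs_sub_comm, abs_sub_comm t s, abs_of_nonneg (by linarith : (0:ℝ) ≤ s - t)]
      exact key t ht s hs h x
  have h2 := abs_sub_le (ctrlValue H c w a M t x) (ctrlValue H c w a M s x) (ctrlValue H c w a M s y)
  have h3 := hΛ s hs x y
  have h4 : 0 ≤ Λ * |t - s| := by positivity
  have h5 : 0 ≤ (C + Λ * M) * |x - y| := by positivity
  linarith

theorem ctrlValue_dominated (hH : BurgersHyp H) {B Λ K a b : ℝ} (hB : ∀ x, |w x| ≤ B)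
    (hK0 : 0 ≤ K) (hΛ : ∀ t ∈ Icc a b, ∀ x y,
      |ctrlValue H c w a M t x - ctrlValue H c w a M t y| ≤ Λ * |x - y|)
    (hK : ∀ t ∈ Icc a b, ∀ s ∈ Icc a b, ∀ x y,
      |ctrlValue H c w a M t x - ctrlValue H c w a M s y| ≤ K * (|t - s| + |x - y|))
    (hMp : ∀ t ∈ Icc a b, ∀ x p, |p| ≤ |c| + Λ → |Hp H t x p| ≤ M)
    {s t : ℝ} (has : a ≤ s) (hst : s ≤ t) (htb : t ≤ b) {ξ g : ℝ → ℝ} (hAC : IsAC ξ g s t)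
    (hint : IntervalIntegrable (fun σ => Lag H σ (ξ σ) (g σ) - c * g σ) volume s t) :
    ctrlValue H c w a M t (ξ t) ≤ ctrlValue H c w a M s (ξ s) +
      ∫ σ in s..t, (Lag H σ (ξ σ) (g σ) - c * g σ) := by
  have hsub : Icc s t ⊆ Icc a b := Icc_subset_Icc has htb
  refine hH.le_action_of_ae (c := c) (u := ctrlValue H c w a M) hst hK0
    (fun t' ht' s' hs' => hK t' (hsub ht') s' (hsub hs')) ?_ hAC hint
  have hdiff := ae_differentiableAt_strip hK0
    (fun t' ht' s' hs' => hK t' (hsub ht') s' (hsub hs'))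
  have hmem : ∀ᵐ z ∂(volume.restrict (Ioo s t ×ˢ (univ : Set ℝ))), z ∈ Ioo s t ×ˢ (univ : Set ℝ) :=
    ae_restrict_mem (measurableSet_Ioo.prod MeasurableSet.univ)
  filter_upwards [hdiff, hmem] with z hz hzm
  obtain ⟨r, x⟩ := z
  have hr : r ∈ Ioo s t := hzm.1
  refine ⟨hz, ?_⟩
  set φ' := fderiv ℝ (fun w' : ℝ × ℝ => ctrlValue H c w a M w'.1 w'.2) (r, x) with hφ'
  have hrI : r ∈ Icc a b := hsub (Ioo_subset_Icc_self hr)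
  have hb : |φ' (0, 1)| ≤ Λ := by
    have h1 : HasDerivAt (fun y => ctrlValue H c w a M r y) (φ' (0, 1)) x :=
      hz.hasFDerivAt.comp_hasDerivAt (f := fun y : ℝ => (r, y)) x
        ((hasDerivAt_const x r).prodMk (hasDerivAt_id x))
    have hΛ0 : 0 ≤ Λ := by
      have := (abs_nonneg _).trans (hΛ r hrI 1 0)
      simpa using this
    exact h1.le_of_lip' hΛ0 (Eventually.of_forall fun y => by
      rw [Real.norm_eq_abs, Real.norm_eq_abs]; exact hΛ r hrI y x)
  refine hH.sub_test (u := ctrlValue H c w a M) hz.hasFDerivAt (fun v hv => ?_) ?_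
  · filter_upwards [Ioo_mem_nhdsLT (has.trans_lt hr.1)] with q hq
    have hvM : |v| ≤ M := by
      rw [hv]
      exact hMp r hrI x _ ((abs_add_le _ _).trans (by linarith))
    have hc : IsCtrl M fun _ => v := ⟨measurable_const, fun _ => hvM⟩
    have := hH.ctrlValue_le_of_ctrl (c := c) hB hq.1.le hq.2.le x hc
    simpa [traj] using this
  · exact Eventually.of_forall fun y => by simp

/-- Existence, regularity and uniqueness properties of the value function with a smooth initial
condition. -/
theorem exists_value_function (hH : BurgersHyp H) (c : ℝ) {a b τ B : ℝ} (hτ : 0 < τ)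
    (hB0 : 0 ≤ B) : ∃ K, 0 ≤ K ∧ ∀ w : ℝ → ℝ, ContDiff ℝ 1 w → (∀ x, w (x + 1) = w x) →
      (∀ x, |w x| ≤ B) → ∃ v : ℝ → ℝ → ℝ,
        (∃ L, 0 ≤ L ∧ ∀ t ∈ Icc a b, ∀ s ∈ Icc a b, ∀ x y,
          |v t x - v s y| ≤ L * (|t - s| + |x - y|)) ∧
        (∀ t x, v t (x + 1) = v t x) ∧ (∀ x, v a x = w x) ∧
        ViscSol H c 0 (Ioo a b ×ˢ univ) v ∧
        (∀ t ∈ Icc a b, ∀ x, IsGLB (hloSet H c a t w x) (v t x)) ∧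
        ∀ t, a + τ ≤ t → t ≤ b → QuadSup K (v t) := by
  obtain ⟨K, hK0, hquad⟩ := hH.exists_ctrlValue_quadSup c (a := a) (b := b) hτ hB0
  refine ⟨K, hK0, fun w hw hwp hB => ?_⟩
  have hwd : Differentiable ℝ w := hw.differentiable (by norm_num)
  obtain ⟨K', hK'⟩ : ∃ K', ∀ x, |deriv w x| ≤ K' := by
    have hdc : Continuous (deriv w) := hw.continuous_deriv (by norm_num)
    have hdp : Function.Periodic (deriv w) 1 := fun x => by
      have : (fun y => w (y + 1)) = w := funext hwp
      rw [← deriv_comp_add_const, this]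
    obtain ⟨C, hC⟩ := isCompact_Icc.exists_bound_of_continuousOn (s := Icc (0:ℝ) 1) hdc.continuousOn
    refine ⟨C, fun x => ?_⟩
    obtain ⟨y, hy, hxy⟩ := hdp.exists_mem_Ico₀ one_pos x
    rw [hxy]
    exact hC y (Ico_subset_Icc_self hy)
  obtain ⟨M₂, hM₂⟩ := hquad w hwd ⟨K', hK'⟩ hB
  obtain ⟨M₁, Λ, hM₁, hΛ0, hΛ⟩ := hH.exists_ctrlValue_lipschitz hwd hK' hB c a b
  obtain ⟨C, hC0, hC⟩ := exists_bound_of_periodic hH.contDiff_Hp.continuous hH.Hp_periodic a b (|c| + Λ)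
  set M := max (max M₁ M₂) C + 1 with hM
  have hMM₁ : M₁ < M := by
    rw [hM]; linarith [le_max_left (max M₁ M₂) C, le_max_left M₁ M₂]
  have hMM₂ : M₂ < M := by
    rw [hM]; linarith [le_max_left (max M₁ M₂) C, le_max_right M₁ M₂]
  have hMC : C ≤ M := by rw [hM]; linarith [le_max_right (max M₁ M₂) C]
  have hM0 : 0 ≤ M := (hM₁.trans hMM₁).le
  have hΛM := hΛ M hMM₁
  obtain ⟨L, hL0, hL⟩ := hH.exists_ctrlValue_time_lipschitz (c := c) hB hM0 hΛ0 hΛM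
  have hdom := fun {s t : ℝ} => hH.ctrlValue_dominated (s := s) (t := t) hB hL0 hΛM hL
    (fun t ht x p hp => (hC t ht x p hp).trans hMC)
  have hbound : ∃ C', ∀ t ∈ Icc a b, ∀ x, |ctrlValue H c w a M t x| ≤ C' := by
    obtain ⟨C', -, -, h⟩ := hH.ctrlValue_bounds c a b
    exact ⟨_, fun t ht x => h t ht w B M hM0 hB x⟩
  obtain ⟨C', hC'⟩ := hbound
  refine ⟨ctrlValue H c w a M, ⟨L, hL0, hL⟩, fun t x => hH.ctrlValue_periodic hwp a t x,
    fun x => ctrlValue_initial hM0 a x, ⟨?_, ?_⟩, ?_, fun t h1 h2 => hM₂ M hMM₂ t h1 h2⟩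
  · exact hH.viscSubSol_of_dominated fun s t has hst htb ξ g hAC hint =>
      hdom has.le hst.le htb.le hAC hint
  · refine hH.viscSuperSol_of_near (B := C')
      (fun t ht y => (abs_le.1 (hC' t (Ioo_subset_Icc_self ht) y)).1) ?_
    intro s t has hst htb x ε hε
    obtain ⟨g, hg, hle⟩ := hH.exists_ctrl_le_ctrlValue (c := c) hB hM0 has.le x hε (t := t)
    exact ⟨_, g, hg.isAC_traj s t t x, traj_self g t x, hH.action_intervalIntegrable hg t x s t, hle⟩
  · intro t ht x
    constructor
    · rintro _ ⟨ξ, g, hAC, hx, hint, rfl⟩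
      have h1 := hdom le_rfl ht.1 ht.2 hAC hint
      rwa [hx, ctrlValue_initial hM0] at h1
    · intro l hl
      refine le_of_forall_pos_le_add fun ε hε => ?_
      obtain ⟨g, hg, hlt⟩ := exists_ctrlAction_lt (H := H) (c := c) (w := w) hM0 a t x
        (lt_add_of_pos_right _ hε)
      exact (hl (hH.ctrlAction_mem_hloSet hg a t x)).trans hlt.le

end BurgersHyp

theorem QuadSup.of_approx {K : ℝ} {f : ℝ → ℝ}
    (h : ∀ ε > 0, ∃ g, QuadSup K g ∧ ∀ x, |f x - g x| ≤ ε) : QuadSup K f := by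
  intro x ε hε
  obtain ⟨g, hg, hfg⟩ := h (ε / 3) (by positivity)
  obtain ⟨l, hl, hy⟩ := hg x (ε / 3) (by positivity)
  refine ⟨l, hl, fun y => ?_⟩
  have h1 := abs_le.1 (hfg x)
  have h2 := abs_le.1 (hfg (x + y))
  have h3 := hy y
  linarith [h1.1, h2.2]

theorem QuadSup.abs_sub_le {K : ℝ} {f : ℝ → ℝ} (h : QuadSup K f) (hp : ∀ x, f (x + 1) = f x)
    (x y : ℝ) : |f x - f y| ≤ 2 * K * |x - y| := by
  have hK : 0 ≤ K := by
    obtain ⟨l, hl, -⟩ := h 0 1 one_pos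
    exact (abs_nonneg l).trans hl
  have key : ∀ x y, |y| ≤ 1 → f (x + y) - f x ≤ 2 * K * |y| := by
    intro x y hy1
    refine le_of_forall_pos_le_add fun ε hε => ?_
    obtain ⟨l, hl, hy⟩ := h x ε hε
    have h1 := hy y
    have h2 : l * y ≤ K * |y| :=
      (le_abs_self _).trans ((abs_mul l y).le.trans (by gcongr))
    have h3 : y ^ 2 ≤ |y| := by
      rw [← sq_abs]; nlinarith [abs_nonneg y]
    have h4 := mul_le_mul_of_nonneg_left h3 hK
    linarith
  have hper : Function.Periodic f 1 := hp
  have key2 : ∀ x z, f z - f x ≤ 2 * K * |z - x| := by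
    intro x z
    by_cases hzx : |z - x| ≤ 1
    · simpa using key x (z - x) hzx
    · have h0 := key x (Int.fract (z - x)) (by
        rw [abs_of_nonneg (Int.fract_nonneg _)]; exact (Int.fract_lt_one _).le)
      have h1 : x + Int.fract (z - x) = z - (⌊z - x⌋ : ℝ) := by
        rw [← Int.self_sub_floor]; ring
      have h2 : f (z - (⌊z - x⌋ : ℝ)) = f z := by
        simpa using hper.sub_int_mul_eq ⌊z - x⌋ (x := z)
      rw [h1, h2] at h0
      refine h0.trans ?_
      have : |Int.fract (z - x)| ≤ |z - x| := by
        rw [abs_of_nonneg (Int.fract_nonneg _)]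
        exact (Int.fract_lt_one _).le.trans (not_le.1 hzx).le
      gcongr
  rw [abs_le]
  have h1 := key2 x y
  have h2 := key2 y x
  rw [abs_sub_comm] at h1
  constructor <;> linarith

theorem SemiConcaveK.mono {K K' : ℝ} {f : ℝ → ℝ} (h : SemiConcaveK f K) (hK : K ≤ K') :
    SemiConcaveK f K' := by
  have h1 : ConcaveOn ℝ univ (fun x : ℝ => -((K' - K) / 2 * x ^ 2)) :=
    ((even_two.convexOn_pow (𝕜 := ℝ)).smul (by linarith : 0 ≤ (K' - K) / 2)).neg
  have h2 := ConcaveOn.add h h1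
  refine h2.congr fun x _ => ?_
  simp only [Pi.add_apply]
  ring

theorem QuadSup.semiConcaveK {K : ℝ} {f : ℝ → ℝ} (h : QuadSup K f) : SemiConcaveK f (2 * K) := by
  refine ⟨convex_univ, fun x _ y _ a b ha hb hab => ?_⟩
  simp only [smul_eq_mul]
  refine le_of_forall_pos_le_add fun ε hε => ?_
  obtain ⟨l, hl, hz⟩ := h (a * x + b * y) ε hε
  have h1 := hz (x - (a * x + b * y))
  have h2 := hz (y - (a * x + b * y))
  rw [add_sub_cancel] at h1 h2
  have h3 := mul_le_mul_of_nonneg_left h1 ha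
  have h4 := mul_le_mul_of_nonneg_left h2 hb
  obtain rfl : a = 1 - b := by linarith
  nlinarith

/-- Continuous periodic functions are uniform limits of `C¹` periodic functions. -/
theorem exists_contDiff_periodic_approx {f : ℝ → ℝ} (hf : Continuous f)
    (hp : ∀ x, f (x + 1) = f x) {ε : ℝ} (hε : 0 < ε) :
    ∃ w : ℝ → ℝ, ContDiff ℝ 1 w ∧ (∀ x, w (x + 1) = w x) ∧ ∀ x, |f x - w x| ≤ ε := by
  have hper : Function.Periodic f 1 := hp
  have huc : UniformContinuous f := by
    have hc := isCompact_Icc.uniformContinuousOn_of_continuous (s := Icc (-1 : ℝ) 2)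
      hf.continuousOn
    refine Metric.uniformContinuous_iff.2 fun e he => ?_
    obtain ⟨δ, hδ, hd⟩ := Metric.uniformContinuousOn_iff.1 hc e he
    refine ⟨min δ 1, by positivity, fun x y hxy => ?_⟩
    have hs : ∀ z, f (z - (⌊x⌋ : ℝ)) = f z := fun z => by
      simpa using hper.sub_int_mul_eq ⌊x⌋ (x := z)
    rw [← hs x, ← hs y]
    have h1 := Int.floor_le x
    have h2 := Int.lt_floor_add_one x
    have h3 := abs_lt.1 (Real.dist_eq x y ▸ (lt_min_iff.1 hxy).2)
    refine hd _ ⟨by linarith, by linarith⟩ _ ⟨by linarith [h3.2], by linarith [h3.1]⟩ ?_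
    rw [dist_sub_right]
    exact (lt_min_iff.1 hxy).1
  obtain ⟨δ, hδ, hd⟩ := Metric.uniformContinuous_iff.1 huc ε hε
  set d := δ / 2
  have hd0 : 0 < d := by positivity
  set F : ℝ → ℝ := fun x => ∫ s in (0:ℝ)..x, f s
  have hF : ∀ x, HasDerivAt F (f x) x := fun x =>
    intervalIntegral.integral_hasDerivAt_right (hf.intervalIntegrable _ _)
      (hf.stronglyMeasurableAtFilter _ _) hf.continuousAt
  have hw : ∀ x, HasDerivAt (fun x => (F (x + d) - F x) / d) ((f (x + d) - f x) / d) x := fun x =>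
    (((hF (x + d)).comp_add_const x d).sub (hF x)).div_const d
  have heq : ∀ x, F (x + d) - F x = ∫ s in x..x + d, f s := fun x =>
    intervalIntegral.integral_interval_sub_left (hf.intervalIntegrable _ _)
      (hf.intervalIntegrable _ _)
  refine ⟨fun x => (F (x + d) - F x) / d, ?_, fun x => ?_, fun x => ?_⟩
  · refine contDiff_one_iff_deriv.2 ⟨fun x => (hw x).differentiableAt, ?_⟩
    rw [funext fun x => (hw x).deriv]
    fun_prop
  · simp only [heq]
    congr 1
    rw [show x + 1 + d = (x + d) + 1 by ring,
      ← intervalIntegral.integral_comp_add_right (fun s => f s) 1]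
    simp only [hp]
  · have h1 : f x - (F (x + d) - F x) / d = -((∫ s in x..x + d, (f s - f x)) / d) := by
      rw [heq, intervalIntegral.integral_sub (hf.intervalIntegrable _ _) (by simp)]
      simp
      field_simp
      ring
    rw [h1, abs_neg, abs_div, abs_of_pos hd0, div_le_iff₀ hd0]
    have := intervalIntegral.norm_integral_le_of_norm_le_const (a := x) (b := x + d)
      (f := fun s => f s - f x) (C := ε) (fun s hs => by
        rw [uIoc_of_le (by linarith)] at hs
        have := hd (a := s) (b := x) (by
          rw [Real.dist_eq, abs_of_nonneg (by linarith [hs.1])]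
          have : d = δ / 2 := rfl
          linarith [hs.2])
        exact this.le)
    simpa [abs_of_pos hd0] using this

theorem ViscSol.mono {H : ℝ → ℝ → ℝ → ℝ} {c a : ℝ} {D D' : Set (ℝ × ℝ)} {u : ℝ → ℝ → ℝ} (h : ViscSol H c a D u)
    (hD : D' ⊆ D) : ViscSol H c a D' u :=
  ⟨fun φ hφ z hz => h.1 φ hφ z (hD hz), fun φ hφ z hz => h.2 φ hφ z (hD hz)⟩

theorem continuous_slice {a b : ℝ} {u : ℝ → ℝ → ℝ}
    (hu : ContinuousOn (fun z : ℝ × ℝ => u z.1 z.2) (Icc a b ×ˢ univ)) {t : ℝ}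
    (ht : t ∈ Icc a b) : Continuous (u t) :=
  continuousOn_univ.1 (hu.comp (f := fun x : ℝ => (t, x)) (by fun_prop) fun x _ => ⟨ht, trivial⟩)

theorem continuousOn_slice {a b : ℝ} {u : ℝ → ℝ → ℝ}
    (hu : ContinuousOn (fun z : ℝ × ℝ => u z.1 z.2) (Icc a b ×ˢ univ)) (x : ℝ) :
    ContinuousOn (fun t => u t x) (Icc a b) :=
  hu.comp (f := fun t : ℝ => (t, x)) (by fun_prop) fun t ht => ⟨ht, trivial⟩

theorem continuousOn_of_strip_lipschitz {a b L : ℝ} {v : ℝ → ℝ → ℝ}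
    (hv : ∀ t ∈ Icc a b, ∀ s ∈ Icc a b, ∀ x y, |v t x - v s y| ≤ L * (|t - s| + |x - y|)) :
    ContinuousOn (fun z : ℝ × ℝ => v z.1 z.2) (Icc a b ×ˢ univ) := by
  intro z hz
  have h0 : Tendsto (fun w : ℝ × ℝ => L * (|w.1 - z.1| + |w.2 - z.2|)) (𝓝[Icc a b ×ˢ univ] z)
      (𝓝 0) := by
    have : Continuous fun w : ℝ × ℝ => L * (|w.1 - z.1| + |w.2 - z.2|) := by fun_prop
    simpa using (this.tendsto z).mono_left nhdsWithin_le_nhds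
  refine tendsto_iff_norm_sub_tendsto_zero.2 (squeeze_zero' (Eventually.of_forall fun _ =>
    norm_nonneg _) ?_ h0)
  filter_upwards [self_mem_nhdsWithin] with w hw
  exact hv w.1 hw.1 z.1 hz.1 w.2 z.2

theorem exists_strip_bound {a b : ℝ} {u : ℝ → ℝ → ℝ}
    (hu : ContinuousOn (fun z : ℝ × ℝ => u z.1 z.2) (Icc a b ×ˢ univ))
    (hp : ∀ t x, u t (x + 1) = u t x) : ∃ B, 0 ≤ B ∧ ∀ t ∈ Icc a b, ∀ x, |u t x| ≤ B := by
  obtain ⟨C, hC⟩ := (isCompact_Icc.prod isCompact_Icc).exists_bound_of_continuousOn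
    (s := Icc a b ×ˢ Icc (0:ℝ) 1) (hu.mono (prod_mono le_rfl (subset_univ _)))
  refine ⟨max C 0, le_max_right _ _, fun t ht x => ?_⟩
  have h1 : u t (Int.fract x) = u t x := by
    have hper : Function.Periodic (u t) 1 := hp t
    simpa [Int.self_sub_floor] using hper.sub_int_mul_eq ⌊x⌋ (x := x)
  rw [← h1]
  exact (hC (t, Int.fract x) ⟨ht, Int.fract_nonneg _, (Int.fract_lt_one _).le⟩).trans
    (le_max_left _ _)

namespace BurgersHyp

variable {H : ℝ → ℝ → ℝ → ℝ}

theorem abs_sub_le_of_viscSol (hH : BurgersHyp H) {a b c L m : ℝ} {U W : ℝ → ℝ → ℝ} (hab : a < b)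
    (hUc : ContinuousOn (fun z : ℝ × ℝ => U z.1 z.2) (Icc a b ×ˢ univ))
    (hUp : ∀ t x, U t (x + 1) = U t x) (hWp : ∀ t x, W t (x + 1) = W t x)
    (hU : ViscSol H c 0 (Ioo a b ×ˢ univ) U) (hW : ViscSol H c 0 (Ioo a b ×ˢ univ) W)
    (hL : ∀ t ∈ Icc a b, ∀ s ∈ Icc a b, ∀ x y, |W t x - W s y| ≤ L * (|t - s| + |x - y|))
    (hm : ∀ x, |U a x - W a x| ≤ m) {t : ℝ} (ht : t ∈ Icc a b) (x : ℝ) :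
    |U t x - W t x| ≤ m := by
  have hWc := continuousOn_of_strip_lipschitz hL
  have hL' : ∀ t ∈ Icc a b, ∀ x y, |W t x - W t y| ≤ L * |x - y| := fun t ht x y => by
    simpa using hL t ht t ht x y
  have hin : ∀ s ∈ Ioo a b, |U s x - W s x| ≤ m := by
    intro s hs
    rw [abs_sub_le_iff]
    exact ⟨hH.comparison hUc hWc hUp hWp hU.1 hW.2 (.inr hL')
        (fun y => (abs_sub_le_iff.1 (hm y)).1) hs x,
      hH.comparison hWc hUc hWp hUp hW.1 hU.2 (.inl hL')
        (fun y => (abs_sub_le_iff.1 (hm y)).2) hs x⟩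
  rw [← closure_Ioo hab.ne] at ht
  refine le_on_closure (f := fun s => |U s x - W s x|) (g := fun _ => m) hin ?_
    continuousOn_const ht
  rw [closure_Ioo hab.ne]
  exact ((continuousOn_slice hUc x).sub (continuousOn_slice hWc x)).abs

theorem isGLB_hloSet_of_viscSol (hH : BurgersHyp H) {a b c : ℝ} {u : ℝ → ℝ → ℝ} (hab : a < b)
    (huc : ContinuousOn (fun z : ℝ × ℝ => u z.1 z.2) (Icc a b ×ˢ univ))
    (hup : ∀ t x, u t (x + 1) = u t x) (hu : ViscSol H c 0 (Ioo a b ×ˢ univ) u) (x : ℝ) :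
    IsGLB (hloSet H c a b (u a) x) (u b x) := by
  have ha : a ∈ Icc a b := left_mem_Icc.2 hab.le
  have hb : b ∈ Icc a b := right_mem_Icc.2 hab.le
  obtain ⟨B, hB0, hB⟩ := exists_strip_bound huc hup
  obtain ⟨K, -, hK⟩ := hH.exists_value_function c (a := a) (b := b) one_pos
    (by positivity : 0 ≤ B + 1)
  have happ : ∀ ε > 0, ε ≤ 1 → ∃ w : ℝ → ℝ, (∀ y, |u a y - w y| ≤ ε) ∧
      ∃ r, |u b x - r| ≤ ε ∧ IsGLB (hloSet H c a b w x) r := by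
    intro ε hε hε1
    obtain ⟨w, hw, hwp, hwa⟩ := exists_contDiff_periodic_approx (continuous_slice huc ha) (hup a) hε
    obtain ⟨v, ⟨L, -, hL⟩, hvp, hva, hv, hglb, -⟩ := hK w hw hwp fun y => by
      have h1 := abs_le.1 (hwa y)
      have h2 := abs_le.1 (hB a ha y)
      rw [abs_le]
      constructor <;> linarith
    exact ⟨w, hwa, v b x, hH.abs_sub_le_of_viscSol hab huc hup hvp hu hv hL
      (fun y => by rw [hva]; exact hwa y) hb x, hglb b hb x⟩
  constructor
  · rintro _ ⟨ξ, g, hAC, hξ, hint, rfl⟩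
    refine le_of_forall_pos_le_add fun ε hε => ?_
    obtain ⟨w, hw, r, hr, hglb⟩ := happ (min (ε / 2) 1) (by positivity) (min_le_right _ _)
    have h1 := hglb.1 ⟨ξ, g, hAC, hξ, hint, rfl⟩
    have h2 := abs_le.1 (hw (ξ a))
    have h3 := abs_le.1 hr
    have h4 := min_le_left (ε / 2) 1
    linarith
  · intro m hm
    refine le_of_forall_pos_le_add fun ε hε => ?_
    obtain ⟨w, hw, r, hr, hglb⟩ := happ (min (ε / 2) 1) (by positivity) (min_le_right _ _)
    have h4 := min_le_left (ε / 2) 1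
    have h1 : m - min (ε / 2) 1 ≤ r := by
      refine hglb.2 ?_
      rintro _ ⟨ξ, g, hAC, hξ, hint, rfl⟩
      have h5 := hm ⟨ξ, g, hAC, hξ, hint, rfl⟩
      have h2 := abs_le.1 (hw (ξ a))
      linarith
    have h3 := abs_le.1 hr
    linarith

theorem hloSet_nonempty (hH : BurgersHyp H) (c a b : ℝ) (w : ℝ → ℝ) (x : ℝ) :
    (hloSet H c a b w x).Nonempty :=
  ⟨_, _, _, line_isAC a b x 0, by simp, hH.line_action_intervalIntegrable c a b x 0, rfl⟩

theorem hlo_self (c a : ℝ) (w : ℝ → ℝ) (x : ℝ) : hlo H c a a w x = w x := by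
  have : hloSet H c a a w x = {w x} := by
    ext v
    constructor
    · rintro ⟨ξ, g, -, hξ, -, rfl⟩
      simp [hξ]
    · rintro rfl
      exact ⟨fun _ => x, 0, ⟨by simp, by simp⟩, rfl, by simp, by simp⟩
  rw [hlo, this, csInf_singleton]

theorem eq_hlo_of_viscSol (hH : BurgersHyp H) {a b c : ℝ} {u : ℝ → ℝ → ℝ} (hab : a ≤ b)
    (huc : ContinuousOn (fun z : ℝ × ℝ => u z.1 z.2) (Icc a b ×ˢ univ))
    (hup : ∀ t x, u t (x + 1) = u t x) (hu : ViscSol H c 0 (Ioo a b ×ˢ univ) u) (x : ℝ) :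
    u b x = hlo H c a b (u a) x := by
  rcases hab.eq_or_lt with rfl | hab
  · rw [hlo_self]
  · exact ((hH.isGLB_hloSet_of_viscSol hab huc hup hu x).csInf_eq (hH.hloSet_nonempty ..)).symm

theorem bddBelow_hloSet (hH : BurgersHyp H) {a b c B : ℝ} {w : ℝ → ℝ} (hab : a ≤ b)
    (hB : ∀ x, |w x| ≤ B) (x : ℝ) : BddBelow (hloSet H c a b w x) := by
  obtain ⟨C, hC, hlow, -⟩ := hH.ctrlValue_bounds c a b
  refine ⟨-B + ∫ _ in a..b, -C, ?_⟩
  rintro _ ⟨ξ, g, hAC, hξ, hint, rfl⟩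
  refine add_le_add (abs_le.1 (hB _)).1 (intervalIntegral.integral_mono_on hab (by simp) hint
    fun s hs => ?_)
  have := hlow s hs (ξ s) (g s)
  linarith [abs_nonneg (g s)]

theorem isGLB_hloSet_of_eq_hlo (hH : BurgersHyp H) {a b c : ℝ} {u : ℝ → ℝ → ℝ}
    (huc : ContinuousOn (fun z : ℝ × ℝ => u z.1 z.2) (Icc a b ×ˢ univ))
    (hup : ∀ t x, u t (x + 1) = u t x)
    (hu : ∀ t t', a ≤ t → t ≤ t' → t' ≤ b → ∀ x, u t' x = hlo H c t t' (u t) x)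
    {s t : ℝ} (has : a ≤ s) (hst : s ≤ t) (htb : t ≤ b) (x : ℝ) :
    IsGLB (hloSet H c s t (u s) x) (u t x) := by
  obtain ⟨B, hB0, hB⟩ := exists_strip_bound huc hup
  rw [hu s t has hst htb]
  exact isGLB_csInf (hH.hloSet_nonempty ..)
    (hH.bddBelow_hloSet hst (hB s ⟨has, hst.trans htb⟩) x)

theorem viscSol_of_eq_hlo (hH : BurgersHyp H) {a b c : ℝ} {u : ℝ → ℝ → ℝ}
    (huc : ContinuousOn (fun z : ℝ × ℝ => u z.1 z.2) (Icc a b ×ˢ univ))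
    (hup : ∀ t x, u t (x + 1) = u t x)
    (hu : ∀ t t', a ≤ t → t ≤ t' → t' ≤ b → ∀ x, u t' x = hlo H c t t' (u t) x) :
    ViscSol H c 0 (Ioo a b ×ˢ univ) u := by
  obtain ⟨B, hB0, hB⟩ := exists_strip_bound huc hup
  constructor
  · refine hH.viscSubSol_of_dominated fun s t has hst htb ξ g hAC hint => ?_
    exact (hH.isGLB_hloSet_of_eq_hlo huc hup hu has.le hst.le htb.le (ξ t)).1
      ⟨ξ, g, hAC, rfl, hint, rfl⟩
  · refine hH.viscSuperSol_of_near (B := B) (fun t ht y => (abs_le.1 (hB t (Ioo_subset_Icc_self ht) y)).1)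
      fun s t has hst htb x ε hε => ?_
    obtain ⟨_, ⟨ξ, g, hAC, hξ, hint, rfl⟩, -, h⟩ :=
      (hH.isGLB_hloSet_of_eq_hlo huc hup hu has.le hst.le htb.le x).exists_between
        (lt_add_of_pos_right _ hε)
    exact ⟨ξ, g, hAC, hξ, hint, h.le⟩

end BurgersHyp

namespace BurgersHyp

variable {H : ℝ → ℝ → ℝ → ℝ}

theorem exists_quadSup_of_viscSol (hH : BurgersHyp H) {a b c τ : ℝ} {u : ℝ → ℝ → ℝ} (hab : a < b)
    (hτ : 0 < τ) (huc : ContinuousOn (fun z : ℝ × ℝ => u z.1 z.2) (Icc a b ×ˢ univ))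
    (hup : ∀ t x, u t (x + 1) = u t x) (hu : ViscSol H c 0 (Ioo a b ×ˢ univ) u) :
    ∃ K, 0 ≤ K ∧ ∀ t, a + τ ≤ t → t ≤ b → QuadSup K (u t) := by
  have ha : a ∈ Icc a b := left_mem_Icc.2 hab.le
  obtain ⟨B, hB0, hB⟩ := exists_strip_bound huc hup
  obtain ⟨K, hK0, hK⟩ := hH.exists_value_function c (a := a) (b := b) hτ (by positivity : 0 ≤ B + 1)
  refine ⟨K, hK0, fun t hat htb => QuadSup.of_approx fun ε hε => ?_⟩
  obtain ⟨w, hw, hwp, hwa⟩ := exists_contDiff_periodic_approx (continuous_slice huc ha) (hup a)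
    (ε := min ε 1) (by positivity)
  obtain ⟨v, ⟨L, -, hL⟩, hvp, hva, hv, -, hq⟩ := hK w hw hwp fun y => by
    have h1 := abs_le.1 ((hwa y).trans (min_le_right _ _))
    have h2 := abs_le.1 (hB a ha y)
    rw [abs_le]
    constructor <;> linarith
  exact ⟨v t, hq t hat htb, fun x => hH.abs_sub_le_of_viscSol hab huc hup hvp hu hv hL
    (fun y => by rw [hva]; exact (hwa y).trans (min_le_left _ _)) ⟨by linarith, htb⟩ x⟩

theorem exists_time_lipschitz_of_eq_hlo (hH : BurgersHyp H) {a b c A : ℝ} {u : ℝ → ℝ → ℝ}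
    (huc : ContinuousOn (fun z : ℝ × ℝ => u z.1 z.2) (Icc a b ×ˢ univ))
    (hup : ∀ t x, u t (x + 1) = u t x)
    (hu : ∀ t t', a ≤ t → t ≤ t' → t' ≤ b → ∀ x, u t' x = hlo H c t t' (u t) x)
    (hA : ∀ t ∈ Icc a b, ∀ x y, |u t x - u t y| ≤ A * |x - y|) :
    ∃ C, 0 ≤ C ∧ ∀ t ∈ Icc a b, ∀ s ∈ Icc a b, ∀ x, |u t x - u s x| ≤ C * |t - s| := by
  obtain ⟨C₁, hC₁0, hC₁⟩ := hH.exists_action_bound c a b 0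
  obtain ⟨C₂, hC₂0, hC₂⟩ := hH.exists_Lag_superlinear a b (A + |c|)
  have key : ∀ s t, a ≤ s → s ≤ t → t ≤ b → ∀ x, |u t x - u s x| ≤ (C₁ + C₂) * (t - s) := by
    intro s t has hst htb x
    have hglb := hH.isGLB_hloSet_of_eq_hlo huc hup hu has hst htb x
    have hA0 : 0 ≤ A := by
      simpa using (abs_nonneg _).trans (hA s ⟨has, hst.trans htb⟩ 1 0)
    have hup' : u t x ≤ u s x + C₁ * (t - s) := by
      have h1 := hglb.1 ⟨_, _, line_isAC s t x 0, by simp,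
        hH.line_action_intervalIntegrable c s t x 0, rfl⟩
      refine h1.trans ?_
      have h2 := intervalIntegral.integral_mono_on hst
        (hH.line_action_intervalIntegrable c s t x 0) (g := fun _ => C₁) (by simp)
        (fun σ hσ => (abs_le.1 (hC₁ σ ⟨has.trans hσ.1, hσ.2.trans htb⟩ _ 0 (by simp))).2)
      simp at h2 ⊢
      linarith
    have hlow : u s x - C₂ * (t - s) ≤ u t x := by
      refine hglb.2 ?_
      rintro _ ⟨ξ, g, hAC, hξ, hint, rfl⟩
      have h1 := hA s ⟨has, hst.trans htb⟩ x (ξ s)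
      have h2 : |x - ξ s| ≤ ∫ σ in s..t, |g σ| := by
        have := hAC.2 t ⟨hst, le_rfl⟩
        rw [hξ] at this
        rw [this, add_sub_cancel_left]
        exact intervalIntegral.abs_integral_le_integral_abs hst
      have h3 : (∫ σ in s..t, (A * |g σ| - C₂)) ≤
          ∫ σ in s..t, (Lag H σ (ξ σ) (g σ) - c * g σ) := by
        refine intervalIntegral.integral_mono_on hst ((hAC.1.abs.const_mul A).sub (by simp)) hint
          fun σ hσ => ?_
        have h4 := hC₂ σ ⟨has.trans hσ.1, hσ.2.trans htb⟩ (ξ σ) (g σ)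
        have h5 : c * g σ ≤ |c| * |g σ| := by rw [← abs_mul]; exact le_abs_self _
        linarith
      rw [intervalIntegral.integral_sub (hAC.1.abs.const_mul A) (by simp),
        intervalIntegral.integral_const_mul] at h3
      simp at h3
      have h4 := mul_le_mul_of_nonneg_left h2 hA0
      have h5 := (abs_le.1 h1).2
      linarith
    have := mul_nonneg hC₁0.le (sub_nonneg.2 hst)
    have := mul_nonneg hC₂0.le (sub_nonneg.2 hst)
    rw [abs_le]
    constructor <;> linarith
  refine ⟨C₁ + C₂, by positivity, fun t ht s hs x => ?_⟩
  rcases le_total s t with h | h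
  · rw [abs_of_nonneg (sub_nonneg.2 h)]
    exact key s t hs.1 h ht.2 x
  · rw [abs_sub_comm, abs_sub_comm t s, abs_of_nonneg (sub_nonneg.2 h)]
    exact key t s ht.1 h hs.2 x

theorem exists_strip_lipschitz_of_viscSol (hH : BurgersHyp H) {a b c τ : ℝ} {u : ℝ → ℝ → ℝ}
    (hab : a < b) (hτ : 0 < τ)
    (huc : ContinuousOn (fun z : ℝ × ℝ => u z.1 z.2) (Icc a b ×ˢ univ))
    (hup : ∀ t x, u t (x + 1) = u t x) (hu : ViscSol H c 0 (Ioo a b ×ˢ univ) u) :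
    ∃ L, 0 ≤ L ∧ ∀ t ∈ Icc (a + τ) b, ∀ s ∈ Icc (a + τ) b, ∀ x y,
      |u t x - u s y| ≤ L * (|t - s| + |x - y|) := by
  obtain ⟨K, hK0, hK⟩ := hH.exists_quadSup_of_viscSol hab hτ huc hup hu
  have hsub : Icc (a + τ) b ⊆ Icc a b := Icc_subset_Icc_left (by linarith)
  have hA : ∀ t ∈ Icc (a + τ) b, ∀ x y, |u t x - u t y| ≤ 2 * K * |x - y| := fun t ht =>
    (hK t ht.1 ht.2).abs_sub_le (hup t)
  obtain ⟨C, hC0, hC⟩ := hH.exists_time_lipschitz_of_eq_hlo (c := c)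
    (huc.mono (prod_mono hsub le_rfl)) hup (fun t t' hat htt htb x =>
      hH.eq_hlo_of_viscSol htt (huc.mono (prod_mono (Icc_subset_Icc (by linarith) htb) le_rfl)) hup
        (hu.mono (prod_mono (Ioo_subset_Ioo (by linarith) htb) le_rfl)) x) hA
  refine ⟨C + 2 * K, by positivity, fun t ht s hs x y => ?_⟩
  have h1 := hC t ht s hs x
  have h2 := hA s hs x y
  have h3 : |u t x - u s y| ≤ |u t x - u s x| + |u s x - u s y| := abs_sub_le _ _ _
  have h4 := mul_nonneg hC0 (abs_nonneg (x - y))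
  have h5 := mul_nonneg hK0 (abs_nonneg (t - s))
  linarith

theorem locallyLipschitz_of_viscSol (hH : BurgersHyp H) {a b c : ℝ} {u : ℝ → ℝ → ℝ} (hab : a < b)
    (huc : ContinuousOn (fun z : ℝ × ℝ => u z.1 z.2) (Icc a b ×ˢ univ))
    (hup : ∀ t x, u t (x + 1) = u t x) (hu : ViscSol H c 0 (Ioo a b ×ˢ univ) u) :
    ∀ z ∈ Ioc a b ×ˢ (univ : Set ℝ), ∃ K : NNReal, ∃ s ∈ 𝓝[Ioc a b ×ˢ univ] z,
      LipschitzOnWith K (fun w : ℝ × ℝ => u w.1 w.2) s := by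
  rintro ⟨t, x⟩ ⟨ht, -⟩
  obtain ⟨L, hL0, hL⟩ := hH.exists_strip_lipschitz_of_viscSol hab (τ := (t - a) / 2)
    (by linarith [ht.1]) huc hup hu
  refine ⟨Real.toNNReal (2 * L), Icc (a + (t - a) / 2) b ×ˢ univ, ?_, ?_⟩
  · have h1 : Ioi (a + (t - a) / 2) ×ˢ univ ∈ 𝓝 (t, x) :=
      (isOpen_Ioi.prod isOpen_univ).mem_nhds ⟨by simp; linarith [ht.1], trivial⟩
    filter_upwards [mem_nhdsWithin_of_mem_nhds h1, self_mem_nhdsWithin] with w hw hw'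
    exact ⟨⟨le_of_lt hw.1, hw'.1.2⟩, trivial⟩
  · refine LipschitzOnWith.of_dist_le_mul fun z hz w hw => ?_
    rw [Real.coe_toNNReal _ (by positivity), Real.dist_eq, Prod.dist_eq, Real.dist_eq, Real.dist_eq]
    refine (hL _ hz.1 _ hw.1 _ _).trans ?_
    have h1 := le_max_left |z.1 - w.1| |z.2 - w.2|
    have h2 := le_max_right |z.1 - w.1| |z.2 - w.2|
    nlinarith

theorem exists_semiConcave_of_viscSol (hH : BurgersHyp H) {a b c : ℝ} {u : ℝ → ℝ → ℝ} (hab : a < b)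
    (huc : ContinuousOn (fun z : ℝ × ℝ => u z.1 z.2) (Icc a b ×ˢ univ))
    (hup : ∀ t x, u t (x + 1) = u t x) (hu : ViscSol H c 0 (Ioo a b ×ˢ univ) u) :
    ∃ K : ℝ → ℝ, AntitoneOn K (Ioc a b) ∧ ∀ t ∈ Ioc a b, 0 < K t ∧ SemiConcaveK (u t) (K t) := by
  set S : ℝ → Set ℝ := fun t => {K | 0 ≤ K ∧ ∀ s ∈ Icc t b, SemiConcaveK (u s) K} with hS
  have hbdd : ∀ t, BddBelow (S t) := fun t => ⟨0, fun K hK => hK.1⟩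
  have hne : ∀ t ∈ Ioc a b, (S t).Nonempty := by
    intro t ht
    obtain ⟨K, hK0, hK⟩ := hH.exists_quadSup_of_viscSol hab (sub_pos.2 ht.1) huc hup hu
    exact ⟨2 * K, by positivity, fun s hs =>
      (hK s (by linarith [hs.1]) hs.2).semiConcaveK⟩
  refine ⟨fun t => sInf (S t) + 1, fun t ht s hs hts => ?_, fun t ht => ⟨?_, ?_⟩⟩
  · have : S t ⊆ S s := fun K hK => ⟨hK.1, fun r hr => hK.2 r ⟨hts.trans hr.1, hr.2⟩⟩
    have := csInf_le_csInf (hbdd s) (hne t ht) this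
    simp only
    linarith
  · have := Real.sInf_nonneg (s := S t) fun K hK => hK.1
    positivity
  · obtain ⟨K, hK, hlt⟩ := exists_lt_of_csInf_lt (hne t ht) (lt_add_one (sInf (S t)))
    exact (hK.2 t ⟨le_rfl, ht.2⟩).mono hlt.le

theorem ae_eq_of_viscSol (hH : BurgersHyp H) {a b c : ℝ} {u : ℝ → ℝ → ℝ} (hab : a < b)
    (huc : ContinuousOn (fun z : ℝ × ℝ => u z.1 z.2) (Icc a b ×ˢ univ))
    (hup : ∀ t x, u t (x + 1) = u t x) (hu : ViscSol H c 0 (Ioo a b ×ˢ univ) u) :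
    ∀ᵐ z ∂(volume.restrict (Ioo a b ×ˢ (univ : Set ℝ))),
      DifferentiableAt ℝ (fun w : ℝ × ℝ => u w.1 w.2) z ∧
      fderiv ℝ (fun w : ℝ × ℝ => u w.1 w.2) z (1, 0)
        + H z.1 z.2 (c + fderiv ℝ (fun w : ℝ × ℝ => u w.1 w.2) z (0, 1)) = 0 := by
  have hmeas : MeasurableSet (Ioo a b ×ˢ (univ : Set ℝ)) := measurableSet_Ioo.prod .univ
  have hdiff : ∀ n : ℕ, ∀ᵐ z : ℝ × ℝ, z ∈ Ioo (a + 1 / ((n : ℝ) + 1)) b ×ˢ (univ : Set ℝ) →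
      DifferentiableAt ℝ (fun w : ℝ × ℝ => u w.1 w.2) z := by
    intro n
    obtain ⟨L, hL0, hL⟩ := hH.exists_strip_lipschitz_of_viscSol hab
      (τ := 1 / ((n : ℝ) + 1)) (by positivity) huc hup hu
    exact (ae_restrict_iff' (measurableSet_Ioo.prod .univ)).1 (ae_differentiableAt_strip hL0 hL)
  rw [ae_restrict_iff' hmeas]
  filter_upwards [ae_all_iff.2 hdiff]
  rintro ⟨t, x⟩ hd ⟨ht, -⟩
  obtain ⟨n, hn⟩ := exists_nat_one_div_lt (sub_pos.2 ht.1)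
  have hdz := hd n ⟨⟨by simp only at hn ⊢; linarith, ht.2⟩, trivial⟩
  refine ⟨hdz, ?_⟩
  obtain ⟨B, hB0, hB⟩ := exists_strip_bound huc hup
  have hglb : ∀ s, a ≤ s → s ≤ t → ∀ y, IsGLB (hloSet H c s t (u s) y) (u t y) := fun s has hst y =>
    hH.isGLB_hloSet_of_eq_hlo huc hup (fun r r' har hrr hrb x =>
      hH.eq_hlo_of_viscSol hrr (huc.mono (prod_mono (Icc_subset_Icc har hrb) le_rfl)) hup
        (hu.mono (prod_mono (Ioo_subset_Ioo har hrb) le_rfl)) x) has hst ht.2.le y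
  apply le_antisymm
  · refine hH.sub_test (u := u) hdz.hasFDerivAt (fun v _ => ?_) (Eventually.of_forall fun w => by simp)
    filter_upwards [Ioo_mem_nhdsLT ht.1] with s hs
    exact (hglb s hs.1.le hs.2.le x).1 ⟨_, _, line_isAC s t x v, by simp,
      hH.line_action_intervalIntegrable c s t x v, rfl⟩
  · refine hH.super_test (u := u) (B := B) hdz.hasFDerivAt ?_ ?_ (Eventually.of_forall fun w => by simp)
    · filter_upwards [Ioo_mem_nhdsLT ht.1] with s hs y
      exact (abs_le.1 (hB s ⟨hs.1.le, hs.2.le.trans ht.2.le⟩ y)).1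
    · filter_upwards [Ioo_mem_nhdsLT ht.1] with s hs ε hε
      obtain ⟨_, ⟨ξ, g, hAC, hξ, hint, rfl⟩, -, h⟩ :=
        (hglb s hs.1.le hs.2.le x).exists_between (lt_add_of_pos_right _ hε)
      exact ⟨ξ, g, hAC, hξ, hint, h.le⟩

end BurgersHyp

theorem exists_uniform_lipschitz_of_isCompact {α : Type*} [PseudoMetricSpace α] {F : α → ℝ}
    {S Q : Set α} (hQ : IsCompact Q) (hQS : Q ⊆ S)
    (hloc : ∀ z ∈ S, ∃ K : NNReal, ∃ s ∈ 𝓝[S] z, LipschitzOnWith K F s) :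
    ∃ δ > 0, ∃ K : ℝ, 0 ≤ K ∧ ∀ z ∈ Q, ∀ w ∈ S, dist z w < δ → |F z - F w| ≤ K * dist z w := by
  suffices h : ∃ δ > 0, ∃ K : ℝ, 0 ≤ K ∧ ∀ z ∈ Q, z ∈ S → ∀ w ∈ S, dist z w < δ →
      |F z - F w| ≤ K * dist z w by
    obtain ⟨δ, hδ, K, hK, h⟩ := h
    exact ⟨δ, hδ, K, hK, fun z hz => h z hz (hQS hz)⟩
  refine hQ.induction_on (p := fun Q => ∃ δ > 0, ∃ K : ℝ, 0 ≤ K ∧ ∀ z ∈ Q, z ∈ S → ∀ w ∈ S,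
      dist z w < δ → |F z - F w| ≤ K * dist z w) ⟨1, one_pos, 0, le_rfl, by simp⟩ ?_ ?_ ?_
  · rintro s t hst ⟨δ, hδ, K, hK, h⟩
    exact ⟨δ, hδ, K, hK, fun z hz => h z (hst hz)⟩
  · rintro s t ⟨δ, hδ, K, hK, h⟩ ⟨δ', hδ', K', hK', h'⟩
    refine ⟨min δ δ', lt_min hδ hδ', max K K', hK.trans (le_max_left _ _), ?_⟩
    rintro z (hz | hz) hzS w hw hd
    · refine (h z hz hzS w hw (hd.trans_le (min_le_left _ _))).trans ?_
      gcongr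
      exact le_max_left _ _
    · refine (h' z hz hzS w hw (hd.trans_le (min_le_right _ _))).trans ?_
      gcongr
      exact le_max_right _ _
  · intro z hz
    obtain ⟨K, s, hs, hK⟩ := hloc z (hQS hz)
    obtain ⟨ε, hε, hball⟩ := Metric.mem_nhdsWithin_iff.1 hs
    refine ⟨Metric.ball z (ε / 2), mem_nhdsWithin_of_mem_nhds (Metric.ball_mem_nhds _ (by positivity)),
      ε / 2, by positivity, K, K.2, fun z' hz' hz'S w hw hd => ?_⟩
    rw [← Real.dist_eq]
    refine hK.dist_le_mul _ (hball ⟨?_, hz'S⟩) _ (hball ⟨?_, hw⟩)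
    · exact Metric.ball_subset_ball (by linarith) hz'
    · rw [Metric.mem_ball] at hz' ⊢
      have := dist_triangle w z' z
      rw [dist_comm w z'] at this
      linarith

theorem exists_strip_lipschitz_of_local {t₀ t₁ a : ℝ} {u : ℝ → ℝ → ℝ} (ha : t₀ < a)
    (huc : ContinuousOn (fun z : ℝ × ℝ => u z.1 z.2) (Icc t₀ t₁ ×ˢ univ))
    (hup : ∀ t x, u t (x + 1) = u t x)
    (hloc : ∀ z ∈ Ioc t₀ t₁ ×ˢ (univ : Set ℝ), ∃ K : NNReal,
      ∃ s ∈ 𝓝[Ioc t₀ t₁ ×ˢ (univ : Set ℝ)] z, LipschitzOnWith K (fun w : ℝ × ℝ => u w.1 w.2) s) :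
    ∃ L, 0 ≤ L ∧ ∀ t ∈ Icc a t₁, ∀ s ∈ Icc a t₁, ∀ x y,
      |u t x - u s y| ≤ L * (|t - s| + |x - y|) := by
  obtain ⟨B, hB0, hB⟩ := exists_strip_bound huc hup
  have hsub : Icc a t₁ ⊆ Ioc t₀ t₁ := fun s hs => ⟨ha.trans_le hs.1, hs.2⟩
  obtain ⟨δ, hδ, K, hK, h⟩ := exists_uniform_lipschitz_of_isCompact
    (isCompact_Icc.prod isCompact_Icc : IsCompact (Icc a t₁ ×ˢ Icc (0:ℝ) 1))
    (prod_mono hsub (subset_univ _)) hloc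
  refine ⟨K + 2 * B / δ, by positivity, fun t ht s hs x y => ?_⟩
  have hdist : ∀ x y, dist (t, x) (s, y) ≤ |t - s| + |x - y| := fun x y => by
    rw [Prod.dist_eq, Real.dist_eq, Real.dist_eq]
    exact max_le (by simp) (by simp)
  have hshift : ∀ r z, u r (z - (⌊x⌋ : ℝ)) = u r z := fun r z => by
    have hper : Function.Periodic (u r) 1 := hup r
    simpa using hper.sub_int_mul_eq ⌊x⌋ (x := z)
  rw [add_mul]
  by_cases hd : dist (t, x) (s, y) < δ
  · have h1 := h (t, x - (⌊x⌋ : ℝ)) ⟨ht, by simp,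
      by simpa using (Int.fract_lt_one x).le⟩ (s, y - (⌊x⌋ : ℝ)) ⟨hsub hs, trivial⟩
      (by simpa [Prod.dist_eq, dist_sub_right] using hd)
    simp only [hshift] at h1
    have h2 := hdist (x - (⌊x⌋ : ℝ)) (y - (⌊x⌋ : ℝ))
    rw [sub_sub_sub_cancel_right] at h2
    have h3 := mul_le_mul_of_nonneg_left h2 hK
    have : 0 ≤ 2 * B / δ * (|t - s| + |x - y|) := by positivity
    linarith
  · have h1 : |u t x - u s y| ≤ 2 * B := by
      have h2 := hB t ⟨ha.le.trans ht.1, ht.2⟩ x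
      have h3 := hB s ⟨ha.le.trans hs.1, hs.2⟩ y
      have := abs_sub (u t x) (u s y)
      linarith
    have h2 : 2 * B ≤ 2 * B / δ * (|t - s| + |x - y|) := by
      rw [div_mul_eq_mul_div, le_div_iff₀ hδ]
      exact mul_le_mul_of_nonneg_left ((not_lt.1 hd).trans (hdist x y)) (by positivity)
    have : 0 ≤ K * (|t - s| + |x - y|) := by positivity
    linarith

theorem SemiConcaveK.le_tangent {w : ℝ → ℝ} {K p x : ℝ} (h : SemiConcaveK w K)
    (hp : HasDerivAt w p x) (y : ℝ) : w (x + y) ≤ w x + p * y + K * y ^ 2 / 2 := by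
  have hd : HasDerivAt (fun x => w x - K * x ^ 2 / 2) (p - K * x) x := by
    refine hp.sub ?_
    convert! ((hasDerivAt_pow 2 x).const_mul K).div_const 2 using 1
    simp
    ring
  have key : w (x + y) - K * (x + y) ^ 2 / 2 ≤ w x - K * x ^ 2 / 2 + (p - K * x) * y := by
    rcases lt_trichotomy y 0 with hy | rfl | hy
    · have h1 := ConcaveOn.le_slope_of_hasDerivAt h (mem_univ (x + y)) (mem_univ x) (by linarith) hd
      rw [slope_def_field, le_div_iff₀ (by linarith)] at h1
      linarith
    · simp
    · have h1 := ConcaveOn.slope_le_of_hasDerivAt h (mem_univ x) (mem_univ (x + y)) (by linarith) hd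
      rw [slope_def_field, div_le_iff₀ (by linarith)] at h1
      linarith
  linarith

namespace BurgersHyp

variable {H : ℝ → ℝ → ℝ → ℝ}

theorem viscSubSol_of_ae (hH : BurgersHyp H) {t₀ t₁ c : ℝ} {u : ℝ → ℝ → ℝ}
    (huc : ContinuousOn (fun z : ℝ × ℝ => u z.1 z.2) (Icc t₀ t₁ ×ˢ univ))
    (hup : ∀ t x, u t (x + 1) = u t x)
    (hloc : ∀ z ∈ Ioc t₀ t₁ ×ˢ (univ : Set ℝ), ∃ K : NNReal,
      ∃ s ∈ 𝓝[Ioc t₀ t₁ ×ˢ (univ : Set ℝ)] z, LipschitzOnWith K (fun w : ℝ × ℝ => u w.1 w.2) s)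
    (hae : ∀ᵐ z ∂(volume.restrict (Ioo t₀ t₁ ×ˢ (univ : Set ℝ))),
      DifferentiableAt ℝ (fun w : ℝ × ℝ => u w.1 w.2) z ∧
      fderiv ℝ (fun w : ℝ × ℝ => u w.1 w.2) z (1, 0)
        + H z.1 z.2 (c + fderiv ℝ (fun w : ℝ × ℝ => u w.1 w.2) z (0, 1)) = 0) :
    ViscSubSol H c 0 (Ioo t₀ t₁ ×ˢ univ) u := by
  refine hH.viscSubSol_of_dominated fun s t hs hst ht ξ g hAC hint => ?_
  obtain ⟨L, hL0, hL⟩ := exists_strip_lipschitz_of_local hs huc hup hloc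
  refine hH.le_action_of_ae hst.le hL0 (fun r hr r' hr' => hL r ⟨hr.1, hr.2.trans ht.le⟩ r'
    ⟨hr'.1, hr'.2.trans ht.le⟩) ?_ hAC hint
  have := ae_mono (Measure.restrict_mono (prod_mono (Ioo_subset_Ioo hs.le ht.le) le_rfl :
    Ioo s t ×ˢ (univ : Set ℝ) ⊆ Ioo t₀ t₁ ×ˢ (univ : Set ℝ)) le_rfl) hae
  filter_upwards [this] with z hz
  exact ⟨hz.1, hz.2.le⟩

end BurgersHyp

namespace BurgersHyp

variable {H : ℝ → ℝ → ℝ → ℝ}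

theorem viscSuperSol_of_semiConcave (hH : BurgersHyp H) {a b c L K : ℝ} {u : ℝ → ℝ → ℝ}
    (hK : 0 < K)
    (hL : ∀ t ∈ Icc a b, ∀ s ∈ Icc a b, ∀ x y, |u t x - u s y| ≤ L * (|t - s| + |x - y|))
    (hae : ∀ᵐ z : ℝ × ℝ, z.1 ∈ Ioo a b →
      DifferentiableAt ℝ (fun w : ℝ × ℝ => u w.1 w.2) z ∧
      0 ≤ fderiv ℝ (fun w : ℝ × ℝ => u w.1 w.2) z (1, 0)
        + H z.1 z.2 (c + fderiv ℝ (fun w : ℝ × ℝ => u w.1 w.2) z (0, 1)))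
    (hsc : ∀ t ∈ Ioo a b, SemiConcaveK (u t) K) : ViscSuperSol H c 0 (Ioo a b ×ˢ univ) u := by
  rintro φ hφ ⟨t, x⟩ ⟨ht, -⟩ hmin
  replace ht : t ∈ Ioo a b := ht
  set F : ℝ × ℝ → ℝ := fun w => u w.1 w.2 with hF
  set Φ := fderiv ℝ φ (t, x) with hΦ
  set p₀ := Φ (0, 1) with hp₀
  set τ := Φ (1, 0) with hτ
  set H₀ := H t x (c + p₀) with hH₀
  change 0 ≤ τ + H₀
  by_contra! hneg
  obtain ⟨η, hη0, hη⟩ : ∃ η > 0, τ + H₀ < -(2 * η) := ⟨-(τ + H₀) / 3, by linarith, by linarith⟩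
  obtain ⟨θ, hθ0, hθ⟩ : ∃ θ > 0, ∀ s y p, |s - t| < θ → |y - x| < θ → |p - p₀| < θ →
      H s y (c + p) < H₀ + η := by
    have hc : Continuous fun q : ℝ × ℝ × ℝ => H q.1 q.2.1 (c + q.2.2) :=
      hH.continuous_H.comp (g := fun q : ℝ × ℝ × ℝ => H q.1 q.2.1 q.2.2)
        (f := fun q : ℝ × ℝ × ℝ => (q.1, q.2.1, c + q.2.2)) (by fun_prop)
    obtain ⟨θ, hθ0, hθ⟩ := Metric.eventually_nhds_iff.1
      ((hc.tendsto (t, x, p₀)).eventually_lt_const (u := H₀ + η) (lt_add_of_pos_right H₀ hη0))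
    refine ⟨θ, hθ0, fun s y p hs hy hp => hθ (y := (s, y, p)) ?_⟩
    simp only [Prod.dist_eq, Real.dist_eq]
    exact max_lt hs (max_lt hy hp)
  obtain ⟨ε, hε0, hεη, hεθ⟩ : ∃ ε > 0, ε ≤ η ∧ ε ≤ θ / 5 :=
    ⟨min η (θ / 5), by positivity, min_le_left _ _, min_le_right _ _⟩
  obtain ⟨R, hR0, hRφ, hRmin, hRt, hRθ⟩ : ∃ R > 0,
      (∀ w ∈ Metric.ball (t, x) R, ‖fderiv ℝ φ w - Φ‖ ≤ ε) ∧
      (∀ w ∈ Metric.ball (t, x) R, u t x - φ (t, x) ≤ F w - φ w) ∧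
      (∀ w ∈ Metric.ball (t, x) R, w.1 ∈ Ioo a b) ∧ R ≤ θ := by
    have h1 : ∀ᶠ w in 𝓝 (t, x), ‖fderiv ℝ φ w - Φ‖ ≤ ε := by
      have : Continuous fun w => ‖fderiv ℝ φ w - Φ‖ :=
        ((hφ.continuous_fderiv (by norm_num)).sub continuous_const).norm
      exact (this.continuousAt.eventually_lt_const (by simpa [hΦ] using hε0)).mono
        fun _ => le_of_lt
    have h2 : ∀ᶠ w : ℝ × ℝ in 𝓝 (t, x), w.1 ∈ Ioo a b :=
      (continuous_fst.tendsto (t, x)).eventually (isOpen_Ioo.mem_nhds ht)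
    obtain ⟨R, hR0, hR⟩ := Metric.eventually_nhds_iff.1 (h1.and (h2.and hmin))
    refine ⟨min R θ, by positivity, fun w hw => (hR (hw.trans_le (min_le_left _ _))).1,
      fun w hw => (hR (hw.trans_le (min_le_left _ _))).2.2,
      fun w hw => (hR (hw.trans_le (min_le_left _ _))).2.1, min_le_right _ _⟩
  have hmv : ∀ w ∈ Metric.ball (t, x) R, ∀ w' ∈ Metric.ball (t, x) R,
      |φ w' - φ w - Φ (w' - w)| ≤ ε * ‖w' - w‖ := fun w hw w' hw' =>
    (convex_ball _ _).norm_image_sub_le_of_norm_fderiv_le'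
      (fun v _ => hφ.differentiable (by norm_num) v) hRφ hw hw'
  obtain ⟨ρ, hρ0, hρR, hρK⟩ : ∃ ρ > 0, ρ ≤ R / 2 ∧ K * ρ ≤ θ / 5 := by
    refine ⟨min (R / 2) (θ / 5 / K), by positivity, min_le_left _ _, ?_⟩
    rw [mul_comm, ← le_div_iff₀ hK]
    exact min_le_right _ _
  obtain ⟨σ, hσ0, hσR, hσ⟩ : ∃ σ > 0, σ < R / 2 ∧ ∀ s y, |s - t| ≤ σ → |y - x| ≤ σ →
      u s y - φ (s, y) < u t x - φ (t, x) + ρ * θ / 5 := by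
    have h1 : ContinuousAt (fun w => F w - φ w) (t, x) :=
      ((continuousOn_of_strip_lipschitz hL).continuousAt
        (prod_mem_nhds (Icc_mem_nhds ht.1 ht.2) univ_mem)).sub hφ.continuous.continuousAt
    obtain ⟨r, hr0, hr⟩ := Metric.eventually_nhds_iff.1 (h1.eventually_lt_const
      (u := u t x - φ (t, x) + ρ * θ / 5) (lt_add_of_pos_right _ (by positivity)))
    refine ⟨min r (R / 2) / 2, by positivity, by linarith [min_le_right r (R / 2)],
      fun s y hs hy => hr (y := (s, y)) ?_⟩
    rw [Prod.dist_eq, Real.dist_eq, Real.dist_eq]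
    have := min_le_left r (R / 2)
    have : 0 < min r (R / 2) := by positivity
    exact max_lt (by simp only; linarith) (by simp only; linarith)
  have hball : ∀ s y, |s - t| < R → |y - x| < R → (s, y) ∈ Metric.ball (t, x) R := fun s y hs hy => by
    rw [Metric.mem_ball, Prod.dist_eq, Real.dist_eq, Real.dist_eq]
    exact max_lt hs hy
  have hderiv : ∀ s y, |s - t| ≤ σ → |y - x| ≤ σ → DifferentiableAt ℝ F (s, y) →
      0 ≤ fderiv ℝ F (s, y) (1, 0) + H s y (c + fderiv ℝ F (s, y) (0, 1)) →
      ∃ f', HasDerivAt (fun s => -u s y) f' s ∧ f' ≤ H₀ + η := by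
    intro s y hs hy hd heq
    set p := fderiv ℝ F (s, y) (0, 1) with hp
    have hdt : HasDerivAt (fun s => u s y) (fderiv ℝ F (s, y) (1, 0)) s :=
      hd.hasFDerivAt.comp_hasDerivAt (f := fun s : ℝ => (s, y)) s
        ((hasDerivAt_id s).prodMk (hasDerivAt_const s y))
    have hdx : HasDerivAt (u s) p y :=
      hd.hasFDerivAt.comp_hasDerivAt (f := fun y : ℝ => (s, y)) y
        ((hasDerivAt_const y s).prodMk (hasDerivAt_id y))
    have hsy : (s, y) ∈ Metric.ball (t, x) R := hball s y (by linarith) (by linarith)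
    have hside : ∀ h, |h| = ρ → -(ρ * θ) < (p - p₀) * h := by
      intro h hh
      have h1 := (hsc s (hRt _ hsy)).le_tangent hdx h
      have hyh : (s, y + h) ∈ Metric.ball (t, x) R := by
        refine hball s _ (by linarith) ?_
        have := abs_add_le (y - x) h
        rw [show y + h - x = y - x + h by ring]
        linarith
      have h2 := hmv _ hsy _ hyh
      have h3 : Φ ((s, y + h) - (s, y)) = p₀ * h := by
        have : ((s, y + h) - (s, y) : ℝ × ℝ) = h • (0, 1) := by ext <;> simp
        rw [this, map_smul, smul_eq_mul, mul_comm]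
      have h4 : ‖((s, y + h) - (s, y) : ℝ × ℝ)‖ = ρ := by
        simp [Prod.norm_def, hh, hρ0.le]
      rw [h3, h4] at h2
      have h5 := hRmin _ hyh
      simp only [hF] at h5
      have h6 := hσ s y hs hy
      have h7 : h ^ 2 = ρ * ρ := by rw [← sq_abs, hh, sq]
      rw [h7] at h1
      have h8 := (abs_le.1 h2).1
      have h9 := mul_le_mul_of_nonneg_right hρK hρ0.le
      have h10 := mul_le_mul_of_nonneg_right hεθ hρ0.le
      have h11 := mul_pos hρ0 hθ0
      linarith
    have hpp : |p - p₀| < θ := by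
      have h1 := hside ρ (abs_of_pos hρ0)
      have h2 := hside (-ρ) (by rw [abs_neg, abs_of_pos hρ0])
      rw [abs_lt]
      constructor <;> nlinarith
    refine ⟨_, hdt.neg, ?_⟩
    have := hθ s y p (by linarith) (by linarith) hpp
    linarith
  have hts : t - σ ∈ Ioo a b := hRt (t - σ, x) (hball _ _ (by simp [abs_of_pos hσ0]; linarith)
    (by simpa using hR0))
  have hL0 : 0 ≤ L := by
    have := (abs_nonneg _).trans (hL t (Ioo_subset_Icc_self ht) t (Ioo_subset_Icc_self ht) 1 0)
    simpa using this
  have hline : ∀ᵐ y, |y - x| ≤ σ → u (t - σ) y - u t y ≤ σ * (H₀ + η) := by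
    have hswap := Measure.ae_ae_of_ae_prod (μ := (volume : Measure ℝ)) (ν := (volume : Measure ℝ))
      (Measure.measurePreserving_swap.quasiMeasurePreserving.ae hae)
    filter_upwards [hswap] with y hy hyx
    have h1 := sub_le_integral_of_ae_hasDerivAt_le (f := fun s => -u s y) (h := fun _ => L)
      (k := fun _ => H₀ + η) (a := t - σ) (b := t) (by linarith) (by simp) (by simp) ?_ ?_
    · simp at h1
      linarith
    · intro r hr s hs
      have := hL r ⟨hts.1.le.trans hr.1, hr.2.trans ht.2.le⟩ s
        ⟨hts.1.le.trans hs.1, hs.2.trans ht.2.le⟩ y y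
      simp only [intervalIntegral.integral_const, smul_eq_mul, abs_mul, abs_of_nonneg hL0]
      rw [sub_self, abs_zero, add_zero, abs_sub_comm r s, mul_comm] at this
      rwa [neg_sub_neg]
    · filter_upwards [hy] with s hs hst
      obtain ⟨hd, heq⟩ := hs ⟨hts.1.trans hst.1, hst.2.trans ht.2⟩
      refine hderiv s y ?_ hyx hd heq
      rw [abs_le]
      constructor <;> linarith [hst.1, hst.2]
  have hx : u (t - σ) x - u t x ≤ σ * (H₀ + η) := by
    refine le_of_forall_pos_le_add fun e he => ?_
    obtain ⟨y, hy, hyx⟩ := (Measure.dense_of_ae hline).exists_dist_lt x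
      (ε := min σ (e / (2 * L + 1))) (by positivity)
    rw [dist_comm, Real.dist_eq] at hyx
    have h1 := hy (hyx.le.trans (min_le_left _ _))
    have h2 := (lt_min_iff.1 hyx).2.le
    rw [le_div_iff₀ (by positivity)] at h2
    have h3 := hL t (Ioo_subset_Icc_self ht) t (Ioo_subset_Icc_self ht) y x
    have h4 := hL _ (Ioo_subset_Icc_self hts) _ (Ioo_subset_Icc_self hts) y x
    rw [sub_self, abs_zero, zero_add] at h3 h4
    have h5 := (abs_le.1 h3).2
    have h6 := (abs_le.1 h4).1
    have h7 := abs_nonneg (y - x)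
    linarith
  have hz : (t - σ, x) ∈ Metric.ball (t, x) R := hball _ _ (by simp [abs_of_pos hσ0]; linarith)
    (by simpa using hR0)
  have h1 := hRmin _ hz
  have h2 := hmv _ (Metric.mem_ball_self hR0) _ hz
  have h3 : Φ ((t - σ, x) - (t, x)) = -(τ * σ) := by
    have : ((t - σ, x) - (t, x) : ℝ × ℝ) = (-σ) • (1, 0) := by ext <;> simp
    rw [this, map_smul, smul_eq_mul]
    ring
  have h4 : ‖((t - σ, x) - (t, x) : ℝ × ℝ)‖ = σ := by
    simp [Prod.norm_def, abs_of_pos hσ0, hσ0.le]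
  rw [h3, h4] at h2
  have h5 := (abs_le.1 h2).1
  simp only [hF] at h1
  nlinarith

theorem viscSol_of_ae (hH : BurgersHyp H) {t₀ t₁ c : ℝ} {u : ℝ → ℝ → ℝ}
    (huc : ContinuousOn (fun z : ℝ × ℝ => u z.1 z.2) (Icc t₀ t₁ ×ˢ univ))
    (hup : ∀ t x, u t (x + 1) = u t x)
    (hloc : ∀ z ∈ Ioc t₀ t₁ ×ˢ (univ : Set ℝ), ∃ K : NNReal,
      ∃ s ∈ 𝓝[Ioc t₀ t₁ ×ˢ (univ : Set ℝ)] z, LipschitzOnWith K (fun w : ℝ × ℝ => u w.1 w.2) s)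
    (hae : ∀ᵐ z ∂(volume.restrict (Ioo t₀ t₁ ×ˢ (univ : Set ℝ))),
      DifferentiableAt ℝ (fun w : ℝ × ℝ => u w.1 w.2) z ∧
      fderiv ℝ (fun w : ℝ × ℝ => u w.1 w.2) z (1, 0)
        + H z.1 z.2 (c + fderiv ℝ (fun w : ℝ × ℝ => u w.1 w.2) z (0, 1)) = 0)
    (hsc : ∃ K : ℝ → ℝ, AntitoneOn K (Ioc t₀ t₁) ∧
      ∀ t ∈ Ioc t₀ t₁, 0 < K t ∧ SemiConcaveK (u t) (K t)) :
    ViscSol H c 0 (Ioo t₀ t₁ ×ˢ univ) u := by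
  refine ⟨hH.viscSubSol_of_ae huc hup hloc hae, ?_⟩
  rintro φ hφ z ⟨hz, -⟩ hmin
  obtain ⟨K, hanti, hK⟩ := hsc
  obtain ⟨a, ha, haz⟩ := exists_between hz.1
  have ha' : a ∈ Ioc t₀ t₁ := ⟨ha, haz.le.trans hz.2.le⟩
  obtain ⟨L, hL0, hL⟩ := exists_strip_lipschitz_of_local ha huc hup hloc
  refine hH.viscSuperSol_of_semiConcave (hK a ha').1 hL ?_ (fun t ht => ?_) φ hφ z
    ⟨⟨haz, hz.2⟩, trivial⟩ hmin
  · rw [ae_restrict_iff' (measurableSet_Ioo.prod .univ)] at hae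
    filter_upwards [hae] with w hw hwa
    have := hw ⟨⟨ha.trans hwa.1, hwa.2⟩, trivial⟩
    exact ⟨this.1, this.2.ge⟩
  · have ht' : t ∈ Ioc t₀ t₁ := ⟨ha.trans ht.1, ht.2.le⟩
    exact (hK t ht').2.mono (hanti ha' ht' ht.1.le)

end BurgersHyp

/-- characterizations of viscosity solutions of `(HJc)` on `[t₀,t₁] × 𝕋`:
(i) the Crandall–Lions definition, (ii) locally Lipschitz + equation a.e. + semi-concavity,
(iii) the Hopf–Lax–Oleinik semigroup property. -/
theorem stmt_2 (H : ℝ → ℝ → ℝ → ℝ) (hH : BurgersHyp H) (c t₀ t₁ : ℝ) (h01 : t₀ < t₁)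
    (u : ℝ → ℝ → ℝ)
    (hcont : ContinuousOn (fun z : ℝ × ℝ => u z.1 z.2) (Icc t₀ t₁ ×ˢ univ))
    (hper : ∀ t x, u t (x + 1) = u t x) :
    (ViscSol H c 0 (Ioo t₀ t₁ ×ˢ univ) u ↔
      ((∀ z ∈ Ioc t₀ t₁ ×ˢ (univ : Set ℝ), ∃ K : NNReal,
          ∃ s ∈ 𝓝[Ioc t₀ t₁ ×ˢ (univ : Set ℝ)] z,
            LipschitzOnWith K (fun w : ℝ × ℝ => u w.1 w.2) s) ∧
        (∀ᵐ z ∂(volume.restrict (Ioo t₀ t₁ ×ˢ (univ : Set ℝ))),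
          DifferentiableAt ℝ (fun w : ℝ × ℝ => u w.1 w.2) z ∧
          fderiv ℝ (fun w : ℝ × ℝ => u w.1 w.2) z (1, 0)
            + H z.1 z.2 (c + fderiv ℝ (fun w : ℝ × ℝ => u w.1 w.2) z (0, 1)) = 0) ∧
        (∃ K : ℝ → ℝ, AntitoneOn K (Ioc t₀ t₁) ∧
          ∀ t ∈ Ioc t₀ t₁, 0 < K t ∧ SemiConcaveK (u t) (K t)))) ∧
    (ViscSol H c 0 (Ioo t₀ t₁ ×ˢ univ) u ↔
      (∀ t t' : ℝ, t₀ ≤ t → t ≤ t' → t' ≤ t₁ → ∀ x, u t' x = hlo H c t t' (u t) x)) := by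
  have hiii : (∀ t t' : ℝ, t₀ ≤ t → t ≤ t' → t' ≤ t₁ → ∀ x, u t' x = hlo H c t t' (u t) x) ↔
      ViscSol H c 0 (Ioo t₀ t₁ ×ˢ univ) u :=
    ⟨hH.viscSol_of_eq_hlo hcont hper, fun hu t t' ht htt ht' x => hH.eq_hlo_of_viscSol htt
      (hcont.mono (prod_mono (Icc_subset_Icc ht ht') le_rfl)) hper
      (hu.mono (prod_mono (Ioo_subset_Ioo ht ht') le_rfl)) x⟩
  exact ⟨⟨fun hu => ⟨hH.locallyLipschitz_of_viscSol h01 hcont hper hu,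
      hH.ae_eq_of_viscSol h01 hcont hper hu, hH.exists_semiConcave_of_viscSol h01 hcont hper hu⟩,
    fun h => hH.viscSol_of_ae hcont hper h.1 h.2.1 h.2.2⟩, hiii.symm⟩
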